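/- arXiv:math/0010237 — 3 statements merged into one kernel-verified Lean document; each statement's English description precedes it below -/
import Mathlib

section
/- Let (M, s) be an oriented Lagrangian matroid with fundamental basis F and matroid polytope P. For a basis ω, a height-increasing path from F to ω is a sequence F = v_0, v_1, …, v_s = ω of bases in which consecutive bases are adjacent vertices of P and h(v_{i−1}) < h(v_i) for all 1 ≤ i ≤ s, where h is height relative to F. Then the number of changes of sign of A ↦ s(F,A) along any height-increasing path from F to any basis of maximal height relative to F is the same. -/
open Finset Matrix
open scoped Classical

/-- The index set `J = I ∪ I*`: the element `(i, false)` represents the unstarred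
index `i+1`, and `(i, true)` represents the starred index `(i+1)*`. -/
abbrev JJ (n : ℕ) := Fin n × Bool

/-- The involution `* : J → J`. -/
def starJ {n : ℕ} (x : JJ n) : JJ n := (x.1, !x.2)

/-- A subset `A ⊆ J` is admissible iff `A ∩ A* = ∅`. -/
def AdmissibleSet {n : ℕ} (A : Finset (JJ n)) : Prop := ∀ x ∈ A, starJ x ∉ A

/-- An admissible permutation of `J`: one commuting with `*`.  These form the
hyperoctahedral group `W = BC_n`. -/
def AdmissiblePerm {n : ℕ} (w : Equiv.Perm (JJ n)) : Prop := ∀ x, w (starJ x) = starJ (w x)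

/-- The standard ordering `n* < … < 1* < 1 < … < n` on `J`, encoded by a value in `ℤ`. -/
def ordJ {n : ℕ} (x : JJ n) : ℤ := if x.2 then -((x.1 : ℤ) + 1) else (x.1 : ℤ) + 1

/-- The ordering `≤^w` on `J`: `x ≤^w y` iff `w⁻¹ x ≤ w⁻¹ y` in the standard order. -/
def leW {n : ℕ} (w : Equiv.Perm (JJ n)) (x y : JJ n) : Prop :=
  ordJ (w.symm x) ≤ ordJ (w.symm y)

/-- The (Gale) ordering induced by `≤^w` on admissible subsets: `A ≼^w B` iff the
sorted lists dominate componentwise, equivalently iff there is a bijection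
`f : A → B` with `a ≤^w f a` for all `a ∈ A`. -/
def setLE {n : ℕ} (w : Equiv.Perm (JJ n)) (A B : Finset (JJ n)) : Prop :=
  ∃ f : JJ n → JJ n, Set.BijOn f ↑A ↑B ∧ ∀ a ∈ A, leW w a (f a)

/-- `ℬ` is the collection of bases of a symplectic matroid of rank `k`: all members
are admissible `k`-sets, and for every admissible permutation `w` there is a
(necessarily unique) `≤^w`-maximal member (the Maximality Property). -/
def IsSymplecticMatroid {n : ℕ} (k : ℕ) (ℬ : Finset (Finset (JJ n))) : Prop :=
  (∀ A ∈ ℬ, AdmissibleSet A ∧ A.card = k) ∧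
  ∀ w : Equiv.Perm (JJ n), AdmissiblePerm w → ∃ A ∈ ℬ, ∀ B ∈ ℬ, setLE w B A

/-- A Lagrangian matroid is a symplectic matroid of rank `n`. -/
def IsLagrangianMatroid {n : ℕ} (ℬ : Finset (Finset (JJ n))) : Prop :=
  IsSymplecticMatroid n ℬ
/-- The vector `e_j ∈ ℝ^n` for `j ∈ J`: `e_i` for unstarred `i`, `-e_i` for starred. -/
def eVec {n : ℕ} (x : JJ n) : Fin n → ℝ :=
  fun i => if i = x.1 then (if x.2 then -1 else 1) else 0

/-- The point `e_A = Σ_{j ∈ A} e_j ∈ ℝ^n` associated to an admissible set `A`. -/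
def eSet {n : ℕ} (A : Finset (JJ n)) : Fin n → ℝ := ∑ x ∈ A, eVec x

/-- The matroid polytope: the convex hull of the points `e_A`, `A ∈ ℬ`. -/
def matroidPolytope {n : ℕ} (ℬ : Finset (Finset (JJ n))) : Set (Fin n → ℝ) :=
  convexHull ℝ (eSet '' ↑ℬ)

/-- Bases `A` and `B` are joined by an edge of the matroid polytope: there is a linear
functional taking equal maximal values at `e_A`, `e_B` and strictly smaller values at
all other vertices. -/
def IsEdge {n : ℕ} (ℬ : Finset (Finset (JJ n))) (A B : Finset (JJ n)) : Prop :=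
  A ∈ ℬ ∧ B ∈ ℬ ∧ A ≠ B ∧
  ∃ L : (Fin n → ℝ) →ₗ[ℝ] ℝ, L (eSet A) = L (eSet B) ∧
    ∀ C ∈ ℬ, C ≠ A → C ≠ B → L (eSet C) < L (eSet A)

/-- The height of `A` relative to the fundamental basis `F`: `h(A) = n - |A ∩ F|`. -/
def heightF {n : ℕ} (F A : Finset (JJ n)) : ℕ := n - (A ∩ F).card

/-- A short edge: an edge whose ends are related by a short exchange `A = B ∆ {i,i*}`. -/
def IsShortEdge {n : ℕ} (ℬ : Finset (Finset (JJ n))) (A B : Finset (JJ n)) : Prop :=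
  IsEdge ℬ A B ∧ ∃ i : JJ n, symmDiff A B = ({i, starJ i} : Finset (JJ n))

/-- A long edge: an edge whose ends are related by a long exchange
`A = B ∆ {i,i*,j,j*}`, `i ∉ {j,j*}`. -/
def IsLongEdge {n : ℕ} (ℬ : Finset (Finset (JJ n))) (A B : Finset (JJ n)) : Prop :=
  IsEdge ℬ A B ∧ ∃ i j : JJ n, i ≠ j ∧ i ≠ starJ j ∧
    symmDiff A B = ({i, starJ i, j, starJ j} : Finset (JJ n))

/-- The four bases of a 2-dimensional face of the matroid polytope which is a square
with short edges (type sSquare): `A`, `A ∆ {i,i*}`, `A ∆ {j,j*}`, `A ∆ {i,i*,j,j*}`,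
all of them bases. -/
def ShortSquare {n : ℕ} (ℬ : Finset (Finset (JJ n))) (v : Fin 4 → Finset (JJ n)) : Prop :=
  ∃ (A : Finset (JJ n)) (i j : JJ n), i.1 ≠ j.1 ∧
    v 0 = A ∧ v 1 = symmDiff A ({i, starJ i} : Finset (JJ n)) ∧
    v 2 = symmDiff A ({j, starJ j} : Finset (JJ n)) ∧
    v 3 = symmDiff A ({i, starJ i, j, starJ j} : Finset (JJ n)) ∧
    ∀ k : Fin 4, v k ∈ ℬ

/-- `sF` is an orientation of the Lagrangian matroid with bases `ℬ` relative to the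
fundamental basis `F`: it takes values `±1` on bases and satisfies axioms (i)–(iv). -/
def IsOrientationRel {n : ℕ} (ℬ : Finset (Finset (JJ n))) (F : Finset (JJ n))
    (sF : Finset (JJ n) → ℤ) : Prop :=
  (∀ A ∈ ℬ, sF A = 1 ∨ sF A = -1) ∧
  (∀ A B : Finset (JJ n), IsLongEdge ℬ A B → heightF F A = heightF F B → sF A = sF B) ∧
  (∀ A B : Finset (JJ n), IsLongEdge ℬ A B → heightF F A ≠ heightF F B → sF A = -sF B) ∧
  (∀ v : Fin 4 → Finset (JJ n), ShortSquare ℬ v →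
    ∀ k : Fin 4,
      ((∀ l m : Fin 4, l ≠ k → m ≠ k → sF (v l) = sF (v m)) ∧
        ∃ l : Fin 4, l ≠ k ∧ sF (v l) ≠ sF (v k)) →
      (∀ l : Fin 4, heightF F (v l) ≤ heightF F (v k)) ∨
      (∀ l : Fin 4, heightF F (v k) ≤ heightF F (v l))) ∧
  sF F = 1

/-- `(ℬ, s)` is an oriented Lagrangian matroid: `s` vanishes when an argument is not a
basis, each `s G` is an orientation relative to `G`, and the change-of-fundamental-basis
rule holds. -/
def IsOrientation {n : ℕ} (ℬ : Finset (Finset (JJ n)))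
    (s : Finset (JJ n) → Finset (JJ n) → ℤ) : Prop :=
  (∀ G A : Finset (JJ n), G ∉ ℬ ∨ A ∉ ℬ → s G A = 0) ∧
  (∀ G ∈ ℬ, IsOrientationRel ℬ G (s G)) ∧
  (∀ G ∈ ℬ, ∀ H ∈ ℬ, ∀ A ∈ ℬ, s G A = s H A * s H G * (-1) ^ ((G \ (H ∪ A)).card))
/-- An increasing path of length `p` in the matroid polytope starting at the
fundamental basis `F`: consecutive vertices are joined by edges and strictly increase
for some linear functional compatible with the height relative to `F`. -/
def IncreasingPath {n : ℕ} (ℬ : Finset (Finset (JJ n))) (F : Finset (JJ n))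
    (v : ℕ → Finset (JJ n)) (p : ℕ) : Prop :=
  v 0 = F ∧ (∀ i < p, IsEdge ℬ (v i) (v (i + 1))) ∧
  ∃ L : (Fin n → ℝ) →ₗ[ℝ] ℝ,
    (∀ A ∈ ℬ, ∀ B ∈ ℬ, heightF F B < heightF F A → L (eSet B) < L (eSet A)) ∧
    ∀ i < p, L (eSet (v i)) < L (eSet (v (i + 1)))

/-- A height-increasing path: consecutive vertices are adjacent in the polytope and
the height relative to `F` strictly increases. -/
def HeightIncreasingPath {n : ℕ} (ℬ : Finset (Finset (JJ n))) (F : Finset (JJ n))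
    (v : ℕ → Finset (JJ n)) (p : ℕ) : Prop :=
  v 0 = F ∧ ∀ i < p, IsEdge ℬ (v i) (v (i + 1)) ∧ heightF F (v i) < heightF F (v (i + 1))

/-- `A` is a basis of maximal height relative to `F`. -/
def MaxHeightBasis {n : ℕ} (ℬ : Finset (Finset (JJ n))) (F A : Finset (JJ n)) : Prop :=
  A ∈ ℬ ∧ ∀ B ∈ ℬ, heightF F B ≤ heightF F A

/-- The number of changes of sign of `sF` along the path `v 0, v 1, …, v p`. -/
def signChanges {n : ℕ} (sF : Finset (JJ n) → ℤ) (v : ℕ → Finset (JJ n)) (p : ℕ) : ℕ :=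
  ((Finset.range p).filter fun i => sF (v i) ≠ sF (v (i + 1))).card

/-- A 2-dimensional (exposed) face of the matroid polytope. -/
def Is2Face {n : ℕ} (ℬ : Finset (Finset (JJ n))) (Fc : Set (Fin n → ℝ)) : Prop :=
  IsExposed ℝ (matroidPolytope ℬ) Fc ∧ Module.finrank ℝ (vectorSpan ℝ Fc) = 2

/-- `v 0, …, v (m-1)` is the cycle of vertices (bases) of the 2-dimensional face `Fc`
of the matroid polytope, consecutive ones (cyclically) being joined by edges. -/
def FaceCycle {n : ℕ} (ℬ : Finset (Finset (JJ n))) (Fc : Set (Fin n → ℝ)) (m : ℕ)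
    (v : ℕ → Finset (JJ n)) : Prop :=
  Is2Face ℬ Fc ∧ 3 ≤ m ∧ (∀ i < m, v i ∈ ℬ ∧ eSet (v i) ∈ Fc) ∧
  (∀ A ∈ ℬ, eSet A ∈ Fc → ∃! i : ℕ, i < m ∧ v i = A) ∧
  ∀ i < m, IsEdge ℬ (v i) (v ((i + 1) % m))

/-- An orientation of the Lagrangian matroid polytope: an assignment `ε` of directions
to short edges (`ε A B = 1` when the edge is directed from `A` to `B`; `ε` vanishes on
non-(short edges)) such that in every 2-dimensional face the number of short edges
directed clockwise equals the number directed anti-clockwise. -/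
def IsPolytopeOrientation {n : ℕ} (ℬ : Finset (Finset (JJ n)))
    (ε : Finset (JJ n) → Finset (JJ n) → ℤ) : Prop :=
  (∀ A B : Finset (JJ n), IsShortEdge ℬ A B → (ε A B = 1 ∨ ε A B = -1) ∧ ε B A = -ε A B) ∧
  (∀ A B : Finset (JJ n), ¬IsShortEdge ℬ A B → ε A B = 0) ∧
  ∀ (Fc : Set (Fin n → ℝ)) (m : ℕ) (v : ℕ → Finset (JJ n)), FaceCycle ℬ Fc m v →
    (∑ i ∈ Finset.range m, ε (v i) (v ((i + 1) % m))) = 0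

/-- An inducing edge relative to `F`, for the polytope orientation `ε`: a vertical long
edge, or a short edge directed downwards (from the higher basis to the lower one). -/
def IsInducingEdge {n : ℕ} (ℬ : Finset (Finset (JJ n)))
    (ε : Finset (JJ n) → Finset (JJ n) → ℤ) (F A B : Finset (JJ n)) : Prop :=
  (IsLongEdge ℬ A B ∧ heightF F A ≠ heightF F B) ∨
  (IsShortEdge ℬ A B ∧
    ((heightF F B < heightF F A ∧ ε A B = 1) ∨ (heightF F A < heightF F B ∧ ε B A = 1)))

/-- The signs `s` are induced from the polytope orientation `ε`: for every fundamental
basis `F`, `s F F = 1`, bases joined by an inducing edge get opposite signs, and bases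
joined by a non-inducing edge get the same sign. -/
def InducedBy {n : ℕ} (ℬ : Finset (Finset (JJ n)))
    (ε : Finset (JJ n) → Finset (JJ n) → ℤ)
    (s : Finset (JJ n) → Finset (JJ n) → ℤ) : Prop :=
  ∀ F ∈ ℬ, s F F = 1 ∧ ∀ A B : Finset (JJ n), IsEdge ℬ A B →
    (IsInducingEdge ℬ ε F A B → s F A = -s F B) ∧
    (¬IsInducingEdge ℬ ε F A B → s F A = s F B)

/-! ### Abstract part: signed delta-matroids on a ground set -/

/-- A delta-matroid with a sign function obeying the orientation axioms relative to `∅`. -/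
structure SignedDelta {α : Type} [DecidableEq α] (D : Finset α → Prop) (sg : Finset α → ℤ) :
    Prop where
  exch : ∀ X Y : Finset α, D X → D Y → ∀ i ∈ symmDiff X Y, ∃ j ∈ symmDiff X Y,
    D (symmDiff X {i, j})
  pm : ∀ A, D A → sg A = 1 ∨ sg A = -1
  hor : ∀ (Z : Finset α) (i j : α), i ≠ j → i ∉ Z → j ∉ Z → D (insert i Z) → D (insert j Z) →
    ¬ (D Z ∧ D (insert i (insert j Z))) → sg (insert i Z) = sg (insert j Z)
  ver : ∀ (Z : Finset α) (i j : α), i ≠ j → i ∉ Z → j ∉ Z → D Z → D (insert i (insert j Z)) →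
    ¬ (D (insert i Z) ∧ D (insert j Z)) → sg (insert i (insert j Z)) = - sg Z
  sq : ∀ (Z : Finset α) (i j : α), i ≠ j → i ∉ Z → j ∉ Z → D Z → D (insert i (insert j Z)) →
    D (insert i Z) → D (insert j Z) → sg Z = sg (insert i (insert j Z)) →
    sg (insert i Z) = sg (insert j Z)

/-- An upward step. -/
def DStep {α : Type} [DecidableEq α] (D : Finset α → Prop) (Z W : Finset α) : Prop :=
  D Z ∧ D W ∧ ((∃ i, i ∉ Z ∧ W = insert i Z) ∨
    ∃ i j, i ≠ j ∧ i ∉ Z ∧ j ∉ Z ∧ W = insert i (insert j Z) ∧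
      ¬ (D (insert i Z) ∧ D (insert j Z)))

/-- Whether the sign changes. -/
def chg {α : Type} (sg : Finset α → ℤ) (Z W : Finset α) : ℕ := if sg Z ≠ sg W then 1 else 0

/-- Upward paths with their number of sign changes. -/
inductive DPath {α : Type} [DecidableEq α] (D : Finset α → Prop) (sg : Finset α → ℤ) :
    Finset α → Finset α → ℕ → Prop
  | nil (Z : Finset α) : D Z → DPath D sg Z Z 0
  | cons (Z W X : Finset α) (k : ℕ) : DStep D Z W → DPath D sg W X k →
      DPath D sg Z X (chg sg Z W + k)

section abstractPart

variable {α : Type} [DecidableEq α] {D : Finset α → Prop} {sg : Finset α → ℤ}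

theorem DStep.ssub {Z W : Finset α} (h : DStep D Z W) : Z ⊂ W := by
  obtain ⟨-, -, h⟩ := h
  rcases h with ⟨i, hi, rfl⟩ | ⟨i, j, hij, hi, hj, rfl, -⟩
  · exact Finset.ssubset_insert hi
  · refine Finset.ssubset_iff_subset_ne.2 ⟨?_, ?_⟩
    · intro x hx; simp [hx]
    · intro h; apply hi; rw [h]; simp

theorem DPath.sub {Z X : Finset α} {k : ℕ} (h : DPath D sg Z X k) : Z ⊆ X := by
  induction h with
  | nil => exact Finset.Subset.refl _
  | cons Z W X k h1 _ ih => exact h1.ssub.subset.trans ih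

theorem DPath.left {Z X : Finset α} {k : ℕ} (h : DPath D sg Z X k) : D Z := by
  cases h with
  | nil _ h => exact h
  | cons _ _ _ _ h => exact h.1

theorem DPath.right {Z X : Finset α} {k : ℕ} (h : DPath D sg Z X k) : D X := by
  induction h with
  | nil _ h => exact h
  | cons _ _ _ _ _ _ ih => exact ih

theorem DPath.snoc {Z X Y : Finset α} {k : ℕ} (h : DPath D sg Z X k) (hs : DStep D X Y) :
    DPath D sg Z Y (k + chg sg X Y) := by
  induction h with
  | nil Z h =>
    have := DPath.cons (sg := sg) Z Y Y 0 hs (DPath.nil Y hs.2.1)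
    simpa using this
  | cons Z W X k h1 h2 ih =>
    have := DPath.cons (sg := sg) Z W Y _ h1 (ih hs)
    simpa [add_assoc] using this

theorem SignedDelta.exUp (H : SignedDelta D sg) {A X : Finset α} (hA : D A) (hX : D X)
    (hAX : A ⊆ X) {i : α} (hi : i ∈ X) (hiA : i ∉ A) :
    D (insert i A) ∨ ∃ j ∈ X, j ∉ A ∧ j ≠ i ∧ D (insert i (insert j A)) := by
  obtain ⟨j, hj, hD⟩ := H.exch A X hA hX i (by simp [Finset.mem_symmDiff, hi, hiA])
  have hj' : j ∈ X ∧ j ∉ A := by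
    rw [Finset.mem_symmDiff] at hj
    rcases hj with ⟨h1, h2⟩ | h
    · exact absurd (hAX h1) h2
    · exact h
  by_cases hji : j = i
  · left
    convert hD using 1
    ext x; simp only [Finset.mem_symmDiff, Finset.mem_insert, Finset.mem_singleton]; grind
  · right
    refine ⟨j, hj'.1, hj'.2, hji, ?_⟩
    convert hD using 1
    ext x; simp only [Finset.mem_symmDiff, Finset.mem_insert, Finset.mem_singleton]; grind

theorem SignedDelta.exists_step (H : SignedDelta D sg) {Z X : Finset α} (hZ : D Z) (hX : D X)
    (hs : Z ⊂ X) : ∃ W, DStep D Z W ∧ W ⊆ X := by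
  obtain ⟨i, hi, hiZ⟩ := Finset.exists_of_ssubset hs
  have short : ∀ i ∈ X, i ∉ Z → D (insert i Z) → ∃ W, DStep D Z W ∧ W ⊆ X := by
    intro i hi hiZ h
    exact ⟨insert i Z, ⟨hZ, h, Or.inl ⟨i, hiZ, rfl⟩⟩, Finset.insert_subset hi hs.subset⟩
  rcases H.exUp hZ hX hs.subset hi hiZ with h | ⟨j, hj, hjZ, hji, h⟩
  · exact short i hi hiZ h
  · by_cases h1 : D (insert i Z)
    · exact short i hi hiZ h1
    · exact ⟨insert i (insert j Z), ⟨hZ, h, Or.inr ⟨i, j, hji.symm, hiZ, hjZ, rfl,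
        fun h => h1 h.1⟩⟩, Finset.insert_subset hi (Finset.insert_subset hj hs.subset)⟩

theorem SignedDelta.exists_path (H : SignedDelta D sg) {X : Finset α} (hX : D X) :
    ∀ (N : ℕ) (Z : Finset α), (X \ Z).card ≤ N → D Z → Z ⊆ X → ∃ k, DPath D sg Z X k := by
  intro N
  induction N with
  | zero =>
    intro Z hN hZ hs
    have : X ⊆ Z := by
      rw [← Finset.sdiff_eq_empty_iff_subset, ← Finset.card_eq_zero]; omega
    have := Finset.Subset.antisymm hs this
    subst this
    exact ⟨0, DPath.nil _ hZ⟩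
  | succ N ih =>
    intro Z hN hZ hs
    by_cases h : Z = X
    · subst h; exact ⟨0, DPath.nil _ hZ⟩
    · obtain ⟨W, hW, hWX⟩ := H.exists_step hZ hX (Finset.ssubset_iff_subset_ne.2 ⟨hs, h⟩)
      have hlt : (X \ W).card < (X \ Z).card := by
        have h1 := Finset.card_lt_card hW.ssub
        have h2 := Finset.card_sdiff_add_card_eq_card hWX
        have h3 := Finset.card_sdiff_add_card_eq_card hs
        omega
      obtain ⟨k, hk⟩ := ih W (by omega) hW.2.1 hWX
      exact ⟨_, DPath.cons Z W X k hW hk⟩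

theorem chg_opp (H : SignedDelta D sg) {A B : Finset α} (hA : D A) (h : sg B = - sg A) :
    chg sg A B = 1 := by
  rcases H.pm A hA with h1 | h1 <;> simp [chg, h, h1]

set_option maxHeartbeats 4000000 in
/-- Local confluence. -/
theorem SignedDelta.local_conf (H : SignedDelta D sg) {Z X : Finset α} (hZ : D Z) (hX : D X)
    (hZX : Z ⊆ X) (ν : Finset α → ℕ)
    (hν : ∀ W W', Z ⊂ W → W' ⊆ X → DStep D W W' → ν W = chg sg W W' + ν W') :
    ∀ W W', W ⊆ X → W' ⊆ X → DStep D Z W → DStep D Z W' →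
      chg sg Z W + ν W = chg sg Z W' + ν W' := by
  -- steps above `Z`
  have short : ∀ (A : Finset α) (i : α), Z ⊂ A → D A → A ⊆ X → i ∈ X → i ∉ A →
      D (insert i A) → ν A = chg sg A (insert i A) + ν (insert i A) := by
    intro A i hA hDA hAX hi hiA hD
    exact hν _ _ hA (Finset.insert_subset hi hAX) ⟨hDA, hD, Or.inl ⟨i, hiA, rfl⟩⟩
  have long : ∀ (A : Finset α) (i j : α), Z ⊂ A → D A → A ⊆ X → i ∈ X → i ∉ A → j ∈ X → j ∉ A →
      i ≠ j → D (insert i (insert j A)) → ¬ (D (insert i A) ∧ D (insert j A)) →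
      sg (insert i (insert j A)) = - sg A ∧
      ν A = 1 + ν (insert i (insert j A)) := by
    intro A i j hA hDA hAX hi hiA hj hjA hij hD hn
    have hv := H.ver A i j hij hiA hjA hDA hD hn
    refine ⟨hv, ?_⟩
    rw [← chg_opp H hDA hv]
    exact hν _ _ hA (Finset.insert_subset hi (Finset.insert_subset hj hAX))
      ⟨hDA, hD, Or.inr ⟨i, j, hij, hiA, hjA, rfl, hn⟩⟩
  have ss1 : ∀ i, i ∉ Z → Z ⊂ insert i Z := fun i hi => Finset.ssubset_insert hi
  have ss2 : ∀ i j, i ∉ Z → j ∉ Z → Z ⊂ insert i (insert j Z) := fun i j hi hj =>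
    (ss1 j hj).trans_subset (Finset.subset_insert _ _)
  -- long step through a short basis
  have L0 : ∀ i j, i ∈ X → i ∉ Z → j ∈ X → j ∉ Z → i ≠ j → D (insert i (insert j Z)) →
      ¬ (D (insert i Z) ∧ D (insert j Z)) → D (insert i Z) →
      chg sg Z (insert i (insert j Z)) + ν (insert i (insert j Z)) =
        chg sg Z (insert i Z) + ν (insert i Z) := by
    intro i j hi hiZ hj hjZ hij hD hn hDi
    have hv := H.ver Z i j hij hiZ hjZ hZ hD hn
    have e : insert i (insert j Z) = insert j (insert i Z) := Finset.insert_comm _ _ _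
    have h1 := short (insert i Z) j (ss1 i hiZ) hDi (Finset.insert_subset hi hZX) hj
      (by simp [hjZ, hij.symm]) (by rw [← e]; exact hD)
    rw [← e] at h1
    rw [h1]
    rcases H.pm _ hZ with h2 | h2 <;> rcases H.pm _ hDi with h3 | h3 <;>
      simp [chg, hv, h2, h3]
  -- two short steps
  have L1 : ∀ i j, i ∈ X → i ∉ Z → j ∈ X → j ∉ Z → i ≠ j → D (insert i Z) → D (insert j Z) →
      chg sg Z (insert i Z) + ν (insert i Z) = chg sg Z (insert j Z) + ν (insert j Z) := by
    intro i j hi hiZ hj hjZ hij hDi hDj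
    have e : insert i (insert j Z) = insert j (insert i Z) := Finset.insert_comm _ _ _
    have hiX := Finset.insert_subset hi hZX
    have hjX := Finset.insert_subset hj hZX
    by_cases hD : D (insert i (insert j Z))
    · have h1 := short (insert i Z) j (ss1 i hiZ) hDi hiX hj
        (by simp [hjZ, hij.symm]) (by rw [← e]; exact hD)
      have h2 := short (insert j Z) i (ss1 j hjZ) hDj hjX hi
        (by simp [hiZ, hij]) hD
      rw [← e] at h1
      rw [h1, h2]
      have hsq := H.sq Z i j hij hiZ hjZ hZ hD hDi hDj
      rcases H.pm _ hZ with h3 | h3 <;> rcases H.pm _ hDi with h4 | h4 <;>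
        rcases H.pm _ hDj with h5 | h5 <;> rcases H.pm _ hD with h6 | h6 <;>
        simp [chg, h3, h4, h5, h6] at hsq ⊢
    · have hs := H.hor Z i j hij hiZ hjZ hDi hDj (fun h => hD h.2)
      rcases H.exUp hDi hX hiX hj (by simp [hjZ, hij.symm]) with h | ⟨k, hk, hkn, hkj, h⟩
      · exact absurd (e ▸ h) hD
      · simp only [Finset.mem_insert, not_or] at hkn
        obtain ⟨-, h1⟩ := long (insert i Z) j k (ss1 i hiZ) hDi hiX hj (by simp [hjZ, hij.symm])
          hk (by simp [hkn]) hkj.symm h (fun h => hD (e ▸ h.1))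
        have e2 : insert j (insert k (insert i Z)) = insert i (insert k (insert j Z)) := by
          ext x; simp only [Finset.mem_insert]; tauto
        obtain ⟨-, h2⟩ := long (insert j Z) i k (ss1 j hjZ) hDj hjX hi (by simp [hiZ, hij])
          hk (by simp [hkn, hkj]) (Ne.symm hkn.1) (e2 ▸ h) (fun h => hD h.1)
        rw [e2] at h1
        rw [h1, h2]; simp [chg, hs]
  -- two long steps sharing an element, no short bases
  have L3 : ∀ i j k, i ∈ X → i ∉ Z → j ∈ X → j ∉ Z → k ∈ X → k ∉ Z → i ≠ j → i ≠ k → j ≠ k →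
      D (insert i (insert j Z)) → D (insert i (insert k Z)) → ¬ D (insert i Z) →
      chg sg Z (insert i (insert j Z)) + ν (insert i (insert j Z)) =
        chg sg Z (insert i (insert k Z)) + ν (insert i (insert k Z)) := by
    intro i j k hi hiZ hj hjZ hk hkZ hij hik hjk hDij hDik hni
    have s1 := H.ver Z i j hij hiZ hjZ hZ hDij (fun h => hni h.1)
    have s2 := H.ver Z i k hik hiZ hkZ hZ hDik (fun h => hni h.1)
    have hijX := Finset.insert_subset hi (Finset.insert_subset hj hZX)
    have hikX := Finset.insert_subset hi (Finset.insert_subset hk hZX)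
    have e : insert k (insert i (insert j Z)) = insert j (insert i (insert k Z)) := by
      ext x; simp only [Finset.mem_insert]; tauto
    by_cases hD : D (insert k (insert i (insert j Z)))
    · have h1 := short _ k (ss2 i j hiZ hjZ) hDij hijX hk (by simp [hkZ, hik.symm, hjk.symm]) hD
      have h2 := short _ j (ss2 i k hiZ hkZ) hDik hikX hj (by simp [hjZ, hij.symm, hjk])
        (e ▸ hD)
      rw [h1, h2, ← e]; simp [chg, s1, s2]
    · rcases H.exUp hDij hX hijX hk (by simp [hkZ, hik.symm, hjk.symm]) with
        h | ⟨l, hl, hln, hlk, h⟩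
      · exact absurd h hD
      · simp only [Finset.mem_insert, not_or] at hln
        obtain ⟨-, h1⟩ := long _ k l (ss2 i j hiZ hjZ) hDij hijX hk
          (by simp [hkZ, hik.symm, hjk.symm]) hl (by simp [hln]) hlk.symm h (fun h => hD h.1)
        have e2 : insert k (insert l (insert i (insert j Z))) =
            insert j (insert l (insert i (insert k Z))) := by
          ext x; simp only [Finset.mem_insert]; tauto
        obtain ⟨-, h2⟩ := long _ j l (ss2 i k hiZ hkZ) hDik hikX hj
          (by simp [hjZ, hij.symm, hjk]) hl (by simp [hln, hlk]) (Ne.symm hln.2.1) (e2 ▸ h)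
          (fun h => hD (e ▸ h.1))
        rw [h1, h2, e2]; simp [chg, s1, s2]
  -- a short step and a disjoint long one, no short bases below the long one
  have L2 : ∀ i j k, i ∈ X → i ∉ Z → j ∈ X → j ∉ Z → k ∈ X → k ∉ Z → i ≠ j → i ≠ k → j ≠ k →
      D (insert i Z) → D (insert j (insert k Z)) → ¬ D (insert j Z) → ¬ D (insert k Z) →
      chg sg Z (insert i Z) + ν (insert i Z) =
        chg sg Z (insert j (insert k Z)) + ν (insert j (insert k Z)) := by
    intro i j k hi hiZ hj hjZ hk hkZ hij hik hjk hDi hDjk hnj hnk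
    have c1 : insert i (insert j Z) = insert j (insert i Z) := Finset.insert_comm _ _ _
    have c2 : insert i (insert k Z) = insert k (insert i Z) := Finset.insert_comm _ _ _
    have c3 : insert j (insert k Z) = insert k (insert j Z) := Finset.insert_comm _ _ _
    by_cases hDij : D (insert i (insert j Z))
    · rw [← L0 i j hi hiZ hj hjZ hij hDij (fun h => hnj h.2) hDi, c1]
      exact L3 j i k hj hjZ hi hiZ hk hkZ hij.symm hjk hik (c1 ▸ hDij) hDjk hnj
    by_cases hDik : D (insert i (insert k Z))
    · rw [← L0 i k hi hiZ hk hkZ hik hDik (fun h => hnk h.2) hDi, c2, c3]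
      exact L3 k i j hk hkZ hi hiZ hj hjZ hik.symm hjk.symm hij (c2 ▸ hDik) (c3 ▸ hDjk) hnk
    have hD : D (insert i (insert j (insert k Z))) := by
      obtain ⟨l, hl, h⟩ := H.exch _ _ hDjk hDi i
        (by simp [Finset.mem_symmDiff, hiZ, hij, hik])
      have hl' : l = i ∨ l = j ∨ l = k := by
        simp only [Finset.mem_symmDiff, Finset.mem_insert] at hl; tauto
      rcases hl' with rfl | rfl | rfl
      · convert h using 1
        ext x; simp only [Finset.mem_symmDiff, Finset.mem_insert, Finset.mem_singleton]; grind
      · exfalso; apply hDik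
        convert h using 1
        ext x; simp only [Finset.mem_symmDiff, Finset.mem_insert, Finset.mem_singleton]; grind
      · exfalso; apply hDij
        convert h using 1
        ext x; simp only [Finset.mem_symmDiff, Finset.mem_insert, Finset.mem_singleton]; grind
    have e2 : insert i (insert j (insert k Z)) = insert j (insert k (insert i Z)) := by
      ext x; simp only [Finset.mem_insert]; tauto
    obtain ⟨s1, h1⟩ := long _ j k (ss1 i hiZ) hDi (Finset.insert_subset hi hZX) hj
      (by simp [hjZ, hij.symm]) hk (by simp [hkZ, hik.symm]) hjk (e2 ▸ hD)
      (fun h => hDij (c1 ▸ h.1))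
    have h2 := short _ i (ss2 j k hjZ hkZ) hDjk
      (Finset.insert_subset hj (Finset.insert_subset hk hZX)) hi (by simp [hiZ, hij, hik]) hD
    have s2 := H.ver Z j k hjk hjZ hkZ hZ hDjk (fun h => hnj h.1)
    rw [h1, h2, e2]
    rcases H.pm _ hZ with h3 | h3 <;> rcases H.pm _ hDi with h4 | h4 <;>
      simp [chg, s1, s2, h3, h4]
  -- two disjoint long steps, no short bases
  have L4 : ∀ i j k l, i ∈ X → i ∉ Z → j ∈ X → j ∉ Z → k ∈ X → k ∉ Z → l ∈ X → l ∉ Z →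
      i ≠ j → i ≠ k → i ≠ l → j ≠ k → j ≠ l → k ≠ l →
      D (insert i (insert j Z)) → D (insert k (insert l Z)) →
      ¬ D (insert i Z) → ¬ D (insert j Z) → ¬ D (insert k Z) → ¬ D (insert l Z) →
      chg sg Z (insert i (insert j Z)) + ν (insert i (insert j Z)) =
        chg sg Z (insert k (insert l Z)) + ν (insert k (insert l Z)) := by
    intro i j k l hi hiZ hj hjZ hk hkZ hl hlZ hij hik hil hjk hjl hkl hDij hDkl hni hnj hnk hnl
    have cm : ∀ a b : α, insert a (insert b Z) = insert b (insert a Z) :=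
      fun a b => Finset.insert_comm _ _ _
    by_cases hDik : D (insert i (insert k Z))
    · rw [L3 i j k hi hiZ hj hjZ hk hkZ hij hik hjk hDij hDik hni, cm i k]
      exact L3 k i l hk hkZ hi hiZ hl hlZ hik.symm hkl hil (cm i k ▸ hDik) hDkl hnk
    by_cases hDil : D (insert i (insert l Z))
    · rw [L3 i j l hi hiZ hj hjZ hl hlZ hij hil hjl hDij hDil hni, cm i l, cm k l]
      exact L3 l i k hl hlZ hi hiZ hk hkZ hil.symm hkl.symm hik (cm i l ▸ hDil)
        (cm k l ▸ hDkl) hnl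
    by_cases hDjk : D (insert j (insert k Z))
    · rw [cm i j, L3 j i k hj hjZ hi hiZ hk hkZ hij.symm hjk hik (cm i j ▸ hDij) hDjk hnj, cm j k]
      exact L3 k j l hk hkZ hj hjZ hl hlZ hjk.symm hkl hjl (cm j k ▸ hDjk) hDkl hnk
    -- triples are not bases
    have T1 : ¬ D (insert i (insert j (insert k Z))) := by
      intro hT
      obtain ⟨m, hm, h⟩ := H.exch _ _ hT hZ i
        (by simp [Finset.mem_symmDiff, hiZ])
      have hm' : m = i ∨ m = j ∨ m = k := by
        simp only [Finset.mem_symmDiff, Finset.mem_insert] at hm; tauto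
      rcases hm' with rfl | rfl | rfl
      · apply hDjk
        convert h using 1
        ext x; simp only [Finset.mem_symmDiff, Finset.mem_insert, Finset.mem_singleton]; grind
      · apply hnk
        convert h using 1
        ext x; simp only [Finset.mem_symmDiff, Finset.mem_insert, Finset.mem_singleton]; grind
      · apply hnj
        convert h using 1
        ext x; simp only [Finset.mem_symmDiff, Finset.mem_insert, Finset.mem_singleton]; grind
    have T2 : ¬ D (insert i (insert k (insert l Z))) := by
      intro hT
      obtain ⟨m, hm, h⟩ := H.exch _ _ hT hZ l
        (by simp [Finset.mem_symmDiff, hlZ])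
      have hm' : m = i ∨ m = k ∨ m = l := by
        simp only [Finset.mem_symmDiff, Finset.mem_insert] at hm; tauto
      rcases hm' with rfl | rfl | rfl
      · apply hnk
        convert h using 1
        ext x; simp only [Finset.mem_symmDiff, Finset.mem_insert, Finset.mem_singleton]; grind
      · apply hni
        convert h using 1
        ext x; simp only [Finset.mem_symmDiff, Finset.mem_insert, Finset.mem_singleton]; grind
      · apply hDik
        convert h using 1
        ext x; simp only [Finset.mem_symmDiff, Finset.mem_insert, Finset.mem_singleton]; grind
    have hD : D (insert k (insert l (insert i (insert j Z)))) := by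
      obtain ⟨m, hm, h⟩ := H.exch _ _ hDij hDkl k
        (by simp [Finset.mem_symmDiff, hkZ, hik.symm, hjk.symm])
      have hm' : m = i ∨ m = j ∨ m = k ∨ m = l := by
        simp only [Finset.mem_symmDiff, Finset.mem_insert] at hm; tauto
      rcases hm' with rfl | rfl | rfl | rfl
      · exfalso; apply hDjk
        convert h using 1
        ext x; simp only [Finset.mem_symmDiff, Finset.mem_insert, Finset.mem_singleton]; grind
      · exfalso; apply hDik
        convert h using 1
        ext x; simp only [Finset.mem_symmDiff, Finset.mem_insert, Finset.mem_singleton]; grind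
      · exfalso; apply T1
        convert h using 1
        ext x; simp only [Finset.mem_symmDiff, Finset.mem_insert, Finset.mem_singleton]; grind
      · convert h using 1
        ext x; simp only [Finset.mem_symmDiff, Finset.mem_insert, Finset.mem_singleton]; grind
    have s1 := H.ver Z i j hij hiZ hjZ hZ hDij (fun h => hni h.1)
    have s2 := H.ver Z k l hkl hkZ hlZ hZ hDkl (fun h => hnk h.1)
    have e1 : insert k (insert i (insert j Z)) = insert i (insert j (insert k Z)) := by
      ext x; simp only [Finset.mem_insert]; tauto
    have e2 : insert k (insert l (insert i (insert j Z))) =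
        insert i (insert j (insert k (insert l Z))) := by
      ext x; simp only [Finset.mem_insert]; tauto
    obtain ⟨-, h1⟩ := long _ k l (ss2 i j hiZ hjZ) hDij
      (Finset.insert_subset hi (Finset.insert_subset hj hZX)) hk
      (by simp [hkZ, hik.symm, hjk.symm]) hl (by simp [hlZ, hil.symm, hjl.symm]) hkl hD
      (fun h => T1 (e1 ▸ h.1))
    obtain ⟨-, h2⟩ := long _ i j (ss2 k l hkZ hlZ) hDkl
      (Finset.insert_subset hk (Finset.insert_subset hl hZX)) hi
      (by simp [hiZ, hik, hil]) hj (by simp [hjZ, hjk, hjl]) hij (e2 ▸ hD)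
      (fun h => T2 h.1)
    rw [h1, h2, e2]; simp [chg, s1, s2]
  -- normal form of a step
  have NF : ∀ W, W ⊆ X → DStep D Z W →
      (∃ i, i ∈ X ∧ i ∉ Z ∧ D (insert i Z) ∧
        chg sg Z W + ν W = chg sg Z (insert i Z) + ν (insert i Z)) ∨
      (∃ i j, i ∈ X ∧ i ∉ Z ∧ j ∈ X ∧ j ∉ Z ∧ i ≠ j ∧ W = insert i (insert j Z) ∧ D W ∧
        ¬ D (insert i Z) ∧ ¬ D (insert j Z)) := by
    rintro W hWX ⟨-, hDW, ⟨i, hiZ, rfl⟩ | ⟨i, j, hij, hiZ, hjZ, rfl, hn⟩⟩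
    · exact Or.inl ⟨i, hWX (by simp), hiZ, hDW, rfl⟩
    · have hi : i ∈ X := hWX (by simp)
      have hj : j ∈ X := hWX (by simp)
      by_cases h1 : D (insert i Z)
      · exact Or.inl ⟨i, hi, hiZ, h1, L0 i j hi hiZ hj hjZ hij hDW hn h1⟩
      by_cases h2 : D (insert j Z)
      · refine Or.inl ⟨j, hj, hjZ, h2, ?_⟩
        have e : insert i (insert j Z) = insert j (insert i Z) := Finset.insert_comm _ _ _
        rw [e]
        exact L0 j i hj hjZ hi hiZ hij.symm (e ▸ hDW) (fun h => h1 h.2) h2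
      · exact Or.inr ⟨i, j, hi, hiZ, hj, hjZ, hij, rfl, hDW, h1, h2⟩
  intro W W' hW hW' hs hs'
  rcases NF W hW hs with ⟨i, hi, hiZ, hDi, e⟩ | ⟨i, j, hi, hiZ, hj, hjZ, hij, rfl, hD, n1, n2⟩ <;>
  rcases NF W' hW' hs' with
    ⟨k, hk, hkZ, hDk, e'⟩ | ⟨k, l, hk, hkZ, hl, hlZ, hkl, rfl, hD', n3, n4⟩
  · rw [e, e']
    by_cases h : i = k
    · rw [h]
    · exact L1 i k hi hiZ hk hkZ h hDi hDk
  · rw [e]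
    have h1 : i ≠ k := by rintro rfl; exact n3 hDi
    have h2 : i ≠ l := by rintro rfl; exact n4 hDi
    exact L2 i k l hi hiZ hk hkZ hl hlZ h1 h2 hkl hDi hD' n3 n4
  · rw [e']
    have h1 : k ≠ i := by rintro rfl; exact n1 hDk
    have h2 : k ≠ j := by rintro rfl; exact n2 hDk
    exact (L2 k i j hk hkZ hi hiZ hj hjZ h1 h2 hij hDk hD n1 n2).symm
  · have cm : ∀ a b : α, insert a (insert b Z) = insert b (insert a Z) :=
      fun a b => Finset.insert_comm _ _ _
    by_cases h1 : i = k
    · subst h1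
      by_cases h2 : j = l
      · rw [h2]
      · exact L3 i j l hi hiZ hj hjZ hl hlZ hij hkl h2 hD hD' n1
    by_cases h2 : i = l
    · subst h2
      rw [cm k i] at hD' ⊢
      by_cases h3 : j = k
      · rw [h3]
      · exact L3 i j k hi hiZ hj hjZ hk hkZ hij h1 h3 hD hD' n1
    by_cases h3 : j = k
    · subst h3
      rw [cm i j] at hD ⊢
      exact L3 j i l hj hjZ hi hiZ hl hlZ hij.symm hkl h2 hD hD' n2
    by_cases h4 : j = l
    · subst h4
      rw [cm i j] at hD ⊢
      rw [cm k j] at hD' ⊢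
      exact L3 j i k hj hjZ hi hiZ hk hkZ hij.symm h3 h1 hD hD' n2
    exact L4 i j k l hi hiZ hj hjZ hk hkZ hl hlZ hij h1 h2 h3 h4 hkl hD hD' n1 n2 n3 n4

theorem SignedDelta.path_unique (H : SignedDelta D sg) {X : Finset α} (hX : D X) :
    ∀ (N : ℕ) (Z : Finset α), (X \ Z).card ≤ N → ∀ k k', DPath D sg Z X k → DPath D sg Z X k' →
      k = k' := by
  intro N
  have key : ∀ W W' : Finset α, W ⊂ W' → W' ⊆ X → (X \ W').card < (X \ W).card := by
    intro W W' h h'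
    have h1 := Finset.card_lt_card h
    have h2 := Finset.card_sdiff_add_card_eq_card h'
    have h3 := Finset.card_sdiff_add_card_eq_card (h.subset.trans h')
    omega
  induction N with
  | zero =>
    intro Z hN k k' h h'
    cases h with
    | nil =>
      cases h' with
      | nil => rfl
      | cons _ W _ k hs hp => exact absurd (hs.ssub.trans_subset hp.sub) (ssubset_irrefl _)
    | cons _ W _ k hs hp =>
      have := key Z W hs.ssub hp.sub
      omega
  | succ N ih =>
    intro Z hN k k' h h'
    cases h with
    | nil =>
      cases h' with
      | nil => rfl
      | cons _ W _ k hs hp => exact absurd (hs.ssub.trans_subset hp.sub) (ssubset_irrefl _)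
    | cons _ W _ k hs hp =>
      cases h' with
      | nil => exact absurd (hs.ssub.trans_subset hp.sub) (ssubset_irrefl _)
      | cons _ W' _ k' hs' hp' =>
        classical
        let ν : Finset α → ℕ := fun A => if h : ∃ k, DPath D sg A X k then h.choose else 0
        have hνp : ∀ A, Z ⊂ A → ∀ m, DPath D sg A X m → ν A = m := by
          intro A hA m hm
          have he : ∃ k, DPath D sg A X k := ⟨m, hm⟩
          have : ν A = he.choose := dif_pos he
          rw [this]
          exact ih A (by have := key Z A hA hm.sub; omega) _ _ he.choose_spec hm
        have := H.local_conf hs.1 hX (hs.ssub.subset.trans hp.sub) ν (by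
          intro A A' hA hA' hst
          obtain ⟨m, hm⟩ := H.exists_path hX _ A' le_rfl hst.2.1 hA'
          rw [hνp A' (hA.trans hst.ssub) m hm]
          exact hνp A hA _ (DPath.cons _ _ _ _ hst hm)) W W' hp.sub hp'.sub hs hs'
        rwa [hνp W hs.ssub k hp, hνp W' hs'.ssub k' hp'] at this

theorem SignedDelta.main (H : SignedDelta D sg) (h0 : D ∅) :
    ∀ (N : ℕ) (X Y : Finset α), (Y \ X).card ≤ N → D X → D Y → (∀ B, D B → B.card ≤ X.card) →
      (∀ B, D B → B.card ≤ Y.card) → ∀ k k', DPath D sg ∅ X k → DPath D sg ∅ Y k' → k = k' := by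
  intro N
  induction N with
  | zero =>
    intro X Y hN hX hY mX mY k k' h h'
    have hs : Y ⊆ X := by
      rw [← Finset.sdiff_eq_empty_iff_subset, ← Finset.card_eq_zero]; omega
    have := Finset.eq_of_subset_of_card_le hs (mY X hX)
    subst this
    exact H.path_unique hX _ _ le_rfl _ _ h h'
  | succ N ih =>
    intro X Y hN hX hY mX mY k k' h h'
    by_cases hs : Y ⊆ X
    · have := Finset.eq_of_subset_of_card_le hs (mY X hX)
      subst this
      exact H.path_unique hX _ _ le_rfl _ _ h h'
    obtain ⟨y, hyY, hyX⟩ := Finset.not_subset.1 hs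
    obtain ⟨m, hm, hD⟩ := H.exch X Y hX hY y (by simp [Finset.mem_symmDiff, hyY, hyX])
    have hm' : m ∈ X ∧ m ∉ Y := by
      rw [Finset.mem_symmDiff] at hm
      rcases hm with hm | hm
      · exact hm
      · exfalso
        have e : symmDiff X {y, m} = insert y (insert m X) := by
          ext x; simp only [Finset.mem_symmDiff, Finset.mem_insert, Finset.mem_singleton]; grind
        have h1 := mX _ hD
        rw [e] at h1
        have h2 : X.card < (insert y (insert m X)).card := by
          apply Finset.card_lt_card
          exact (Finset.ssubset_insert hm.2).trans_subset (Finset.subset_insert _ _)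
        omega
    have hym : y ≠ m := by rintro rfl; exact hyX hm'.1
    set U := X.erase m with hU
    have hXU : insert m U = X := Finset.insert_erase hm'.1
    have hmU : m ∉ U := Finset.notMem_erase _ _
    have hyU : y ∉ U := by simp [hU, hyX]
    have e : symmDiff X {y, m} = insert y U := by
      ext x; simp only [hU, Finset.mem_symmDiff, Finset.mem_insert, Finset.mem_singleton,
        Finset.mem_erase]; grind
    rw [e] at hD
    have cX : X.card = U.card + 1 := by rw [← hXU, Finset.card_insert_of_notMem hmU]
    have cX' : (insert y U).card = U.card + 1 := Finset.card_insert_of_notMem hyU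
    have nb : ¬ D (insert m (insert y U)) := by
      intro h
      have := mX _ h
      rw [Finset.card_insert_of_notMem (by simp [hmU, hym.symm]), cX'] at this
      omega
    have sgn : sg X = sg (insert y U) := by
      have := H.hor U m y hym.symm hmU hyU (by rw [hXU]; exact hX) hD (fun h => nb h.2)
      rwa [hXU] at this
    have fin : ∀ V, D V → DStep D V X → DStep D V (insert y U) → k = k' := by
      intro V hV h1 h2
      obtain ⟨c, hc⟩ := H.exists_path hV _ ∅ le_rfl h0 (Finset.empty_subset _)
      have p1 := hc.snoc h1
      have p2 := hc.snoc h2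
      have q1 := H.path_unique hX _ _ le_rfl _ _ h p1
      have q2 := ih (insert y U) Y (by
        have : Y \ (insert y U) ⊂ Y \ X := by
          refine Finset.ssubset_iff_subset_ne.2 ⟨?_, ?_⟩
          · intro x hx
            simp only [hU, Finset.mem_sdiff, Finset.mem_insert, Finset.mem_erase] at hx ⊢
            grind
          · intro he
            have : y ∈ Y \ X := by simp [hyY, hyX]
            rw [← he] at this
            simp at this
        have := Finset.card_lt_card this
        omega) hD hY (by rw [cX', ← cX]; exact mX) mY _ _ p2 h'
      rw [q1, ← q2]
      simp [chg, sgn]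
    by_cases hDU : D U
    · exact fin U hDU ⟨hDU, hX, Or.inl ⟨m, hmU, hXU.symm⟩⟩ ⟨hDU, hD, Or.inl ⟨y, hyU, rfl⟩⟩
    · obtain ⟨z, hz, hDz⟩ := H.exch X ∅ hX h0 m (by simp [Finset.mem_symmDiff, hm'.1])
      have hzX : z ∈ X := by simpa [Finset.mem_symmDiff] using hz
      have hzm : z ≠ m := by
        rintro rfl
        apply hDU
        convert hDz using 1
        ext x; simp only [hU, Finset.mem_symmDiff, Finset.mem_insert, Finset.mem_singleton,
          Finset.mem_erase]; grind
      have e2 : symmDiff X {m, z} = U.erase z := by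
        ext x; simp only [hU, Finset.mem_symmDiff, Finset.mem_insert, Finset.mem_singleton,
          Finset.mem_erase]; grind
      rw [e2] at hDz
      have hzU : insert z (U.erase z) = U := Finset.insert_erase (by simp [hU, hzX, hzm])
      have hyz : y ≠ z := by rintro rfl; exact hyX hzX
      refine fin _ hDz ⟨hDz, hX, Or.inr ⟨m, z, hzm.symm, ?_, ?_, ?_, ?_⟩⟩
        ⟨hDz, hD, Or.inr ⟨y, z, hyz, ?_, ?_, ?_, ?_⟩⟩
      · simp [hmU]
      · simp
      · rw [hzU, hXU]
      · rw [hzU]; exact fun h => hDU h.2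
      · simp [hyU]
      · simp
      · rw [hzU]
      · rw [hzU]; exact fun h => hDU h.2

end abstractPart

/-! ### Translation of Lagrangian matroids into delta-matroids -/

section translation

variable {n : ℕ}

/-- `A` contains exactly one of `x`, `x*` for each `x`. -/
def FullSet (A : Finset (JJ n)) : Prop := ∀ x, x ∈ A ↔ starJ x ∉ A

theorem fullSet_of_admissible {A : Finset (JJ n)} (h : AdmissibleSet A) (hc : A.card = n) :
    FullSet A := by
  have hinj : Set.InjOn (Prod.fst : JJ n → Fin n) A := by
    rintro ⟨i, b⟩ hx ⟨j, c⟩ hy hxy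
    simp only at hxy
    subst hxy
    have := h _ hx
    simp only [starJ] at this
    cases b <;> cases c <;> simp_all
  have him : A.image Prod.fst = Finset.univ := by
    rw [← Finset.card_eq_iff_eq_univ, Finset.card_image_of_injOn hinj, hc]; simp
  intro x
  refine ⟨h x, fun hx => ?_⟩
  have : x.1 ∈ A.image Prod.fst := by rw [him]; simp
  obtain ⟨y, hy, hyx⟩ := Finset.mem_image.1 this
  obtain ⟨i, b⟩ := x
  obtain ⟨j, c⟩ := y
  simp only at hyx
  subst hyx
  simp only [starJ] at hx
  cases b <;> cases c <;> simp_all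

/-- The basis corresponding to a set of flipped indices. -/
def bet (F : Finset (JJ n)) (S : Finset (Fin n)) : Finset (JJ n) :=
  Finset.univ.filter fun x => (x ∈ F ↔ x.1 ∉ S)

/-- The set of flipped indices of a basis. -/
def phi (F A : Finset (JJ n)) : Finset (Fin n) :=
  Finset.univ.filter fun i => ¬ ((i, false) ∈ A ↔ (i, false) ∈ F)

theorem mem_bet {F : Finset (JJ n)} {S : Finset (Fin n)} {x : JJ n} :
    x ∈ bet F S ↔ (x ∈ F ↔ x.1 ∉ S) := by simp [bet]

theorem bet_phi {F A : Finset (JJ n)} (hF : FullSet F) (hA : FullSet A) :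
    bet F (phi F A) = A := by
  ext ⟨i, b⟩
  have h1 := hF (i, true)
  have h2 := hA (i, true)
  simp only [starJ, Bool.not_true] at h1 h2
  simp only [mem_bet, phi, Finset.mem_filter, Finset.mem_univ, true_and]
  cases b <;> tauto

theorem bet_inj {F : Finset (JJ n)} {S T : Finset (Fin n)} (h : bet F S = bet F T) : S = T := by
  ext i
  have : (i, false) ∈ bet F S ↔ (i, false) ∈ bet F T := by rw [h]
  simp only [mem_bet] at this
  tauto

theorem bet_empty (F : Finset (JJ n)) : bet F ∅ = F := by
  ext x; simp [mem_bet]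

theorem bet_full {F : Finset (JJ n)} (hF : FullSet F) (S : Finset (Fin n)) :
    FullSet (bet F S) := by
  intro x
  have := hF x
  simp only [mem_bet]
  have e : (starJ x).1 = x.1 := rfl
  rw [e]
  tauto

theorem symmDiff_bet {F : Finset (JJ n)} (S T : Finset (Fin n)) :
    symmDiff (bet F S) (bet F T) = Finset.univ.filter fun x => x.1 ∈ symmDiff S T := by
  ext x
  simp only [Finset.mem_symmDiff, mem_bet, Finset.mem_filter, Finset.mem_univ, true_and]
  tauto

theorem heightF_bet {F : Finset (JJ n)} (hF : FullSet F) (hc : F.card = n)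
    (S : Finset (Fin n)) : heightF F (bet F S) = S.card := by
  have e : bet F S ∩ F = F.filter fun x => ¬ x.1 ∈ S := by
    ext x; simp only [mem_bet, Finset.mem_inter, Finset.mem_filter]; tauto
  have h1 : (F.filter fun x => x.1 ∈ S).card = S.card := by
    apply Finset.card_bij (fun x _ => x.1)
    · intro x hx; exact (Finset.mem_filter.1 hx).2
    · rintro ⟨i, b⟩ hx ⟨j, c⟩ hy hxy
      simp only at hxy
      subst hxy
      have h1 := hF (i, false)
      simp only [starJ, Bool.not_false, Finset.mem_filter] at h1 hx hy
      cases b <;> cases c <;> simp_all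
    · intro i hi
      by_cases h : (i, false) ∈ F
      · exact ⟨(i, false), by simp [h, hi], rfl⟩
      · refine ⟨(i, true), ?_, rfl⟩
        have h1 := hF (i, true)
        simp only [starJ, Bool.not_true] at h1
        simp [hi, h1, h]
  have h2 := Finset.card_filter_add_card_filter_not (s := F) (fun x => x.1 ∈ S)
  unfold heightF
  rw [e]
  omega

theorem max_lemma {ℬ : Finset (Finset (JJ n))} (hM : IsLagrangianMatroid ℬ)
    (c : Fin n → Bool) (f : Fin n → ℕ) :
    ∃ A ∈ ℬ, ∀ B ∈ ℬ, ∀ r : ℕ,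
      (Finset.univ.filter fun k => (k, c k) ∈ B ∧ r ≤ f k).card ≤
      (Finset.univ.filter fun k => (k, c k) ∈ A ∧ r ≤ f k).card := by
  let σ := Tuple.sort f
  have hmono : Monotone (f ∘ σ) := Tuple.monotone_sort f
  let w : Equiv.Perm (JJ n) :=
    { toFun := fun x => (σ x.1, xor x.2 (c (σ x.1)))
      invFun := fun x => (σ.symm x.1, xor x.2 (c x.1))
      left_inv := by intro x; simp
      right_inv := by intro x; simp }
  have hw : ∀ x, w.symm x = (σ.symm x.1, xor x.2 (c x.1)) := fun x => rfl
  obtain ⟨A, hA, hmax⟩ := hM.2 w (by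
    rintro ⟨k, b⟩
    change (σ k, xor (!b) (c (σ k))) = (σ k, !(xor b (c (σ k))))
    simp)
  refine ⟨A, hA, fun B hB r => ?_⟩
  obtain ⟨g, hg, hle⟩ := hmax B hB
  have key : ∀ k, (k, c k) ∈ B → (g (k, c k)).2 = c (g (k, c k)).1 ∧ f k ≤ f (g (k, c k)).1 := by
    intro k hk
    have h := hle _ hk
    set y := g (k, c k) with hy
    unfold leW at h
    rw [hw, hw] at h
    simp only [ordJ, Bool.xor_self, Bool.false_eq_true, if_false] at h
    have h2 : xor y.2 (c y.1) = false := by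
      by_contra h3
      rw [Bool.not_eq_false] at h3
      rw [h3, if_pos rfl] at h
      omega
    rw [h2] at h
    simp only [Bool.false_eq_true, if_false] at h
    refine ⟨by simpa using h2, ?_⟩
    have h4 : σ.symm k ≤ σ.symm y.1 := by
      rw [Fin.le_def]; omega
    simpa using hmono h4
  apply Finset.card_le_card_of_injOn (fun k => (g (k, c k)).1)
  · intro k hk
    simp only [Finset.coe_filter, Finset.mem_univ, true_and, Set.mem_setOf_eq] at hk ⊢
    obtain ⟨h1, h2⟩ := key k hk.1
    refine ⟨?_, hk.2.trans h2⟩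
    rw [← h1]
    exact hg.mapsTo hk.1
  · intro k hk l hl hkl
    simp only [Finset.coe_filter, Finset.mem_univ, true_and, Set.mem_setOf_eq] at hk hl hkl
    have h1 := (key k hk.1).1
    have h2 := (key l hl.1).1
    have : g (k, c k) = g (l, c l) := by
      apply Prod.ext hkl
      rw [h1, h2, hkl]
    have := hg.injOn hk.1 hl.1 this
    exact (Prod.ext_iff.1 this).1

theorem max_lemma' {ℬ : Finset (Finset (JJ n))} (hM : IsLagrangianMatroid ℬ)
    {F : Finset (JJ n)} (hF : F ∈ ℬ) (P : Finset (Fin n)) (f : Fin n → ℕ) :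
    ∃ S, bet F S ∈ ℬ ∧ ∀ T, bet F T ∈ ℬ → ∀ r : ℕ,
      (Finset.univ.filter fun k => (k ∈ T ↔ k ∈ P) ∧ r ≤ f k).card ≤
      (Finset.univ.filter fun k => (k ∈ S ↔ k ∈ P) ∧ r ≤ f k).card := by
  have full : ∀ A ∈ ℬ, FullSet A := fun A hA =>
    fullSet_of_admissible (hM.1 A hA).1 (hM.1 A hA).2
  have hFF := full F hF
  have hc : ∀ k, ∃ b, (k, b) ∈ bet F P := by
    intro k
    have := bet_full hFF P (k, false)
    simp only [starJ, Bool.not_false] at this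
    by_cases h : (k, false) ∈ bet F P
    · exact ⟨_, h⟩
    · exact ⟨true, by tauto⟩
  choose c hc using hc
  have hcS : ∀ k S, (k, c k) ∈ bet F S ↔ (k ∈ S ↔ k ∈ P) := by
    intro k S
    have := hc k
    simp only [mem_bet] at this ⊢
    tauto
  obtain ⟨A, hA, h⟩ := max_lemma hM c f
  refine ⟨phi F A, by rwa [bet_phi hFF (full A hA)], fun T hT r => ?_⟩
  have := h _ hT r
  rw [← bet_phi hFF (full A hA)] at this
  simpa only [hcS] using this

theorem lag_exch {ℬ : Finset (Finset (JJ n))} (hM : IsLagrangianMatroid ℬ)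
    {F : Finset (JJ n)} (hF : F ∈ ℬ) (X Y : Finset (Fin n)) (hX : bet F X ∈ ℬ)
    (hY : bet F Y ∈ ℬ) (i : Fin n) (hi : i ∈ symmDiff X Y) :
    ∃ j ∈ symmDiff X Y, bet F (symmDiff X {i, j}) ∈ ℬ := by
  obtain ⟨S, hS, h⟩ := max_lemma' hM hF (symmDiff X {i})
    (fun k => if k = i ∨ k ∉ symmDiff X Y then 1 else 0)
  have h1 := h Y hY 1
  have h0 := h X hX 0
  have e1 : (Finset.univ.filter fun k => (k ∈ Y ↔ k ∈ symmDiff X {i}) ∧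
      1 ≤ (if k = i ∨ k ∉ symmDiff X Y then 1 else 0)) =
      Finset.univ.filter fun k => k = i ∨ k ∉ symmDiff X Y := by
    ext k
    simp only [Finset.mem_filter, Finset.mem_univ, true_and, Finset.mem_symmDiff,
      Finset.mem_singleton] at hi ⊢
    by_cases hk : k = i
    · subst hk; simp; tauto
    · by_cases hx : k ∈ X <;> by_cases hy : k ∈ Y <;> simp [hk, hx, hy]
  have e2 : (Finset.univ.filter fun k => (k ∈ S ↔ k ∈ symmDiff X {i}) ∧
      1 ≤ (if k = i ∨ k ∉ symmDiff X Y then 1 else 0)) ⊆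
      Finset.univ.filter fun k => k = i ∨ k ∉ symmDiff X Y := by
    intro k
    simp only [Finset.mem_filter, Finset.mem_univ, true_and]
    rintro ⟨-, hk⟩
    by_contra h3
    rw [if_neg h3] at hk
    omega
  rw [e1] at h1
  have e3 := Finset.eq_of_subset_of_card_le e2 h1
  have agree : ∀ k, (k = i ∨ k ∉ symmDiff X Y) → (k ∈ S ↔ k ∈ symmDiff X {i}) := by
    intro k hk
    have : k ∈ Finset.univ.filter fun k => k = i ∨ k ∉ symmDiff X Y := by simp only [Finset.mem_filter, Finset.mem_univ, true_and]; exact hk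
    rw [← e3] at this
    exact (Finset.mem_filter.1 this).2.1
  have e4 : (Finset.univ.filter fun k => (k ∈ X ↔ k ∈ symmDiff X {i}) ∧
      0 ≤ (if k = i ∨ k ∉ symmDiff X Y then 1 else 0)) = Finset.univ.erase i := by
    ext k
    simp only [Finset.mem_filter, Finset.mem_univ, true_and, Finset.mem_symmDiff,
      Finset.mem_singleton, Finset.mem_erase, and_true, zero_le]
    tauto
  have e5 : (Finset.univ.filter fun k => (k ∈ S ↔ k ∈ symmDiff X {i}) ∧
      0 ≤ (if k = i ∨ k ∉ symmDiff X Y then 1 else 0)) =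
      Finset.univ.filter fun k => ¬ k ∈ symmDiff S (symmDiff X {i}) := by
    ext k
    simp only [Finset.mem_filter, Finset.mem_univ, true_and, Finset.mem_symmDiff,
      Finset.mem_singleton, and_true, zero_le]
    tauto
  rw [e4, e5, Finset.card_erase_of_mem (Finset.mem_univ _)] at h0
  have h5 := Finset.card_filter_add_card_filter_not (s := (Finset.univ : Finset (Fin n)))
    (fun k => k ∈ symmDiff S (symmDiff X {i}))
  have e6 : (Finset.univ.filter fun k => k ∈ symmDiff S (symmDiff X {i})) =
    symmDiff S (symmDiff X {i}) := by ext k; simp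
  rw [e6] at h5
  have hle : (symmDiff S (symmDiff X {i})).card ≤ 1 := by omega
  rcases Nat.le_one_iff_eq_zero_or_eq_one.1 hle with hz | ho
  · rw [Finset.card_eq_zero] at hz
    have : S = symmDiff X {i} := symmDiff_eq_bot.1 hz
    refine ⟨i, hi, ?_⟩
    rw [this] at hS
    simpa using hS
  · obtain ⟨j, hj⟩ := Finset.card_eq_one.1 ho
    have hjm : j ∈ symmDiff S (symmDiff X {i}) := by rw [hj]; simp
    have hjn : ¬ (j = i ∨ j ∉ symmDiff X Y) := by
      intro h6
      have := agree j h6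
      rw [Finset.mem_symmDiff] at hjm
      tauto
    have hS' : S = symmDiff X {i, j} := by
      have hk : ∀ k, k ∈ symmDiff S (symmDiff X {i}) ↔ k = j := by
        intro k; rw [hj]; simp
      ext k
      have h8 := hk k
      have h9 : j ≠ i := fun h => hjn (Or.inl h)
      simp only [Finset.mem_symmDiff, Finset.mem_insert, Finset.mem_singleton] at h8 ⊢
      clear hk hjn hjm hj ho h5 e6 h0 e5 e4 agree e3 h1 e2 e1 h hS hY hX hM hF hi hle
      by_cases h7 : k = i
      · have h10 : k ≠ j := fun h => h9 (h.symm.trans h7)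
        by_cases a : k ∈ S <;> by_cases b : k ∈ X <;> simp [h7, h10, a, b] at h8 ⊢ <;>
          simp_all
      · by_cases c : k = j <;> by_cases a : k ∈ S <;> by_cases b : k ∈ X <;>
          simp_all
    exact ⟨j, by tauto, hS' ▸ hS⟩

/-! Linear functionals -/

/-- The sign of the `k`-th coordinate of `F`. -/
def epsF (F : Finset (JJ n)) (k : Fin n) : ℝ := if (k, false) ∈ F then 1 else -1

theorem epsF_mul (F : Finset (JJ n)) (k : Fin n) : epsF F k * epsF F k = 1 := by
  unfold epsF; split_ifs <;> norm_num

theorem eSet_bet {F : Finset (JJ n)} (hF : FullSet F) (S : Finset (Fin n)) (k : Fin n) :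
    eSet (bet F S) k = epsF F k * (if k ∈ S then -1 else 1) := by
  have h1 : eSet (bet F S) k = ∑ x : JJ n, if x ∈ bet F S then eVec x k else 0 := by
    rw [eSet, Finset.sum_apply, Finset.sum_ite_mem, Finset.univ_inter]
  rw [h1, Fintype.sum_prod_type]
  rw [Finset.sum_eq_single k]
  · have h2 := hF (k, true)
    simp only [starJ, Bool.not_true] at h2
    simp only [Fintype.sum_bool, mem_bet, eVec, epsF, h2]
    by_cases h3 : (k, false) ∈ F <;> by_cases h4 : k ∈ S <;> simp [h3, h4]
  · intro b _ hb
    apply Finset.sum_eq_zero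
    intro c _
    simp [eVec, Ne.symm hb]
  · simp

theorem lin_bet {F : Finset (JJ n)} (hF : FullSet F) (L : (Fin n → ℝ) →ₗ[ℝ] ℝ) :
    ∃ (C : ℝ) (c : Fin n → ℝ), ∀ S, L (eSet (bet F S)) = C + ∑ k ∈ S, c k := by
  let l : Fin n → ℝ := fun k => L fun j => if k = j then 1 else 0
  refine ⟨∑ k, epsF F k * l k, fun k => -2 * epsF F k * l k, fun S => ?_⟩
  rw [LinearMap.pi_apply_eq_sum_univ L]
  have : ∑ k ∈ S, -2 * epsF F k * l k = ∑ k, if k ∈ S then -2 * epsF F k * l k else 0 := by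
    rw [Finset.sum_ite_mem, Finset.univ_inter]
  rw [this, ← Finset.sum_add_distrib]
  apply Finset.sum_congr rfl
  intro k _
  rw [eSet_bet hF]
  change _ • l k = _
  split_ifs <;> simp <;> ring

theorem exists_lin {F : Finset (JJ n)} (hF : FullSet F) (c : Fin n → ℝ) :
    ∃ (C : ℝ) (L : (Fin n → ℝ) →ₗ[ℝ] ℝ), ∀ S, L (eSet (bet F S)) = C + ∑ k ∈ S, c k := by
  refine ⟨∑ k, -(c k / 2), ∑ k, (-(epsF F k * c k / 2)) • LinearMap.proj k, fun S => ?_⟩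
  have : ∑ k ∈ S, c k = ∑ k, if k ∈ S then c k else 0 := by
    rw [Finset.sum_ite_mem, Finset.univ_inter]
  rw [this, ← Finset.sum_add_distrib, LinearMap.sum_apply]
  apply Finset.sum_congr rfl
  intro k _
  rw [LinearMap.smul_apply, LinearMap.proj_apply, eSet_bet hF, smul_eq_mul]
  have := epsF_mul F k
  split_ifs
  · linear_combination (c k / 2) * this
  · linear_combination (-c k / 2) * this

theorem sum_gain (c : Fin n → ℝ) (S R : Finset (Fin n)) :
    ∑ k ∈ symmDiff S R, c k = ∑ k ∈ S, c k + ∑ k ∈ R, (if k ∈ S then - c k else c k) := by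
  have e : ∀ (T : Finset (Fin n)) (d : Fin n → ℝ), ∑ k ∈ T, d k = ∑ k, if k ∈ T then d k else 0 := by
    intro T d
    rw [Finset.sum_ite_mem, Finset.univ_inter]
  rw [e, e S, e R, ← Finset.sum_add_distrib]
  apply Finset.sum_congr rfl
  intro k _
  simp only [Finset.mem_symmDiff]
  by_cases h1 : k ∈ S <;> by_cases h2 : k ∈ R <;> simp [h1, h2]

/-- Edges have bounded symmetric difference. -/
theorem edge_small {D : Finset (Fin n) → Prop}
    (exch : ∀ X Y : Finset (Fin n), D X → D Y → ∀ i ∈ symmDiff X Y, ∃ j ∈ symmDiff X Y,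
      D (symmDiff X {i, j}))
    {S T : Finset (Fin n)} (hS : D S) (hT : D T) (hne : S ≠ T) (c : Fin n → ℝ)
    (heq : ∑ k ∈ S, c k = ∑ k ∈ T, c k)
    (hlt : ∀ C, D C → C ≠ S → C ≠ T → ∑ k ∈ C, c k < ∑ k ∈ S, c k) :
    (symmDiff S T).card ≤ 2 := by
  by_contra hcard
  push Not at hcard
  set g : Fin n → ℝ := fun k => if k ∈ S then - c k else c k with hg
  have hne' : (symmDiff S T).Nonempty := Finset.card_pos.1 (by omega)
  have hsum : ∑ k ∈ symmDiff S T, g k = 0 := by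
    have := sum_gain c S (symmDiff S T)
    rw [symmDiff_symmDiff_cancel_left] at this
    simp only [hg]
    linarith
  have hne2 : ∀ i j, ({i, j} : Finset (Fin n)) ≠ symmDiff S T := by
    intro i j h
    have := Finset.card_le_two (a := i) (b := j)
    rw [h] at this
    omega
  have hSne : ∀ i j, symmDiff S {i, j} ≠ T := by
    intro i j h
    apply hne2 i j
    rw [← h, symmDiff_symmDiff_cancel_left]
  have hTne : ∀ i j, symmDiff T {i, j} ≠ S := by
    intro i j h
    apply hne2 i j
    rw [← h, symmDiff_comm (symmDiff T _) T, symmDiff_symmDiff_cancel_left]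
  have self : ∀ (A : Finset (Fin n)) i j, symmDiff A {i, j} ≠ A := by
    intro A i j h
    rw [symmDiff_eq_left] at h
    have : i ∈ ({i, j} : Finset (Fin n)) := by simp
    rw [h] at this
    simp at this
  -- exchange from S
  have exS : ∀ i ∈ symmDiff S T, ∃ j ∈ symmDiff S T, (j = i ∧ g i < 0) ∨ (g i + g j < 0) := by
    intro i hi
    obtain ⟨j, hj, hD⟩ := exch S T hS hT i hi
    refine ⟨j, hj, ?_⟩
    have h1 := hlt _ hD (self _ _ _) (hSne _ _)
    rw [sum_gain] at h1
    by_cases hij : i = j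
    · subst hij
      left
      simp only [Finset.pair_eq_singleton, Finset.sum_singleton] at h1
      refine ⟨rfl, ?_⟩
      simp only [hg]; linarith
    · right
      rw [Finset.sum_pair hij] at h1
      simp only [hg]; linarith
  have gT : ∀ k ∈ symmDiff S T, (if k ∈ T then - c k else c k) = - g k := by
    intro k hk
    rw [Finset.mem_symmDiff] at hk
    rcases hk with ⟨h1, h2⟩ | ⟨h1, h2⟩ <;> simp [hg, h1, h2]
  have exT : ∀ i ∈ symmDiff S T, ∃ j ∈ symmDiff S T, (j = i ∧ 0 < g i) ∨ (0 < g i + g j) := by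
    intro i hi
    obtain ⟨j, hj, hD⟩ := exch T S hT hS i (by rwa [symmDiff_comm])
    rw [symmDiff_comm] at hj
    refine ⟨j, hj, ?_⟩
    have h1 := hlt _ hD (hTne _ _) (self _ _ _)
    rw [sum_gain] at h1
    by_cases hij : i = j
    · subst hij
      left
      simp only [Finset.pair_eq_singleton, Finset.sum_singleton] at h1
      refine ⟨rfl, ?_⟩
      rw [gT i hi] at h1
      linarith
    · right
      rw [Finset.sum_pair hij, gT i hi, gT j hj] at h1
      linarith
  obtain ⟨a, ha, hamax⟩ := Finset.exists_max_image _ g hne'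
  obtain ⟨b, hb, hbmin⟩ := Finset.exists_min_image _ g hne'
  have hga : 0 ≤ g a := by
    by_contra h
    have := Finset.sum_neg (s := symmDiff S T) (f := g) (fun k hk => by
      have := hamax k hk; linarith) hne'
    linarith
  have hgb : g b ≤ 0 := by
    by_contra h
    have := Finset.sum_pos (s := symmDiff S T) (f := g) (fun k hk => by
      have := hbmin k hk; linarith) hne'
    linarith
  obtain ⟨j, hj, h1⟩ := exS a ha
  obtain ⟨l, hl, h2⟩ := exT b hb
  have h3 := hbmin j hj
  have h4 := hamax l hl
  rcases h1 with ⟨-, h1⟩ | h1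
  · linarith
  rcases h2 with ⟨-, h2⟩ | h2
  · linarith
  linarith

/-- A functional exposing a long edge. -/
theorem long_functional {D : Finset (Fin n) → Prop} (S : Finset (Fin n)) {i j : Fin n}
    (hij : i ≠ j) (hn : ¬ D (symmDiff S {i})) :
    ∃ c : Fin n → ℝ, ∑ k ∈ S, c k = ∑ k ∈ symmDiff S {i, j}, c k ∧
      ∀ C, D C → C ≠ S → C ≠ symmDiff S {i, j} → ∑ k ∈ C, c k < ∑ k ∈ S, c k := by
  let g : Fin n → ℝ := fun k => if k = i then 1 else if k = j then -1 else -2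
  let c : Fin n → ℝ := fun k => if k ∈ S then - g k else g k
  have hs : ∀ R, ∑ k ∈ symmDiff S R, c k = ∑ k ∈ S, c k + ∑ k ∈ R, g k := by
    intro R
    rw [sum_gain]
    congr 1
    apply Finset.sum_congr rfl
    intro k _
    simp only [c]
    split_ifs <;> ring
  refine ⟨c, ?_, ?_⟩
  · rw [hs, Finset.sum_pair hij]
    simp [g, hij.symm]
  · intro C hC h1 h2
    obtain ⟨R, rfl⟩ : ∃ R, C = symmDiff S R :=
      ⟨symmDiff S C, by rw [symmDiff_symmDiff_cancel_left]⟩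
    rw [hs]
    suffices ∑ k ∈ R, g k < 0 by linarith
    by_cases hR : ∃ k0 ∈ R, k0 ≠ i ∧ k0 ≠ j
    · obtain ⟨k0, hk0, hki, hkj⟩ := hR
      have hb : ∑ k ∈ R, g k ≤ ∑ k ∈ R, ((if k = i then 1 else 0) + (if k = k0 then (-2 : ℝ) else 0)) := by
        apply Finset.sum_le_sum
        intro k _
        simp only [g]
        by_cases e1 : k = i
        · subst e1; simp [hki.symm]
        · by_cases e2 : k = j
          · subst e2; simp [e1, hkj.symm]
          · simp only [e1, e2, if_false]
            split_ifs <;> norm_num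
      rw [Finset.sum_add_distrib, Finset.sum_ite_eq', Finset.sum_ite_eq', if_pos hk0] at hb
      split_ifs at hb <;> linarith
    · push Not at hR
      have hR' : ∀ k ∈ R, k = i ∨ k = j := fun k hk => by
        by_cases h : k = i
        · exact Or.inl h
        · exact Or.inr (hR k hk h)
      by_cases hi : i ∈ R <;> by_cases hj : j ∈ R
      · exfalso; apply h2
        have : R = {i, j} := by ext k; simp only [Finset.mem_insert, Finset.mem_singleton]; grind
        rw [this]
      · exfalso; apply hn
        have : R = {i} := by ext k; simp only [Finset.mem_singleton]; grind
        rwa [this] at hC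
      · have : R = {j} := by ext k; simp only [Finset.mem_singleton]; grind
        rw [this]; simp [g, hij.symm]
      · exfalso; apply h1
        have : R = ∅ := by ext k; simp only [Finset.notMem_empty]; grind
        rw [this]; simp

theorem long_edge {ℬ : Finset (Finset (JJ n))}
    (full : ∀ A ∈ ℬ, FullSet A) {F : Finset (JJ n)} (hF : F ∈ ℬ) (S : Finset (Fin n))
    {i j : Fin n} (hij : i ≠ j) (hS : bet F S ∈ ℬ) (hT : bet F (symmDiff S {i, j}) ∈ ℬ)
    (hn : ¬ (bet F (symmDiff S {i}) ∈ ℬ ∧ bet F (symmDiff S {j}) ∈ ℬ)) :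
    IsLongEdge ℬ (bet F S) (bet F (symmDiff S {i, j})) := by
  have hc : ∃ c : Fin n → ℝ, ∑ k ∈ S, c k = ∑ k ∈ symmDiff S {i, j}, c k ∧
      ∀ C, bet F C ∈ ℬ → C ≠ S → C ≠ symmDiff S {i, j} → ∑ k ∈ C, c k < ∑ k ∈ S, c k := by
    by_cases h : bet F (symmDiff S {i}) ∈ ℬ
    · rw [Finset.pair_comm]
      exact long_functional (D := fun S => bet F S ∈ ℬ) S hij.symm (fun h' => hn ⟨h, h'⟩)
    · exact long_functional (D := fun S => bet F S ∈ ℬ) S hij h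
  obtain ⟨c, h1, h2⟩ := hc
  obtain ⟨C, L, hL⟩ := exists_lin (full F hF) c
  refine ⟨⟨hS, hT, ?_, L, ?_, ?_⟩, (i, false), (j, false), ?_, ?_, ?_⟩
  · intro h
    have h3 := bet_inj h
    have : i ∈ S ↔ i ∈ symmDiff S {i, j} := by rw [← h3]
    simp [Finset.mem_symmDiff] at this
  · rw [hL, hL, h1]
  · intro A hA hA1 hA2
    have e := bet_phi (full F hF) (full A hA)
    rw [← e, hL, hL]
    have := h2 (phi F A) (by rwa [e]) (by intro h; apply hA1; rw [← e, h])
      (by intro h; apply hA2; rw [← e, h])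
    linarith
  · simpa using hij
  · simp [starJ]
  · rw [symmDiff_bet, symmDiff_symmDiff_cancel_left]
    ext ⟨k, b⟩
    simp only [Finset.mem_filter, Finset.mem_univ, true_and, Finset.mem_insert,
      Finset.mem_singleton, starJ, Prod.mk.injEq, Bool.not_false]
    cases b <;> simp

theorem step_of_edge {ℬ : Finset (Finset (JJ n))} (hM : IsLagrangianMatroid ℬ)
    {F : Finset (JJ n)} (hF : F ∈ ℬ) (S T : Finset (Fin n))
    (he : IsEdge ℬ (bet F S) (bet F T))
    (hh : heightF F (bet F S) < heightF F (bet F T)) :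
    DStep (fun S => bet F S ∈ ℬ) S T := by
  have full : ∀ A ∈ ℬ, FullSet A := fun A hA =>
    fullSet_of_admissible (hM.1 A hA).1 (hM.1 A hA).2
  rw [heightF_bet (full F hF) (hM.1 F hF).2, heightF_bet (full F hF) (hM.1 F hF).2] at hh
  obtain ⟨hS, hT, hne, L, hL1, hL2⟩ := he
  obtain ⟨C, c, hc⟩ := lin_bet (full F hF) L
  have hne' : S ≠ T := by rintro rfl; exact hne rfl
  have heq : ∑ k ∈ S, c k = ∑ k ∈ T, c k := by
    rw [hc, hc] at hL1; linarith
  have hlt : ∀ C, bet F C ∈ ℬ → C ≠ S → C ≠ T → ∑ k ∈ C, c k < ∑ k ∈ S, c k := by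
    intro A hA h1 h2
    have := hL2 _ hA (fun h => h1 (bet_inj h)) (fun h => h2 (bet_inj h))
    rw [hc, hc] at this; linarith
  have hsmall := edge_small (D := fun S => bet F S ∈ ℬ)
    (fun X Y hX hY i hi => lag_exch hM hF X Y hX hY i hi) hS hT hne' c heq hlt
  have hT' : symmDiff S (symmDiff S T) = T := symmDiff_symmDiff_cancel_left _ _
  have hpos : (symmDiff S T).card ≠ 0 := by
    rw [Ne, Finset.card_eq_zero]
    intro h; exact hne' (symmDiff_eq_bot.1 h)
  refine ⟨hS, hT, ?_⟩
  have h12 : (symmDiff S T).card = 1 ∨ (symmDiff S T).card = 2 := by omega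
  rcases h12 with h | h
  · obtain ⟨i, hi⟩ := Finset.card_eq_one.1 h
    rw [hi] at hT'
    left
    have hiS : i ∉ S := by
      intro hiS
      have : T ⊆ S := by
        intro x hx
        rw [← hT', Finset.mem_symmDiff, Finset.mem_singleton] at hx
        grind
      have := Finset.card_le_card this
      omega
    refine ⟨i, hiS, ?_⟩
    rw [← hT']
    ext x; simp only [Finset.mem_symmDiff, Finset.mem_insert, Finset.mem_singleton]; grind
  · obtain ⟨i, j, hij, hi⟩ := Finset.card_eq_two.1 h
    rw [hi] at hT'
    right
    have hcd : ∀ a b, a ≠ b → T = symmDiff S {a, b} → a ∉ S := by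
      intro a b hab hTab haS
      have : T ⊆ insert b (S.erase a) := by
        intro x hx
        rw [hTab] at hx
        simp only [Finset.mem_symmDiff, Finset.mem_insert, Finset.mem_singleton,
          Finset.mem_erase] at hx ⊢
        grind
      have h1 := Finset.card_le_card this
      have h2 := Finset.card_insert_le b (S.erase a)
      have h3 := Finset.card_erase_add_one haS
      omega
    have hiS := hcd i j hij hT'.symm
    have hjS := hcd j i hij.symm (by rw [Finset.pair_comm]; exact hT'.symm)
    have hTe : T = insert i (insert j S) := by
      rw [← hT']
      ext x; simp only [Finset.mem_symmDiff, Finset.mem_insert, Finset.mem_singleton]; grind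
    refine ⟨i, j, hij, hiS, hjS, hTe, ?_⟩
    rintro ⟨h1, h2⟩
    have ne1 : ∀ a, a ∉ S → insert a S ≠ S := fun a ha h => ha (by rw [← h]; simp)
    have hjT : j ∈ T := by rw [hTe]; simp
    have hiT : i ∈ T := by rw [hTe]; simp
    have g1 := hlt _ h1 (ne1 i hiS) (by
      rintro h; rw [← h] at hjT; simp [hij.symm, hjS] at hjT)
    have g2 := hlt _ h2 (ne1 j hjS) (by
      rintro h; rw [← h] at hiT; simp [hij, hiS] at hiT)
    rw [hTe, Finset.sum_insert (by simp [hij, hiS]), Finset.sum_insert hjS] at heq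
    rw [Finset.sum_insert hiS] at g1
    rw [Finset.sum_insert hjS] at g2
    linarith

theorem signedDelta_of_oriented {ℬ : Finset (Finset (JJ n))} (hM : IsLagrangianMatroid ℬ)
    {F : Finset (JJ n)} (hF : F ∈ ℬ) (sF : Finset (JJ n) → ℤ) (ho : IsOrientationRel ℬ F sF) :
    SignedDelta (fun S => bet F S ∈ ℬ) (fun S => sF (bet F S)) := by
  have full : ∀ A ∈ ℬ, FullSet A := fun A hA =>
    fullSet_of_admissible (hM.1 A hA).1 (hM.1 A hA).2
  have ht : ∀ S, heightF F (bet F S) = S.card := heightF_bet (full F hF) (hM.1 F hF).2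
  obtain ⟨hpm, hhor, hver, hsq, -⟩ := ho
  refine ⟨fun X Y hX hY i hi => lag_exch hM hF X Y hX hY i hi, fun A hA => hpm _ hA, ?_, ?_, ?_⟩
  · intro Z i j hij hi hj hDi hDj hn
    have e1 : symmDiff (insert i Z) {i, j} = insert j Z := by
      ext x; simp only [Finset.mem_symmDiff, Finset.mem_insert, Finset.mem_singleton]; grind
    have e2 : symmDiff (insert i Z) {i} = Z := by
      ext x; simp only [Finset.mem_symmDiff, Finset.mem_insert, Finset.mem_singleton]; grind
    have e3 : symmDiff (insert i Z) {j} = insert i (insert j Z) := by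
      ext x; simp only [Finset.mem_symmDiff, Finset.mem_insert, Finset.mem_singleton]; grind
    have := long_edge full hF (insert i Z) hij hDi (by rwa [e1]) (by rwa [e2, e3])
    rw [e1] at this
    apply hhor _ _ this
    rw [ht, ht, Finset.card_insert_of_notMem hi, Finset.card_insert_of_notMem hj]
  · intro Z i j hij hi hj hZ hD hn
    have e1 : symmDiff Z {i, j} = insert i (insert j Z) := by
      ext x; simp only [Finset.mem_symmDiff, Finset.mem_insert, Finset.mem_singleton]; grind
    have e2 : symmDiff Z {i} = insert i Z := by
      ext x; simp only [Finset.mem_symmDiff, Finset.mem_insert, Finset.mem_singleton]; grind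
    have e3 : symmDiff Z {j} = insert j Z := by
      ext x; simp only [Finset.mem_symmDiff, Finset.mem_insert, Finset.mem_singleton]; grind
    have := long_edge full hF Z hij hZ (by rwa [e1]) (by rwa [e2, e3])
    rw [e1] at this
    have h2 := hver _ _ this (by
      rw [ht, ht, Finset.card_insert_of_notMem (by simp [hij, hi]),
        Finset.card_insert_of_notMem hj]; omega)
    rw [h2, neg_neg]
  · intro Z i j hij hi hj hZ hD hDi hDj hs
    let v : Fin 4 → Finset (JJ n) :=
      ![bet F Z, bet F (insert i Z), bet F (insert j Z), bet F (insert i (insert j Z))]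
    have hv : ShortSquare ℬ v := by
      refine ⟨bet F Z, (i, false), (j, false), hij, rfl, ?_, ?_, ?_, ?_⟩
      · change bet F (insert i Z) = _
        ext ⟨x, b⟩
        simp only [Finset.mem_symmDiff, mem_bet, Finset.mem_insert, Finset.mem_singleton, starJ,
          Prod.mk.injEq, Bool.not_false]
        cases b <;> grind
      · change bet F (insert j Z) = _
        ext ⟨x, b⟩
        simp only [Finset.mem_symmDiff, mem_bet, Finset.mem_insert, Finset.mem_singleton, starJ,
          Prod.mk.injEq, Bool.not_false]
        cases b <;> grind
      · change bet F (insert i (insert j Z)) = _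
        ext ⟨x, b⟩
        simp only [Finset.mem_symmDiff, mem_bet, Finset.mem_insert, Finset.mem_singleton, starJ,
          Prod.mk.injEq, Bool.not_false]
        cases b <;> grind
      · intro k
        fin_cases k
        exacts [hZ, hDi, hDj, hD]
    have c0 : heightF F (v 0) = Z.card := ht _
    have c1 : heightF F (v 1) = Z.card + 1 :=
      (ht _).trans (Finset.card_insert_of_notMem hi)
    have c2 : heightF F (v 2) = Z.card + 1 :=
      (ht _).trans (Finset.card_insert_of_notMem hj)
    have c3 : heightF F (v 3) = Z.card + 2 := by
      refine (ht _).trans ?_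
      rw [Finset.card_insert_of_notMem (by simp [hij, hi]), Finset.card_insert_of_notMem hj]
    by_contra hne
    have s0 : sF (v 0) = sF (v 3) := hs
    have s12 : sF (v 1) ≠ sF (v 2) := hne
    have p0 : sF (v 0) = 1 ∨ sF (v 0) = -1 := hpm (v 0) (hZ : v 0 ∈ ℬ)
    have p1 : sF (v 1) = 1 ∨ sF (v 1) = -1 := hpm (v 1) (hDi : v 1 ∈ ℬ)
    have p2 : sF (v 2) = 1 ∨ sF (v 2) = -1 := hpm (v 2) (hDj : v 2 ∈ ℬ)
    have fin : ∀ k : Fin 4, heightF F (v k) = Z.card + 1 →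
        ((∀ l m : Fin 4, l ≠ k → m ≠ k → sF (v l) = sF (v m)) ∧
        ∃ l : Fin 4, l ≠ k ∧ sF (v l) ≠ sF (v k)) → False := by
      intro k hk h
      rcases hsq v hv k h with h1 | h1
      · have := h1 3; omega
      · have := h1 0; omega
    by_cases hc : sF (v 0) = sF (v 1)
    · refine fin 2 c2 ⟨?_, 1, by decide, s12⟩
      have all : ∀ l : Fin 4, l ≠ 2 → sF (v l) = sF (v 0) := by
        intro l hl
        fin_cases l
        · rfl
        · exact hc.symm
        · exact absurd rfl hl
        · exact s0.symm
      intro l m hl hm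
      rw [all l hl, all m hm]
    · have hc' : sF (v 0) = sF (v 2) := by
        clear hs hne c0 c1 c2 c3 s0 fin
        generalize sF (v 0) = a at *
        generalize sF (v 1) = b at *
        generalize sF (v 2) = c at *
        omega
      refine fin 1 c1 ⟨?_, 2, by decide, Ne.symm s12⟩
      have all : ∀ l : Fin 4, l ≠ 1 → sF (v l) = sF (v 0) := by
        intro l hl
        fin_cases l
        · rfl
        · exact absurd rfl hl
        · exact hc'.symm
        · exact s0.symm
      intro l m hl hm
      rw [all l hl, all m hm]

theorem path_of_increasing {ℬ : Finset (Finset (JJ n))} (hM : IsLagrangianMatroid ℬ)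
    {F : Finset (JJ n)} (hF : F ∈ ℬ) (sF : Finset (JJ n) → ℤ) (v : ℕ → Finset (JJ n)) :
    ∀ p, HeightIncreasingPath ℬ F v p →
      DPath (fun S => bet F S ∈ ℬ) (fun S => sF (bet F S)) ∅ (phi F (v p))
        (signChanges sF v p) := by
  have full : ∀ A ∈ ℬ, FullSet A := fun A hA =>
    fullSet_of_admissible (hM.1 A hA).1 (hM.1 A hA).2
  intro p
  induction p with
  | zero =>
    intro h
    have e : phi F (v 0) = ∅ := by
      rw [h.1]; simp [phi]
    rw [e]
    have : signChanges sF v 0 = 0 := by simp [signChanges]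
    rw [this]
    exact DPath.nil _ (by rwa [bet_empty])
  | succ p ih =>
    intro h
    have h1 := ih ⟨h.1, fun i hi => h.2 i (by omega)⟩
    obtain ⟨he, hh⟩ := h.2 p (by omega)
    have e1 := bet_phi (full F hF) (full _ he.1)
    have e2 := bet_phi (full F hF) (full _ he.2.1)
    have hst := step_of_edge hM hF (phi F (v p)) (phi F (v (p + 1))) (by rwa [e1, e2])
      (by rwa [e1, e2])
    have h2 := h1.snoc hst
    have e3 : signChanges sF v (p + 1) = signChanges sF v p +
        chg (fun S => sF (bet F S)) (phi F (v p)) (phi F (v (p + 1))) := by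
      simp only [signChanges, chg, e1, e2]
      rw [Finset.range_add_one, Finset.filter_insert]
      split_ifs with h
      · rw [Finset.card_insert_of_notMem (by simp)]
      · rfl
    rw [e3]
    exact h2

end translation

/-- For an oriented Lagrangian matroid `(ℬ, s)` and a fundamental
basis `F`, the number of changes of sign of `A ↦ s F A` along any height-increasing
path from `F` to any basis of maximal height relative to `F` is the same. -/
theorem index_well_defined_height_increasing {n : ℕ}
    (ℬ : Finset (Finset (JJ n))) (hM : IsLagrangianMatroid ℬ)
    (s : Finset (JJ n) → Finset (JJ n) → ℤ) (hs : IsOrientation ℬ s)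
    (F : Finset (JJ n)) (hF : F ∈ ℬ)
    (v w : ℕ → Finset (JJ n)) (p q : ℕ)
    (hv : HeightIncreasingPath ℬ F v p) (hvmax : MaxHeightBasis ℬ F (v p))
    (hw : HeightIncreasingPath ℬ F w q) (hwmax : MaxHeightBasis ℬ F (w q)) :
    signChanges (s F) v p = signChanges (s F) w q := by
  have full : ∀ A ∈ ℬ, FullSet A := fun A hA =>
    fullSet_of_admissible (hM.1 A hA).1 (hM.1 A hA).2
  have ht : ∀ S, heightF F (bet F S) = S.card := heightF_bet (full F hF) (hM.1 F hF).2
  have H := signedDelta_of_oriented hM hF (s F) (hs.2.1 F hF)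
  have ev := bet_phi (full F hF) (full _ hvmax.1)
  have ew := bet_phi (full F hF) (full _ hwmax.1)
  refine H.main (by rwa [bet_empty]) _ (phi F (v p)) (phi F (w q)) le_rfl
    (by rw [ev]; exact hvmax.1) (by rw [ew]; exact hwmax.1) ?_ ?_ _ _
    (path_of_increasing hM hF (s F) v p hv) (path_of_increasing hM hF (s F) w q hw)
  · intro B hB
    have := hvmax.2 _ hB
    rwa [← ev, ht, ht] at this
  · intro B hB
    have := hwmax.2 _ hB
    rwa [← ew, ht, ht] at this
end

section
/- Let (M, s) be an oriented Lagrangian matroid with fundamental basis F and matroid polytope P. If two increasing paths from F to the same basis of maximal height relative to F differ only as to the route taken through a single 2-dimensional face of P (and agree elsewhere), then they contain the same number of changes of sign of A ↦ s(F,A). -/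
open Finset Matrix
open scoped Classical

section Aux

lemma exists_sorting_perm {n : ℕ} (f : JJ n → ℝ) (hodd : ∀ x, f (starJ x) = - f x) :
    ∃ w : Equiv.Perm (JJ n), AdmissiblePerm w ∧ ∀ x y, leW w x y → f x ≤ f y := by
  set m : Fin n → ℝ := fun i => |f (i, false)| with hm
  set σ := Tuple.sort m with hσ
  have hmono : Monotone (m ∘ σ) := Tuple.monotone_sort m
  let w : Equiv.Perm (JJ n) :=
    { toFun := fun x => (σ x.1, xor x.2 (decide (f (σ x.1, false) < 0)))
      invFun := fun y => (σ.symm y.1, xor y.2 (decide (f (y.1, false) < 0)))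
      left_inv := by
        intro x
        simp [Prod.ext_iff]
      right_inv := by
        intro x
        simp [Prod.ext_iff] }
  have hw : ∀ z : JJ n, f (w z) = if z.2 then -(m (σ z.1)) else m (σ z.1) := by
    rintro ⟨i, b⟩
    have h1 : f (σ i, true) = - f (σ i, false) := by
      have := hodd (σ i, false)
      simpa [starJ] using this
    by_cases h : f (σ i, false) < 0
    · cases b <;> simp [w, hm, h, h1, abs_of_neg h]
    · cases b <;> simp [w, hm, h, h1, abs_of_nonneg (not_lt.mp h)]
  refine ⟨w, ?_, ?_⟩
  · rintro ⟨i, b⟩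
    simp [w, starJ]
  · intro x y hxy
    obtain ⟨z, rfl⟩ := w.surjective x
    obtain ⟨z', rfl⟩ := w.surjective y
    rw [hw, hw]
    simp only [leW, Equiv.symm_apply_apply, ordJ] at hxy
    have p1 : 0 ≤ m (σ z.1) := abs_nonneg _
    have p2 : 0 ≤ m (σ z'.1) := abs_nonneg _
    by_cases h1 : z.2 = true <;> by_cases h2 : z'.2 = true <;>
      simp only [h1, h2, if_true, if_false] at hxy ⊢
    · have : z'.1 ≤ z.1 := by
        rw [Fin.le_def]; omega
      have := hmono this
      simp only [Function.comp] at this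
      linarith
    · simp; linarith
    · simp at hxy; omega
    · have : z.1 ≤ z'.1 := by
        rw [Fin.le_def]; simp at hxy; omega
      have := hmono this
      simpa using this

lemma exists_common_max {n : ℕ} {ℬ : Finset (Finset (JJ n))} (hM : IsLagrangianMatroid ℬ)
    (f g : JJ n → ℝ) (hf : ∀ x, f (starJ x) = - f x) (hg : ∀ x, g (starJ x) = - g x)
    (hfg : ∀ x y, f x < f y → g x ≤ g y) :
    ∃ A ∈ ℬ, ∀ B ∈ ℬ, ∑ x ∈ B, f x ≤ ∑ x ∈ A, f x ∧ ∑ x ∈ B, g x ≤ ∑ x ∈ A, g x := by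
  obtain ⟨w, hw, hmon⟩ := exists_sorting_perm (fun x => f x + g x)
    (by intro x; simp only [hf, hg]; ring)
  obtain ⟨A, hA, hmax⟩ := hM.2 w hw
  refine ⟨A, hA, fun B hB => ?_⟩
  obtain ⟨φ, hφ, hle⟩ := hmax B hB
  have key : ∀ h : JJ n → ℝ, ∑ x ∈ A, h x = ∑ x ∈ B, h (φ x) := by
    intro h
    symm
    exact Finset.sum_bij (fun a _ => φ a) (fun a ha => hφ.1 ha)
      (fun a ha b hb hab => hφ.2.1 ha hb hab)
      (fun b hb => by
        obtain ⟨a, ha, hab⟩ := hφ.2.2 hb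
        exact ⟨a, ha, hab⟩) (fun _ _ => rfl)
  have hfg' : ∀ x y, g x < g y → f x ≤ f y := by
    intro x y h
    by_contra hc
    exact absurd (hfg _ _ (not_le.mp hc)) (not_le.mpr h)
  rw [key, key]
  constructor
  · refine Finset.sum_le_sum fun x hx => ?_
    have := hmon _ _ (hle x hx)
    by_contra hc
    have := hfg _ _ (not_le.mp hc)
    linarith
  · refine Finset.sum_le_sum fun x hx => ?_
    have := hmon _ _ (hle x hx)
    by_contra hc
    have := hfg' _ _ (not_le.mp hc)
    linarith

/-- The transversal associated to a choice function. -/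
def toF {n : ℕ} (a : Fin n → Bool) : Finset (JJ n) := Finset.univ.filter fun x => x.2 = a x.1

lemma mem_toF {n : ℕ} (a : Fin n → Bool) (x : JJ n) : x ∈ toF a ↔ x.2 = a x.1 := by
  simp [toF]

lemma toF_inj {n : ℕ} {a b : Fin n → Bool} (h : toF a = toF b) : a = b := by
  funext i
  have : ((i, a i) : JJ n) ∈ toF b := by rw [← h, mem_toF]
  simpa [mem_toF] using this

lemma exists_toF {n : ℕ} (A : Finset (JJ n)) (hA : AdmissibleSet A) (hc : A.card = n) :
    ∃ a, A = toF a := by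
  have hinj : Set.InjOn (fun x : JJ n => x.1) A := by
    rintro ⟨i, b⟩ hx ⟨j, c⟩ hy hxy
    simp only at hxy
    subst hxy
    have := hA _ hx
    simp only [starJ] at this
    cases b <;> cases c <;> simp_all
  have himg : A.image (fun x : JJ n => x.1) = Finset.univ := by
    apply Finset.eq_univ_of_card
    rw [Finset.card_image_of_injOn hinj, hc, Fintype.card_fin]
  refine ⟨fun i => decide ((i, true) ∈ A), ?_⟩
  ext ⟨i, b⟩
  rw [mem_toF]
  have hi : i ∈ A.image (fun x : JJ n => x.1) := by rw [himg]; simp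
  obtain ⟨⟨j, c⟩, hx, hxy⟩ := Finset.mem_image.mp hi
  simp only at hxy
  subst hxy
  have h1 := hA _ hx
  cases b <;> cases c <;> simp_all [starJ]

lemma sum_toF {n : ℕ} (a : Fin n → Bool) {M : Type*} [AddCommMonoid M] (f : JJ n → M) :
    ∑ x ∈ toF a, f x = ∑ i, f (i, a i) := by
  rw [toF, Finset.sum_filter, Fintype.sum_prod_type]
  refine Finset.sum_congr rfl fun i _ => ?_
  simp

lemma eSet_toF {n : ℕ} (a : Fin n → Bool) (l : Fin n) :
    eSet (toF a) l = if a l then -1 else 1 := by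
  rw [eSet, sum_toF, Finset.sum_apply]
  simp [eVec]

/-- The number of disagreements with `f`. -/
def dist' {n : ℕ} (f a : Fin n → Bool) : ℕ := ∑ l, if a l = f l then 0 else 1

lemma heightF_toF {n : ℕ} (f a : Fin n → Bool) : heightF (toF f) (toF a) = dist' f a := by
  have h1 : (toF a ∩ toF f).card = ∑ l, if a l = f l then 1 else 0 := by
    have : toF a ∩ toF f = (toF a).filter (fun x => x ∈ toF f) := by
      ext x; simp
    rw [this, Finset.card_filter, sum_toF]
    simp [mem_toF]
  have h2 : (∑ l, if a l = f l then 1 else 0) + dist' f a = n := by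
    rw [dist', ← Finset.sum_add_distrib]
    have : ∀ l : Fin n, ((if a l = f l then 1 else 0) + (if a l = f l then 0 else 1) : ℕ) = 1 := by
      intro l; split_ifs <;> rfl
    simp [this]
  rw [heightF, h1]
  omega

set_option maxHeartbeats 800000 in
/-- Edges change one or two coordinates. -/
lemma edge_card {n : ℕ} {ℬ : Finset (Finset (JJ n))} (hM : IsLagrangianMatroid ℬ)
    (a b : Fin n → Bool) (h : IsEdge ℬ (toF a) (toF b)) :
    (Finset.univ.filter fun i => a i ≠ b i).card ≤ 2 := by
  by_contra hcard
  obtain ⟨i, j, k, hi, hj, hk, hij, hik, hjk⟩ :=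
    Finset.two_lt_card_iff.mp (not_le.mp hcard)
  simp only [Finset.mem_filter, Finset.mem_univ, true_and] at hi hj hk
  obtain ⟨hA, hB, hne, L, hL, hmax⟩ := h
  set l : JJ n → ℝ := fun x => L (eVec x) with hl
  have hlodd : ∀ x, l (starJ x) = - l x := by
    intro x
    have : eVec (starJ x) = - eVec x := by
      funext t
      rcases x with ⟨u, c⟩
      by_cases h : t = u <;> cases c <;> simp [eVec, starJ, h]
    simp [hl, this]
  have hLs : ∀ A, L (eSet A) = ∑ x ∈ A, l x := by
    intro A; simp [eSet, hl, map_sum]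
  -- perturbations
  let base : ℝ → JJ n → ℝ := fun c x =>
    (if x.2 = a x.1 then 1 else -1) *
      (if x.1 = i then c else if x.1 = j then -1 else if x.1 = k then -1 else 0)
  have hbodd : ∀ c x, base c (starJ x) = - base c x := by
    rintro c ⟨t, u⟩
    simp only [base, starJ]
    cases u <;> cases a t <;> split_ifs <;> simp_all
  have hbco : ∀ x y, base 3 x < base 3 y → base 1 x ≤ base 1 y := by
    rintro x y
    simp only [base]
    split_ifs <;> norm_num
  have ev1 : ∀ᶠ N : ℝ in Filter.atTop, ∀ x y : JJ n, l x < l y →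
      ∀ c ∈ ({3, 1} : Finset ℝ), N * l x + base c x < N * l y + base c y := by
    refine Filter.eventually_all.mpr fun x => Filter.eventually_all.mpr fun y => ?_
    by_cases hxy : l x < l y
    · simp only [hxy, forall_true_left]
      refine (Filter.eventually_all_finset _).mpr fun c _ => ?_
      filter_upwards [Filter.eventually_gt_atTop ((base c x - base c y) / (l y - l x))] with N hN
      rw [div_lt_iff₀ (by linarith)] at hN
      nlinarith
    · simp [hxy]
  have ev2 : ∀ᶠ N : ℝ in Filter.atTop, ∀ C ∈ ℬ, C ≠ toF a → C ≠ toF b →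
      ∑ x ∈ C, (N * l x + base 3 x) < ∑ x ∈ toF a, (N * l x + base 3 x) := by
    refine (Filter.eventually_all_finset _).mpr fun C hC => ?_
    by_cases h1 : C = toF a
    · simp [h1]
    by_cases h2 : C = toF b
    · simp [h2]
    have h3 := hmax C hC h1 h2
    rw [hLs, hLs] at h3
    filter_upwards [Filter.eventually_gt_atTop ((∑ x ∈ C, base 3 x - ∑ x ∈ toF a, base 3 x) /
      (∑ x ∈ toF a, l x - ∑ x ∈ C, l x))] with N hN _ _
    rw [div_lt_iff₀ (by linarith)] at hN
    rw [Finset.sum_add_distrib, Finset.sum_add_distrib, ← Finset.mul_sum, ← Finset.mul_sum]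
    nlinarith
  obtain ⟨N, hN1, hN2⟩ := (ev1.and ev2).exists
  obtain ⟨C, hC, hCmax⟩ := exists_common_max hM (fun x => N * l x + base 3 x)
    (fun x => N * l x + base 1 x)
    (by intro x; simp only [hlodd, hbodd]; ring)
    (by intro x; simp only [hlodd, hbodd]; ring)
    (by
      intro x y hxy
      rcases lt_trichotomy (l x) (l y) with h | h | h
      · exact (hN1 x y h 1 (by simp)).le
      · simp only [h] at hxy ⊢
        have := hbco x y (by linarith)
        linarith
      · have := hN1 y x h 3 (by simp)
        linarith)
  have sumA : ∀ c, ∑ x ∈ toF a, base c x = c - 2 := by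
    intro c
    rw [sum_toF]
    have : ∀ t : Fin n, base c (t, a t) = (if t = i then c else 0) + (if t = j then -1 else 0)
        + (if t = k then -1 else 0) := by
      intro t
      simp only [base]
      by_cases h1 : t = i
      · subst h1; simp [hij, hik]
      by_cases h2 : t = j
      · subst h2; simp [h1, hjk]
      by_cases h3 : t = k
      · subst h3; simp [h1, h2]
      simp [h1, h2, h3]
    simp only [this, Finset.sum_add_distrib]
    simp
    ring
  have sumB : ∀ c, ∑ x ∈ toF b, base c x = 2 - c := by
    intro c
    rw [sum_toF]
    have : ∀ t : Fin n, base c (t, b t) = (if t = i then -c else 0) + (if t = j then 1 else 0)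
        + (if t = k then 1 else 0) := by
      intro t
      simp only [base]
      by_cases h1 : t = i
      · subst h1; simp [Ne.symm hi, hij, hik]
      by_cases h2 : t = j
      · subst h2; simp [Ne.symm hj, h1, hjk]
      by_cases h3 : t = k
      · subst h3; simp [Ne.symm hk, h1, h2]
      simp [h1, h2, h3]
    simp only [this, Finset.sum_add_distrib]
    simp
    ring
  have hLab : ∑ x ∈ toF a, l x = ∑ x ∈ toF b, l x := by rw [← hLs, ← hLs, hL]
  by_cases h1 : C = toF a
  · subst h1
    have := (hCmax _ hB).2
    rw [Finset.sum_add_distrib, Finset.sum_add_distrib, ← Finset.mul_sum, ← Finset.mul_sum,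
      sumA, sumB, hLab] at this
    linarith
  by_cases h2 : C = toF b
  · subst h2
    have := (hCmax _ hA).1
    rw [Finset.sum_add_distrib, Finset.sum_add_distrib, ← Finset.mul_sum, ← Finset.mul_sum,
      sumA, sumB, hLab] at this
    linarith
  have := hN2 C hC h1 h2
  have := (hCmax _ hA).1
  linarith

/-- The indicator of disagreement at a coordinate. -/
def gI {n : ℕ} (f a : Fin n → Bool) (j : Fin n) : ℕ := if a j = f j then 0 else 1

lemma hdist_one {n : ℕ} (f a b : Fin n → Bool) (j : Fin n) (h : ∀ l, l ≠ j → a l = b l) :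
    dist' f a + gI f b j = dist' f b + gI f a j := by
  have e : ∀ c : Fin n → Bool, dist' f c = gI f c j + ∑ l ∈ Finset.univ.erase j, gI f c l := by
    intro c
    exact (Finset.add_sum_erase Finset.univ (gI f c) (Finset.mem_univ j)).symm
  rw [e a, e b]
  have : ∑ l ∈ Finset.univ.erase j, gI f a l = ∑ l ∈ Finset.univ.erase j, gI f b l := by
    refine Finset.sum_congr rfl fun l hl => ?_
    simp only [gI, h l (Finset.ne_of_mem_erase hl)]
  omega

lemma hdist_two {n : ℕ} (f a b : Fin n → Bool) (j k : Fin n) (hjk : j ≠ k)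
    (h : ∀ l, l ≠ j → l ≠ k → a l = b l) :
    dist' f a + (gI f b j + gI f b k) = dist' f b + (gI f a j + gI f a k) := by
  have h1 := hdist_one f a (Function.update a j (b j)) j
    (by intro l hl; simp [Function.update_of_ne hl])
  have h2 := hdist_one f (Function.update a j (b j)) b k
    (by
      intro l hl
      by_cases hj : l = j
      · subst hj; simp
      · rw [Function.update_of_ne hj, h l hj hl])
  have h3 : gI f (Function.update a j (b j)) j = gI f b j := by simp [gI]
  have h4 : gI f (Function.update a j (b j)) k = gI f a k := by
    simp [gI, Function.update_of_ne (Ne.symm hjk)]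
  omega

lemma symmDiff_one {n : ℕ} (a b : Fin n → Bool) (j : Fin n) (hj : a j ≠ b j)
    (h : ∀ l, l ≠ j → a l = b l) (c : Bool) :
    symmDiff (toF a) (toF b) = ({(j, c), starJ (j, c)} : Finset (JJ n)) := by
  ext ⟨l, u⟩
  simp only [Finset.mem_symmDiff, mem_toF, Finset.mem_insert, Finset.mem_singleton, starJ,
    Prod.mk.injEq]
  by_cases hl : l = j
  · subst hl
    cases u <;> cases c <;> cases h1 : a l <;> cases h2 : b l <;> simp_all
  · simp [hl, h l hl]

lemma symmDiff_two {n : ℕ} (a b : Fin n → Bool) (j k : Fin n) (hj : a j ≠ b j) (hk : a k ≠ b k)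
    (h : ∀ l, l ≠ j → l ≠ k → a l = b l) (c d : Bool) :
    symmDiff (toF a) (toF b) =
      ({(j, c), starJ (j, c), (k, d), starJ (k, d)} : Finset (JJ n)) := by
  ext ⟨l, u⟩
  simp only [Finset.mem_symmDiff, mem_toF, Finset.mem_insert, Finset.mem_singleton, starJ,
    Prod.mk.injEq]
  by_cases hl : l = j
  · subst hl
    cases u <;> cases c <;> cases h1 : a l <;> cases h2 : b l <;> simp_all
  by_cases hl' : l = k
  · subst hl'
    cases u <;> cases d <;> cases h1 : a l <;> cases h2 : b l <;> simp_all
  · simp [hl, hl', h l hl hl']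

/-- The kinds of steps on an increasing path. -/
def StepT {n : ℕ} (sF : Finset (JJ n) → ℤ) (f a b : Fin n → Bool) : Prop :=
  (∃ j, (∀ l, l ≠ j → a l = b l) ∧ a j = f j ∧ b j ≠ f j ∧ dist' f b = dist' f a + 1) ∨
  (∃ j k, j ≠ k ∧ a j ≠ b j ∧ a k ≠ b k ∧ (∀ l, l ≠ j → l ≠ k → a l = b l) ∧
    ((dist' f b = dist' f a ∧ sF (toF a) = sF (toF b)) ∨
     (dist' f b = dist' f a + 2 ∧ sF (toF a) = - sF (toF b))))

lemma step_of_edge_s7 {n : ℕ} {ℬ : Finset (Finset (JJ n))} (hM : IsLagrangianMatroid ℬ)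
    (sF : Finset (JJ n) → ℤ) (f a b : Fin n → Bool) (hs : IsOrientationRel ℬ (toF f) sF)
    (he : IsEdge ℬ (toF a) (toF b)) (hd : dist' f a ≤ dist' f b) : StepT sF f a b := by
  have hc := edge_card hM a b he
  have hne : a ≠ b := fun h => he.2.2.1 (by rw [h])
  have h0 : (Finset.univ.filter fun i => a i ≠ b i).card ≠ 0 := by
    intro h
    apply hne
    funext i
    by_contra hi
    have : i ∈ (Finset.univ.filter fun i => a i ≠ b i) := by simp [hi]
    rw [Finset.card_eq_zero.mp h] at this
    simp at this
  have hcases : (Finset.univ.filter fun i => a i ≠ b i).card = 1 ∨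
      (Finset.univ.filter fun i => a i ≠ b i).card = 2 := by omega
  rcases hcases with h1 | h2
  · obtain ⟨j, hj⟩ := Finset.card_eq_one.mp h1
    have hm : ∀ l, a l ≠ b l ↔ l = j := by
      intro l
      have : l ∈ (Finset.univ.filter fun i => a i ≠ b i) ↔ l ∈ ({j} : Finset (Fin n)) := by rw [hj]
      simpa using this
    have hoff : ∀ l, l ≠ j → a l = b l := fun l hl => by
      by_contra h
      exact hl ((hm l).mp h)
    have hjj := (hm j).mpr rfl
    have := hdist_one f a b j hoff
    left
    refine ⟨j, hoff, ?_⟩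
    simp only [gI] at this
    by_cases h3 : a j = f j
    · have h4 : b j ≠ f j := fun h => hjj (h3.trans h.symm)
      simp only [h3, h4, if_true, if_false] at this
      exact ⟨h3, h4, by omega⟩
    · have h4 : b j = f j := by
        revert hjj h3
        cases a j <;> cases b j <;> cases f j <;> simp
      simp only [h3, h4, if_true, if_false] at this
      omega
  · obtain ⟨j, k, hjk, hj⟩ := Finset.card_eq_two.mp h2
    have hm : ∀ l, a l ≠ b l ↔ l = j ∨ l = k := by
      intro l
      have : l ∈ (Finset.univ.filter fun i => a i ≠ b i) ↔ l ∈ ({j, k} : Finset (Fin n)) := by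
        rw [hj]
      simpa using this
    have hoff : ∀ l, l ≠ j → l ≠ k → a l = b l := fun l hl hl' => by
      by_contra h
      rcases (hm l).mp h with h | h
      · exact hl h
      · exact hl' h
    have hjj := (hm j).mpr (Or.inl rfl)
    have hkk := (hm k).mpr (Or.inr rfl)
    have hlong : IsLongEdge ℬ (toF a) (toF b) :=
      ⟨he, (j, false), (k, false), by simpa using hjk, by simp [starJ],
        symmDiff_two a b j k hjj hkk hoff false false⟩
    have := hdist_two f a b j k hjk hoff
    right
    refine ⟨j, k, hjk, hjj, hkk, hoff, ?_⟩
    obtain ⟨-, hi, hii, -, -⟩ := hs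
    have hi := hi _ _ hlong
    have hii := hii _ _ hlong
    rw [heightF_toF, heightF_toF] at hi hii
    have flip : ∀ t, a t ≠ b t → gI f a t + gI f b t = 1 := by
      intro t ht
      simp only [gI]
      revert ht
      cases a t <;> cases b t <;> cases f t <;> simp
    have f1 := flip j hjj
    have f2 := flip k hkk
    by_cases heq : dist' f a = dist' f b
    · left; exact ⟨heq.symm, hi heq⟩
    · right; exact ⟨by omega, hii heq⟩

lemma signChanges_succ {n : ℕ} (sF : Finset (JJ n) → ℤ) (v : ℕ → Finset (JJ n)) (t : ℕ) :
    signChanges sF v (t + 1) = signChanges sF v t +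
      (if sF (v t) ≠ sF (v (t + 1)) then 1 else 0) := by
  simp only [signChanges, Finset.card_filter, Finset.sum_range_succ]

lemma signChanges_add {n : ℕ} (sF : Finset (JJ n) → ℤ) (v : ℕ → Finset (JJ n)) (a b : ℕ) :
    signChanges sF v (a + b) = signChanges sF v a + signChanges sF (fun i => v (a + i)) b := by
  simp only [signChanges, Finset.card_filter, Finset.sum_range_add, add_assoc]

lemma signChanges_congr {n : ℕ} (sF : Finset (JJ n) → ℤ) (v w : ℕ → Finset (JJ n)) (m : ℕ)
    (h : ∀ i ≤ m, v i = w i) : signChanges sF v m = signChanges sF w m := by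
  simp only [signChanges, Finset.card_filter]
  refine Finset.sum_congr rfl fun i hi => ?_
  have := Finset.mem_range.mp hi
  rw [h i (by omega), h (i + 1) (by omega)]

/-- Standard basis vectors. -/
noncomputable def Eb {n : ℕ} (i : Fin n) : Fin n → ℝ := Pi.single i 1

lemma Eb_mem_one {n : ℕ} (S : Submodule ℝ (Fin n → ℝ)) (z : Fin n → ℝ) (hz : z ∈ S) (j : Fin n)
    (h : ∀ l, l ≠ j → z l = 0) (hj : z j ≠ 0) : Eb j ∈ S := by
  have : Eb j = (z j)⁻¹ • z := by
    funext l
    by_cases hl : l = j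
    · subst hl; simp [Eb, hj]
    · simp [Eb, hl, h l hl]
  rw [this]
  exact S.smul_mem _ hz

lemma Eb_mem_two {n : ℕ} (S : Submodule ℝ (Fin n → ℝ)) (z : Fin n → ℝ) (hz : z ∈ S) (j k : Fin n)
    (hjk : j ≠ k) (h : ∀ l, l ≠ j → l ≠ k → z l = 0) (hk : z k ≠ 0) (hj : Eb j ∈ S) :
    Eb k ∈ S := by
  refine Eb_mem_one S (z - z j • Eb j) (S.sub_mem hz (S.smul_mem _ hj)) k ?_ ?_
  · intro l hl
    by_cases hlj : l = j
    · subst hlj; simp [Eb]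
    · simp [Eb, hlj, h l hlj hl]
  · simp [Eb, Ne.symm hjk, hk]

lemma plane_support {n : ℕ} (S : Submodule ℝ (Fin n → ℝ)) (hS : Module.finrank ℝ S = 2)
    (i j : Fin n) (hij : i ≠ j) (hi : Eb i ∈ S) (hj : Eb j ∈ S) (z : Fin n → ℝ) (hz : z ∈ S)
    (l : Fin n) (hli : l ≠ i) (hlj : l ≠ j) : z l = 0 := by
  have hlin : LinearIndependent ℝ ![(Eb i : Fin n → ℝ), Eb j] := by
    rw [LinearIndependent.pair_iff]
    intro s t hst
    have h1 := congrFun hst i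
    have h2 := congrFun hst j
    simp [Eb, hij, Ne.symm hij] at h1 h2
    exact ⟨h1, h2⟩
  have hfr : Module.finrank ℝ (Submodule.span ℝ (Set.range ![(Eb i : Fin n → ℝ), Eb j])) = 2 := by
    rw [finrank_span_eq_card hlin]; simp
  have hle : Submodule.span ℝ (Set.range ![(Eb i : Fin n → ℝ), Eb j]) ≤ S := by
    rw [Submodule.span_le]
    rintro _ ⟨t, rfl⟩
    fin_cases t
    · exact hi
    · exact hj
  have heq := Submodule.eq_of_le_of_finrank_eq hle (by rw [hfr, hS])
  rw [← heq] at hz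
  simp only [Matrix.range_cons, Matrix.range_empty, Set.union_empty, Set.singleton_union] at hz
  obtain ⟨c, d, rfl⟩ := Submodule.mem_span_pair.mp hz
  simp [Eb, hli, hlj]

/-- A path in a plane whose steps all are of the right kind. -/
structure GoodPath {n : ℕ} (ℬ : Finset (Finset (JJ n))) (sF : Finset (JJ n) → ℤ)
    (f : Fin n → Bool) (S : Submodule ℝ (Fin n → ℝ)) (x : ℕ → Fin n → Bool) (m : ℕ) : Prop where
  step : ∀ t < m, StepT sF f (x t) (x (t + 1))
  memS : ∀ t ≤ m, eSet (toF (x t)) - eSet (toF (x 0)) ∈ S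
  base : ∀ t ≤ m, toF (x t) ∈ ℬ
  sgn : ∀ A ∈ ℬ, sF A = 1 ∨ sF A = -1

lemma eSet_sub_zero {n : ℕ} (a b : Fin n → Bool) (l : Fin n) :
    (eSet (toF a) - eSet (toF b)) l = 0 ↔ a l = b l := by
  rw [Pi.sub_apply, eSet_toF, eSet_toF]
  cases a l <;> cases b l <;> norm_num

lemma GoodPath.count {n : ℕ} {ℬ : Finset (Finset (JJ n))} {sF : Finset (JJ n) → ℤ}
    {f : Fin n → Bool} {S : Submodule ℝ (Fin n → ℝ)} {x : ℕ → Fin n → Bool} {m : ℕ}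
    (h : GoodPath ℬ sF f S x m) : ∀ t ≤ m, ∃ vl sh c : ℕ,
      signChanges sF (fun i => toF (x i)) t = vl + c ∧ c ≤ sh ∧
      dist' f (x t) = dist' f (x 0) + sh + 2 * vl ∧
      ((∀ j, Eb j ∉ S) → sh = 0) ∧
      (∀ i, Eb i ∈ S → (∀ j, Eb j ∈ S → j = i) → sh + gI f (x 0) i = gI f (x t) i) := by
  intro t
  induction t with
  | zero => 
    intro _
    exact ⟨0, 0, 0, by simp [signChanges], le_rfl, by simp, fun _ => rfl, fun i _ _ => by simp⟩
  | succ t ih =>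
    intro ht
    obtain ⟨vl, sh, c, h1, h2, h3, h4, h5⟩ := ih (by omega)
    rw [signChanges_succ, h1]
    have hz : eSet (toF (x (t + 1))) - eSet (toF (x t)) ∈ S := by
      have := S.sub_mem (h.memS (t + 1) ht) (h.memS t (by omega))
      simpa using this
    rcases h.step t (by omega) with ⟨j, hoff, ha, hb, hd⟩ | ⟨j, k, hjk, hj, hk, hoff, hd⟩
    · have hE : Eb j ∈ S := Eb_mem_one S _ hz j
        (fun l hl => (eSet_sub_zero _ _ _).mpr (hoff l hl).symm)
        (fun h => hb (((eSet_sub_zero _ _ _).mp h).trans ha))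
      have hc : ∃ c', c' ≤ sh + 1 ∧ vl + c +
          (if sF (toF (x t)) ≠ sF (toF (x (t + 1))) then 1 else 0) = vl + c' := by
        split_ifs
        · exact ⟨c + 1, by omega, by omega⟩
        · exact ⟨c, by omega, by omega⟩
      obtain ⟨c', hc1, hc2⟩ := hc
      refine ⟨vl, sh + 1, c', hc2, hc1, by omega, fun hn => absurd hE (hn j), ?_⟩
      intro i hi hu
      have := h5 i hi hu
      have hji := hu j hE
      subst hji
      simp only [gI, ha, hb, if_true, if_false] at this ⊢
      omega
    · have hG : ∀ i, Eb i ∈ S → (∀ j, Eb j ∈ S → j = i) → gI f (x (t + 1)) i = gI f (x t) i := by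
        intro i hi hu
        have hij : i ≠ j := by
          rintro rfl
          have := hu k (Eb_mem_two S _ hz i k hjk
            (fun l hl hl' => (eSet_sub_zero _ _ _).mpr (hoff l hl hl').symm)
            (fun h => hk ((eSet_sub_zero _ _ _).mp h).symm) hi)
          exact hjk this.symm
        have hik : i ≠ k := by
          rintro rfl
          have := hu j (Eb_mem_two S _ hz i j (Ne.symm hjk)
            (fun l hl hl' => (eSet_sub_zero _ _ _).mpr (hoff l hl' hl).symm)
            (fun h => hj ((eSet_sub_zero _ _ _).mp h).symm) hi)
          exact hjk this
        simp only [gI, hoff i hij hik]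
      rcases hd with ⟨hd, hs⟩ | ⟨hd, hs⟩
      · refine ⟨vl, sh, c, by simp [hs], h2, by omega, h4, fun i hi hu => ?_⟩
        rw [hG i hi hu, h5 i hi hu]
      · have hne : sF (toF (x t)) ≠ sF (toF (x (t + 1))) := by
          rcases h.sgn _ (h.base (t + 1) ht) with h' | h' <;> rw [hs, h'] <;> norm_num
        refine ⟨vl + 1, sh, c, by simp [hne]; omega, h2, by omega, h4, fun i hi hu => ?_⟩
        rw [hG i hi hu, h5 i hi hu]

lemma GoodPath.parity {n : ℕ} {ℬ : Finset (Finset (JJ n))} {sF : Finset (JJ n) → ℤ}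
    {f : Fin n → Bool} {S : Submodule ℝ (Fin n → ℝ)} {x : ℕ → Fin n → Bool} {m : ℕ}
    (h : GoodPath ℬ sF f S x m) : ∀ t ≤ m,
      sF (toF (x t)) = if signChanges sF (fun i => toF (x i)) t % 2 = 0 then sF (toF (x 0))
        else - sF (toF (x 0)) := by
  intro t
  induction t with
  | zero => intro _; simp [signChanges]
  | succ t ih =>
    intro ht
    have ih := ih (by omega)
    rw [signChanges_succ]
    by_cases he : sF (toF (x t)) = sF (toF (x (t + 1)))
    · simp only [he, ne_eq, not_true, if_false, add_zero]
      rw [← he, ih]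
    · have : sF (toF (x (t + 1))) = - sF (toF (x t)) := by
        rcases h.sgn _ (h.base (t + 1) ht) with h1 | h1 <;>
        rcases h.sgn _ (h.base t (by omega)) with h2 | h2 <;> rw [h1, h2] at he ⊢ <;> first | rfl | exact absurd rfl he
      rw [if_pos he, this, ih]
      rcases Nat.mod_two_eq_zero_or_one (signChanges sF (fun i => toF (x i)) t) with h3 | h3
      · have : (signChanges sF (fun i => toF (x i)) t + 1) % 2 = 1 := by omega
        simp [h3, this]
      · have : (signChanges sF (fun i => toF (x i)) t + 1) % 2 = 0 := by omega
        simp [h3, this]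

lemma square_false {n : ℕ} {ℬ : Finset (Finset (JJ n))} {sF : Finset (JJ n) → ℤ}
    {f : Fin n → Bool} (hs : IsOrientationRel ℬ (toF f) sF) (i j : Fin n) (hij : i ≠ j)
    (a b b' o : Fin n → Bool)
    (hb : ∀ l, l ≠ i → l ≠ j → b l = a l) (hb' : ∀ l, l ≠ i → l ≠ j → b' l = a l)
    (ho : ∀ l, l ≠ i → l ≠ j → o l = a l)
    (ai : a i = f i) (aj : a j = f j) (bi : b i ≠ f i) (bj : b j = f j)
    (b'i : b' i = f i) (b'j : b' j ≠ f j) (oi : o i ≠ f i) (oj : o j ≠ f j)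
    (ma : toF a ∈ ℬ) (mb : toF b ∈ ℬ) (mb' : toF b' ∈ ℬ) (mo : toF o ∈ ℬ)
    (s1 : sF (toF b) = sF (toF a)) (s2 : sF (toF o) = sF (toF a))
    (s3 : sF (toF b') ≠ sF (toF a)) : False := by
  have hsq : ShortSquare ℬ ![toF a, toF b, toF b', toF o] := by
    refine ⟨toF a, (i, false), (j, false), hij, rfl, ?_, ?_, ?_, ?_⟩
    · rw [← symmDiff_one a b i (by rw [ai]; exact bi.symm) (fun l hl => ?_) false]
      · simp
      · by_cases h : l = j
        · subst h; rw [aj, bj]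
        · exact (hb l hl h).symm
    · rw [← symmDiff_one a b' j (by rw [aj]; exact b'j.symm) (fun l hl => ?_) false]
      · simp
      · by_cases h : l = i
        · subst h; rw [ai, b'i]
        · exact (hb' l h hl).symm
    · rw [← symmDiff_two a o i j (by rw [ai]; exact oi.symm) (by rw [aj]; exact oj.symm)
        (fun l hl hl' => (ho l hl hl').symm) false false]
      simp
    · intro k
      fin_cases k <;> simpa
  have d1 := hdist_two f a b' i j hij (fun l hl hl' => (hb' l hl hl').symm)
  have d2 := hdist_two f a o i j hij (fun l hl hl' => (ho l hl hl').symm)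
  simp only [gI, ai, aj, b'i, b'j, oi, oj, if_true, if_false] at d1 d2
  have := hs.2.2.2.1 _ hsq 2 ⟨?_, 0, by decide, ?_⟩
  · rcases this with h | h
    · have := h 3
      simp [heightF_toF] at this
      omega
    · have := h 0
      simp [heightF_toF] at this
      omega
  · intro l m hl hm
    fin_cases l <;> fin_cases m <;> simp_all
  · simpa using s3.symm

lemma caseA_false {n : ℕ} {ℬ : Finset (Finset (JJ n))} {sF : Finset (JJ n) → ℤ}
    {f : Fin n → Bool} {S : Submodule ℝ (Fin n → ℝ)} {x y : ℕ → Fin n → Bool} {m m' : ℕ}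
    (hs : IsOrientationRel ℬ (toF f) sF)
    (hx : GoodPath ℬ sF f S x m) (hy : GoodPath ℬ sF f S y m')
    (h0 : x 0 = y 0) (i j : Fin n) (hij : i ≠ j)
    (hoff : ∀ z : Fin n → ℝ, z ∈ S → ∀ l, l ≠ i → l ≠ j → z l = 0)
    (hend : x m = y m')
    (hN : signChanges sF (fun t => toF (x t)) m = 0)
    (hN' : signChanges sF (fun t => toF (y t)) m' ≠ 0)
    (hd : dist' f (x m) = dist' f (x 0) + 2) : False := by
  have offx : ∀ t ≤ m, ∀ l, l ≠ i → l ≠ j → x t l = x 0 l := fun t ht l hl hl' =>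
    (eSet_sub_zero _ _ _).mp (hoff _ (hx.memS t ht) l hl hl')
  have offy : ∀ t ≤ m', ∀ l, l ≠ i → l ≠ j → y t l = x 0 l := fun t ht l hl hl' => by
    rw [h0]
    exact (eSet_sub_zero _ _ _).mp (hoff _ (hy.memS t ht) l hl hl')
  have hmono : ∀ t ≤ m, signChanges sF (fun t => toF (x t)) t = 0 := by
    intro t ht
    obtain ⟨r, rfl⟩ := Nat.exists_eq_add_of_le ht
    rw [signChanges_add] at hN
    omega
  have hsx : ∀ t ≤ m, sF (toF (x t)) = sF (toF (x 0)) := by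
    intro t ht
    rw [hx.parity t ht, hmono t ht]
    simp
  -- a vertex of intermediate height on `x`
  have hivt : ∀ t ≤ m, (∃ t' ≤ m, dist' f (x t') = dist' f (x 0) + 1) ∨
      dist' f (x t) ≤ dist' f (x 0) := by
    intro t
    induction t with
    | zero => intro _; right; exact le_rfl
    | succ t ih =>
      intro ht
      rcases ih (by omega) with h | h
      · exact Or.inl h
      · by_cases hc : dist' f (x (t + 1)) = dist' f (x 0) + 1
        · exact Or.inl ⟨t + 1, ht, hc⟩
        right
        rcases hx.step t (by omega) with ⟨_, _, _, _, hd⟩ | ⟨_, _, _, _, _, _, hd⟩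
        · omega
        · rcases hd with ⟨hd, _⟩ | ⟨_, hs'⟩
          · omega
          · rw [hsx t (by omega), hsx (t + 1) ht] at hs'
            rcases hx.sgn _ (hx.base 0 (by omega)) with h' | h' <;> rw [h'] at hs' <;> omega
  obtain ⟨t, ht, hdt⟩ : ∃ t' ≤ m, dist' f (x t') = dist' f (x 0) + 1 := by
    rcases hivt m le_rfl with h | h
    · exact h
    · omega
  obtain ⟨t', ht', hst'⟩ : ∃ t' ≤ m', sF (toF (y t')) ≠ sF (toF (x 0)) := by
    by_contra hc
    push Not at hc
    apply hN'
    simp only [signChanges, Finset.card_eq_zero, Finset.filter_eq_empty_iff]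
    intro r hr
    have := Finset.mem_range.mp hr
    rw [hc r (by omega), hc (r + 1) (by omega)]
    simp
  have dm := hdist_two f (x 0) (x m) i j hij (fun l hl hl' => (offx m le_rfl l hl hl').symm)
  have dt := hdist_two f (x 0) (x t) i j hij (fun l hl hl' => (offx t ht l hl hl').symm)
  have hne1 : y t' ≠ x 0 := fun h => hst' (by rw [h])
  have hne2 : y t' ≠ x m := fun h => hst' (by rw [h, hsx m le_rfl])
  have hne3 : y t' ≠ x t := fun h => hst' (by rw [h, hsx t ht])
  have g01 : ∀ (c : Fin n → Bool) l, (c l = f l ∧ gI f c l = 0) ∨ (c l ≠ f l ∧ gI f c l = 1) := by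
    intro c l
    simp only [gI]
    by_cases h : c l = f l <;> simp [h]
  have hbool : ∀ {p q r : Bool}, p ≠ r → q ≠ r → p = q := by
    intro p q r; cases p <;> cases q <;> cases r <;> simp
  have hext : ∀ c : Fin n → Bool, (∀ l, l ≠ i → l ≠ j → c l = x 0 l) → y t' i = c i →
      y t' j = c j → y t' = c := by
    intro c hc hci hcj
    funext l
    by_cases h1 : l = i
    · rw [h1, hci]
    by_cases h2 : l = j
    · rw [h2, hcj]
    rw [offy t' ht' l h1 h2, hc l h1 h2]
  obtain ⟨ai, -⟩ | ⟨-, ai'⟩ := g01 (x 0) i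
  swap
  · rcases g01 (x 0) j with h1 | h1 <;> rcases g01 (x m) j with h2 | h2 <;>
      rcases g01 (x m) i with h3 | h3 <;> omega
  obtain ⟨aj, -⟩ | ⟨-, aj'⟩ := g01 (x 0) j
  swap
  · rcases g01 (x 0) i with h1 | h1 <;> rcases g01 (x m) j with h2 | h2 <;>
      rcases g01 (x m) i with h3 | h3 <;> omega
  have a1 : gI f (x 0) i = 0 := by simp [gI, ai]
  have a2 : gI f (x 0) j = 0 := by simp [gI, aj]
  obtain ⟨oi, oi'⟩ | ⟨oi, oi'⟩ := g01 (x m) i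
  · rcases g01 (x m) j with h2 | h2 <;> omega
  obtain ⟨oj, oj'⟩ | ⟨oj, oj'⟩ := g01 (x m) j
  · omega
  have mx := hx.base
  have my := hy.base t' ht'
  rcases g01 (x t) i with ⟨bi, bi'⟩ | ⟨bi, bi'⟩ <;> rcases g01 (x t) j with ⟨bj, bj'⟩ | ⟨bj, bj'⟩
  · omega
  · -- `x t` differs at `j`
    have ci : y t' i ≠ f i := by
      intro h
      by_cases h' : y t' j = f j
      · exact hne1 (hext (x 0) (fun _ _ _ => rfl) (h.trans ai.symm) (h'.trans aj.symm))
      · exact hne3 (hext (x t) (offx t ht) (h.trans bi.symm) (hbool h' bj))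
    have cj : y t' j = f j := by
      by_contra h'
      exact hne2 (hext (x m) (offx m le_rfl) (hbool ci oi) (hbool h' oj))
    exact square_false hs j i (Ne.symm hij) (x 0) (x t) (y t') (x m)
      (fun l h1 h2 => offx t ht l h2 h1) (fun l h1 h2 => offy t' ht' l h2 h1)
      (fun l h1 h2 => offx m le_rfl l h2 h1) aj ai bj bi cj ci oj oi
      (mx 0 (by omega)) (mx t ht) my (mx m le_rfl) (hsx t ht) (hsx m le_rfl) hst'
  · have cj : y t' j ≠ f j := by
      intro h
      by_cases h' : y t' i = f i
      · exact hne1 (hext (x 0) (fun _ _ _ => rfl) (h'.trans ai.symm) (h.trans aj.symm))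
      · exact hne3 (hext (x t) (offx t ht) (hbool h' bi) (h.trans bj.symm))
    have ci : y t' i = f i := by
      by_contra h'
      exact hne2 (hext (x m) (offx m le_rfl) (hbool h' oi) (hbool cj oj))
    exact square_false hs i j hij (x 0) (x t) (y t') (x m)
      (fun l h1 h2 => offx t ht l h1 h2) (fun l h1 h2 => offy t' ht' l h1 h2)
      (fun l h1 h2 => offx m le_rfl l h1 h2) ai aj bi bj ci cj oi oj
      (mx 0 (by omega)) (mx t ht) my (mx m le_rfl) (hsx t ht) (hsx m le_rfl) hst'
  · omega

lemma middle {n : ℕ} {ℬ : Finset (Finset (JJ n))} {sF : Finset (JJ n) → ℤ}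
    {f : Fin n → Bool} {S : Submodule ℝ (Fin n → ℝ)} {x y : ℕ → Fin n → Bool} {m m' : ℕ}
    (hs : IsOrientationRel ℬ (toF f) sF) (hS : Module.finrank ℝ S = 2)
    (hx : GoodPath ℬ sF f S x m) (hy : GoodPath ℬ sF f S y m')
    (h0 : x 0 = y 0) (hend : x m = y m') :
    signChanges sF (fun t => toF (x t)) m = signChanges sF (fun t => toF (y t)) m' := by
  obtain ⟨vl, sh, c, h1, h2, h3, h4, h5⟩ := hx.count m le_rfl
  obtain ⟨vl', sh', c', h1', h2', h3', h4', h5'⟩ := hy.count m' le_rfl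
  have hpar : signChanges sF (fun t => toF (x t)) m % 2
      = signChanges sF (fun t => toF (y t)) m' % 2 := by
    have e1 := hx.parity m le_rfl
    have e2 := hy.parity m' le_rfl
    rw [hend, e2, h0] at e1
    have hnz : sF (toF (y 0)) ≠ - sF (toF (y 0)) := by
      rcases hy.sgn _ (hy.base 0 (by omega)) with h' | h' <;> rw [h'] <;> norm_num
    split_ifs at e1 with p1 p2 p2
    · omega
    · exact absurd e1 hnz
    · exact absurd e1.symm hnz
    · omega
  have hdd : dist' f (x 0) + sh + 2 * vl = dist' f (x 0) + sh' + 2 * vl' := by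
    rw [← h3, hend, h3', h0]
  have gle : ∀ (c : Fin n → Bool) l, gI f c l ≤ 1 := by
    intro c l; simp only [gI]; split_ifs <;> omega
  by_cases hA : ∃ i j : Fin n, i ≠ j ∧ Eb i ∈ S ∧ Eb j ∈ S
  · obtain ⟨i, j, hij, hi, hj⟩ := hA
    have hoff : ∀ z : Fin n → ℝ, z ∈ S → ∀ l, l ≠ i → l ≠ j → z l = 0 :=
      fun z hz l hl hl' => plane_support S hS i j hij hi hj z hz l hl hl'
    have dm := hdist_two f (x 0) (x m) i j hij (fun l hl hl' =>
      ((eSet_sub_zero _ _ _).mp (hoff _ (hx.memS m le_rfl) l hl hl')).symm)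
    have := gle (x m) i
    have := gle (x m) j
    by_contra hne
    have hc : (signChanges sF (fun t => toF (x t)) m = 0 ∧
        signChanges sF (fun t => toF (y t)) m' ≠ 0 ∧ sh + 2 * vl = 2) ∨
        (signChanges sF (fun t => toF (y t)) m' = 0 ∧
        signChanges sF (fun t => toF (x t)) m ≠ 0 ∧ sh + 2 * vl = 2) := by omega
    rcases hc with ⟨z1, z2, z3⟩ | ⟨z1, z2, z3⟩
    · exact caseA_false hs hx hy h0 i j hij hoff hend z1 z2 (by omega)
    · exact caseA_false hs hy hx h0.symm i j hij hoff hend.symm z1 z2 (by omega)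
  · have hsh : sh ≤ 1 ∧ sh' ≤ 1 := by
      by_cases hn : ∀ j, Eb j ∉ S
      · rw [h4 hn, h4' hn]; simp
      · push Not at hn
        obtain ⟨i, hi⟩ := hn
        have hu : ∀ j, Eb j ∈ S → j = i := by
          intro j hj
          by_contra h
          exact hA ⟨j, i, h, hj, hi⟩
        have := h5 i hi hu
        have := h5' i hi hu
        have := gle (x m) i
        have := gle (y m') i
        omega
    omega

end Aux

/-- If two increasing paths from the fundamental basis `F` to the same
basis of maximal height differ only as to the route taken through a single
2-dimensional face of the matroid polytope (they share a common initial segment and a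
common final segment, and the differing middle portions both lie in one 2-dimensional
face), then they contain the same number of changes of sign of `A ↦ s F A`. -/
theorem facewise_paths_same_sign_changes {n : ℕ}
    (ℬ : Finset (Finset (JJ n))) (hM : IsLagrangianMatroid ℬ)
    (s : Finset (JJ n) → Finset (JJ n) → ℤ) (hs : IsOrientation ℬ s)
    (F : Finset (JJ n)) (hF : F ∈ ℬ)
    (v w : ℕ → Finset (JJ n)) (p q : ℕ)
    (hv : IncreasingPath ℬ F v p) (hw : IncreasingPath ℬ F w q)
    (hsame : v p = w q) (hvmax : MaxHeightBasis ℬ F (v p))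
    (hdiff : ∃ (k r : ℕ) (Fc : Set (Fin n → ℝ)), k + r ≤ p ∧ k + r ≤ q ∧
      (∀ i ≤ k, v i = w i) ∧ (∀ i ≤ r, v (p - i) = w (q - i)) ∧
      Is2Face ℬ Fc ∧
      (∀ i, k ≤ i → i ≤ p - r → eSet (v i) ∈ Fc) ∧
      (∀ i, k ≤ i → i ≤ q - r → eSet (w i) ∈ Fc)) :
    signChanges (s F) v p = signChanges (s F) w q := by
  classical
  obtain ⟨k, r, Fc, hkp, hkq, hinit, hfin, hface, hvF, hwF⟩ := hdiff
  let ofF : Finset (JJ n) → Fin n → Bool := fun A i => decide ((i, true) ∈ A)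
  have hof : ∀ A ∈ ℬ, toF (ofF A) = A := by
    intro A hA
    obtain ⟨a, ha⟩ := exists_toF A (hM.1 A hA).1 (hM.1 A hA).2
    have : ofF A = a := by
      funext i
      simp only [ofF, ha, mem_toF]
      cases a i <;> simp
    rw [this, ha]
  have hFf : toF (ofF F) = F := hof F hF
  have hor : IsOrientationRel ℬ (toF (ofF F)) (s F) := by
    rw [hFf]; exact hs.2.1 F hF
  have build : ∀ (u : ℕ → Finset (JJ n)) (p : ℕ), IncreasingPath ℬ F u p → k + r ≤ p →
      (∀ i, k ≤ i → i ≤ p - r → eSet (u i) ∈ Fc) →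
      (∀ i ≤ p, u i ∈ ℬ) ∧
      GoodPath ℬ (s F) (ofF F) (vectorSpan ℝ Fc) (fun t => ofF (u (k + t))) (p - r - k) := by
    intro u p hu hp huF
    obtain ⟨hu0, hue, L, hL1, hL2⟩ := hu
    have hmem : ∀ i ≤ p, u i ∈ ℬ := by
      intro i hi
      rcases Nat.eq_zero_or_pos i with h | h
      · rw [h, hu0]; exact hF
      · obtain ⟨j, rfl⟩ := Nat.exists_eq_succ_of_ne_zero h.ne'
        exact (hue j (by omega)).2.1
    refine ⟨hmem, ?_, ?_, ?_, hor.1⟩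
    · intro t ht
      have e1 := hof _ (hmem (k + t) (by omega))
      have e2 := hof _ (hmem (k + (t + 1)) (by omega))
      apply step_of_edge_s7 hM (s F) _ _ _ hor
      · rw [e1, e2]; exact hue (k + t) (by omega)
      · rw [← heightF_toF, ← heightF_toF, e1, e2, hFf]
        by_contra hc
        have h1 := hL1 _ (hmem (k + t) (by omega)) _ (hmem (k + (t + 1)) (by omega))
          (not_le.mp hc)
        have h2 := hL2 (k + t) (by omega)
        exact absurd h1 (not_lt.mpr h2.le)
    · intro t ht
      simp only [hof _ (hmem (k + t) (by omega)), hof _ (hmem (k + 0) (by omega))]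
      exact vsub_mem_vectorSpan ℝ (huF (k + t) (by omega) (by omega))
        (huF (k + 0) (by omega) (by omega))
    · intro t ht
      simp only [hof _ (hmem (k + t) (by omega))]
      exact hmem (k + t) (by omega)
  obtain ⟨mv, gv⟩ := build v p hv hkp hvF
  obtain ⟨mw, gw⟩ := build w q hw hkq hwF
  have hmid := middle hor hface.2 gv gw (by simp only [add_zero, hinit k le_rfl]) (by
    have h1 : k + (p - r - k) = p - r := by omega
    have h2 : k + (q - r - k) = q - r := by omega
    simp only [h1, h2, hfin r le_rfl])
  have split : ∀ (u : ℕ → Finset (JJ n)) (p : ℕ), k + r ≤ p →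
      signChanges (s F) u p = signChanges (s F) u k +
        signChanges (s F) (fun t => u (k + t)) (p - r - k) +
        signChanges (s F) (fun t => u (p - r + t)) r := by
    intro u p hp
    have e : p = (k + (p - r - k)) + r := by omega
    have e' : k + (p - r - k) = p - r := by omega
    conv_lhs => rw [e, signChanges_add, signChanges_add, e']
  rw [split v p hkp, split w q hkq, signChanges_congr (s F) v w k hinit,
    signChanges_congr (s F) (fun t => v (p - r + t)) (fun t => w (q - r + t)) r ?_,
    signChanges_congr (s F) (fun t => v (k + t)) (fun t => toF (ofF (v (k + t)))) (p - r - k) ?_,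
    signChanges_congr (s F) (fun t => w (k + t)) (fun t => toF (ofF (w (k + t)))) (q - r - k) ?_,
    hmid]
  · intro i hi
    exact (hof _ (mw _ (by omega))).symm
  · intro i hi
    exact (hof _ (mv _ (by omega))).symm
  · intro i hi
    have h := hfin (r - i) (by omega)
    have h1 : p - (r - i) = p - r + i := by omega
    have h2 : q - (r - i) = q - r + i := by omega
    rw [h1, h2] at h
    exact h
end

section
/- Let P ⊆ ℝ^d be a convex polytope, L a linear functional not constant on any edge of P, α a vertex of P, and ω the vertex of P at which L attains its maximum over P. Then any two paths of vertices and edges of P from α to ω that are strictly increasing with respect to L can be transformed into each other by a finite sequence of steps, where each step replaces a strictly L-increasing path from α to ω by another strictly L-increasing path from α to ω that differs from it only within a single 2-dimensional face of P. -/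
open Finset

/-- `x` is a vertex of the polytope `P`: the singleton `{x}` is an exposed face. -/
def PVertex {d : ℕ} (P : Set (Fin d → ℝ)) (x : Fin d → ℝ) : Prop :=
  IsExposed ℝ P {x}

/-- The segment from `x` to `y` is an edge of `P`: a 1-dimensional exposed face with
endpoints `x ≠ y`. -/
def PEdge {d : ℕ} (P : Set (Fin d → ℝ)) (x y : Fin d → ℝ) : Prop :=
  x ≠ y ∧ IsExposed ℝ P (segment ℝ x y)

/-- A 2-dimensional (exposed) face of the polytope `P`. -/
def P2Face {d : ℕ} (P : Set (Fin d → ℝ)) (Fc : Set (Fin d → ℝ)) : Prop :=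
  IsExposed ℝ P Fc ∧ Module.finrank ℝ (vectorSpan ℝ Fc) = 2

/-- A strictly `L`-increasing path of vertices and edges of `P` from `α` to `ω`,
recorded as the list of its vertices. -/
def PIncrPath {d : ℕ} (P : Set (Fin d → ℝ)) (L : (Fin d → ℝ) →ₗ[ℝ] ℝ)
    (α ω : Fin d → ℝ) (l : List (Fin d → ℝ)) : Prop :=
  l.head? = some α ∧ l.getLast? = some ω ∧
  l.Chain' fun x y => PEdge P x y ∧ L x < L y

/-- One step of a facewise transformation: both lists are strictly `L`-increasing paths
from `α` to `ω`, and they differ only within a single 2-dimensional face of `P` (they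
share a common prefix and suffix, and both of the differing middle portions lie in one
2-dimensional face). -/
def FaceStep {d : ℕ} (P : Set (Fin d → ℝ)) (L : (Fin d → ℝ) →ₗ[ℝ] ℝ)
    (α ω : Fin d → ℝ) (l l' : List (Fin d → ℝ)) : Prop :=
  PIncrPath P L α ω l ∧ PIncrPath P L α ω l' ∧
  ∃ (pre mid mid' suf : List (Fin d → ℝ)) (Fc : Set (Fin d → ℝ)),
    P2Face P Fc ∧ l = pre ++ mid ++ suf ∧ l' = pre ++ mid' ++ suf ∧
    (∀ x ∈ mid, x ∈ Fc) ∧ (∀ x ∈ mid', x ∈ Fc)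

namespace MonoPath

variable {d : ℕ}

/-- Exposed vertex of a finite configuration. -/
def CV (T : Finset (Fin d → ℝ)) (x : Fin d → ℝ) : Prop :=
  x ∈ T ∧ ∃ f : (Fin d → ℝ) →ₗ[ℝ] ℝ, ∀ s ∈ T, s ≠ x → f s < f x

/-- Edge of a finite configuration. -/
def CE (T : Finset (Fin d → ℝ)) (x y : Fin d → ℝ) : Prop :=
  x ≠ y ∧ x ∈ T ∧ y ∈ T ∧ ∃ f : (Fin d → ℝ) →ₗ[ℝ] ℝ, f x = f y ∧
    ∀ s ∈ T, f s ≤ f x ∧ (f s = f x → s ∈ segment ℝ x y)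

open Classical in
/-- Points of the configuration maximizing `f`. -/
noncomputable def face (T : Finset (Fin d → ℝ)) (f : (Fin d → ℝ) →ₗ[ℝ] ℝ) :
    Finset (Fin d → ℝ) := T.filter (fun t => ∀ s ∈ T, f s ≤ f t)

theorem mem_face {T : Finset (Fin d → ℝ)} {f : (Fin d → ℝ) →ₗ[ℝ] ℝ} {x : Fin d → ℝ} :
    x ∈ face T f ↔ x ∈ T ∧ ∀ s ∈ T, f s ≤ f x := by
  classical
  simp [face]

theorem CE.symm {T : Finset (Fin d → ℝ)} {x y : Fin d → ℝ} (h : CE T x y) : CE T y x := by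
  obtain ⟨h1, h2, h3, f, h4, h5⟩ := h
  refine ⟨h1.symm, h3, h2, f, h4.symm, fun s hs => ?_⟩
  rw [segment_symm, ← h4]
  exact h5 s hs

theorem face_eq {T : Finset (Fin d → ℝ)} {f : (Fin d → ℝ) →ₗ[ℝ] ℝ} {x y : Fin d → ℝ}
    (hx : x ∈ face T f) (hy : y ∈ face T f) : f x = f y := by
  rw [mem_face] at hx hy
  exact le_antisymm (hy.2 x hx.1) (hx.2 y hy.1)

theorem face_lt {T : Finset (Fin d → ℝ)} {f : (Fin d → ℝ) →ₗ[ℝ] ℝ} {x s : Fin d → ℝ}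
    (hx : x ∈ face T f) (hs : s ∈ T) (hs' : s ∉ face T f) : f s < f x := by
  rw [mem_face] at hx
  refine lt_of_le_of_ne (hx.2 s hs) fun h => hs' ?_
  rw [mem_face]
  exact ⟨hs, fun t ht => h ▸ hx.2 t ht⟩

theorem face_nonempty {T : Finset (Fin d → ℝ)} (hT : T.Nonempty)
    (f : (Fin d → ℝ) →ₗ[ℝ] ℝ) : (face T f).Nonempty := by
  obtain ⟨x, hx, h⟩ := T.exists_max_image f hT
  exact ⟨x, mem_face.2 ⟨hx, h⟩⟩

theorem exists_lift (T : Finset (Fin d → ℝ)) (f h : (Fin d → ℝ) →ₗ[ℝ] ℝ) :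
    ∃ k : (Fin d → ℝ) →ₗ[ℝ] ℝ,
      (∀ x ∈ face T f, ∀ y ∈ face T f, k x - k y = h x - h y) ∧
      (∀ x ∈ face T f, ∀ s ∈ T, s ∉ face T f → k s < k x) := by
  classical
  obtain ⟨M, hM⟩ := Finset.exists_le
    ((T ×ˢ T).image fun p => (h p.2 - h p.1) / (f p.1 - f p.2))
  refine ⟨(M + 1) • f + h, fun x hx y hy => ?_, fun x hx s hs hs' => ?_⟩
  · simp [face_eq hx hy]
  · have h1 := face_lt hx hs hs'
    have h2 := hM ((h s - h x) / (f x - f s))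
      (Finset.mem_image.2 ⟨(x, s), by simp [hs, (mem_face.1 hx).1], rfl⟩)
    rw [div_le_iff₀ (by linarith)] at h2
    simp only [LinearMap.add_apply, LinearMap.smul_apply, smul_eq_mul]
    nlinarith

theorem CV.of_face {T : Finset (Fin d → ℝ)} {f : (Fin d → ℝ) →ₗ[ℝ] ℝ} {x : Fin d → ℝ}
    (h : CV (face T f) x) : CV T x := by
  obtain ⟨hx, h, hh⟩ := h
  obtain ⟨k, hk1, hk2⟩ := exists_lift T f h
  refine ⟨(mem_face.1 hx).1, k, fun s hs hsx => ?_⟩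
  by_cases hsf : s ∈ face T f
  · have := hk1 s hsf x hx
    have := hh s hsf hsx
    linarith
  · exact hk2 x hx s hs hsf

theorem CE.of_face {T : Finset (Fin d → ℝ)} {f : (Fin d → ℝ) →ₗ[ℝ] ℝ} {x y : Fin d → ℝ}
    (h : CE (face T f) x y) : CE T x y := by
  obtain ⟨hne, hx, hy, h, hxy, hh⟩ := h
  obtain ⟨k, hk1, hk2⟩ := exists_lift T f h
  refine ⟨hne, (mem_face.1 hx).1, (mem_face.1 hy).1, k, ?_, fun s hs => ?_⟩
  · have := hk1 x hx y hy
    linarith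
  by_cases hsf : s ∈ face T f
  · have h1 := hk1 s hsf x hx
    have h2 := hh s hsf
    exact ⟨by linarith, fun h3 => h2.2 (by linarith)⟩
  · have := hk2 x hx s hs hsf
    exact ⟨this.le, fun h => absurd h this.ne⟩

theorem CV.to_face {T : Finset (Fin d → ℝ)} {f : (Fin d → ℝ) →ₗ[ℝ] ℝ} {x : Fin d → ℝ}
    (h : CV T x) (hx : x ∈ face T f) : CV (face T f) x := by
  obtain ⟨_, g, hg⟩ := h
  exact ⟨hx, g, fun s hs => hg s (mem_face.1 hs).1⟩

theorem exists_CV {T : Finset (Fin d → ℝ)} (hT : T.Nonempty) : ∃ x, CV T x := by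
  obtain ⟨x, hx, h⟩ := T.exists_max_image (fun t => ∑ i, t i * t i) hT
  refine ⟨x, hx, ∑ i, x i • LinearMap.proj i, fun s hs hsx => ?_⟩
  have h1 := h s hs
  have h2 : 0 < ∑ i, (s i - x i) * (s i - x i) := by
    obtain ⟨j, hj⟩ := Function.ne_iff.1 hsx
    refine Finset.sum_pos' (fun i _ => mul_self_nonneg _) ⟨j, Finset.mem_univ _, ?_⟩
    exact mul_self_pos.2 (sub_ne_zero.2 hj)
  have h3 : ∑ i, (s i - x i) * (s i - x i)
      = ∑ i, s i * s i - 2 * ∑ i, x i * s i + ∑ i, x i * x i := by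
    rw [Finset.mul_sum, ← Finset.sum_sub_distrib, ← Finset.sum_add_distrib]
    exact Finset.sum_congr rfl fun i _ => by ring
  simp only [LinearMap.sum_apply, LinearMap.smul_apply, LinearMap.proj_apply, smul_eq_mul]
  linarith

theorem CE.right_CV {T : Finset (Fin d → ℝ)} {x y : Fin d → ℝ} (h : CE T x y) : CV T y := by
  obtain ⟨hne, hx, hy, f, hxy, hf⟩ := h
  have hyf : y ∈ face T f := mem_face.2 ⟨hy, fun s hs => hxy ▸ (hf s hs).1⟩
  have hxf : x ∈ face T f := mem_face.2 ⟨hx, fun s hs => (hf s hs).1⟩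
  apply CV.of_face (f := f)
  refine ⟨hyf, ∑ i, (y i - x i) • LinearMap.proj i, fun s hs hsy => ?_⟩
  have h1 := (hf s (mem_face.1 hs).1).2 (face_eq hs hxf)
  rw [segment_eq_image'] at h1
  obtain ⟨θ, hθ, rfl⟩ := h1
  have h2 : 0 < ∑ i, (y i - x i) * (y i - x i) := by
    obtain ⟨j, hj⟩ := Function.ne_iff.1 hne.symm
    refine Finset.sum_pos' (fun i _ => mul_self_nonneg _) ⟨j, Finset.mem_univ _, ?_⟩
    exact mul_self_pos.2 (sub_ne_zero.2 hj)
  have h4 : θ < 1 := by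
    refine lt_of_le_of_ne hθ.2 fun h => hsy ?_
    simp [h]
  simp only [LinearMap.sum_apply, LinearMap.smul_apply, LinearMap.proj_apply, smul_eq_mul,
    Pi.add_apply, Pi.smul_apply, Pi.sub_apply]
  have h3 : ∑ i, (y i - x i) * y i - ∑ i, (y i - x i) * (x i + θ * (y i - x i))
      = (1 - θ) * ∑ i, (y i - x i) * (y i - x i) := by
    rw [Finset.mul_sum, ← Finset.sum_sub_distrib]
    exact Finset.sum_congr rfl fun i _ => by ring
  have := mul_pos (sub_pos.2 h4) h2
  linarith

/-- Direction from `v` to `s`, normalized by `g`. -/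
noncomputable def dir (g : (Fin d → ℝ) →ₗ[ℝ] ℝ) (v s : Fin d → ℝ) : Fin d → ℝ :=
  (g v - g s)⁻¹ • (s - v)

open Classical in
/-- The vertex figure. -/
noncomputable def fig (T : Finset (Fin d → ℝ)) (g : (Fin d → ℝ) →ₗ[ℝ] ℝ)
    (v : Fin d → ℝ) : Finset (Fin d → ℝ) := (T.erase v).image (dir g v)

theorem mem_fig {T : Finset (Fin d → ℝ)} {g : (Fin d → ℝ) →ₗ[ℝ] ℝ} {v p : Fin d → ℝ} :
    p ∈ fig T g v ↔ ∃ s, (s ≠ v ∧ s ∈ T) ∧ dir g v s = p := by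
  classical
  simp [fig]

theorem sub_eq_dir {g : (Fin d → ℝ) →ₗ[ℝ] ℝ} {v s : Fin d → ℝ} (h : g s < g v) :
    s - v = (g v - g s) • dir g v s := by
  rw [dir, smul_smul, mul_inv_cancel₀ (by linarith), one_smul]

theorem g_dir {g : (Fin d → ℝ) →ₗ[ℝ] ℝ} {v s : Fin d → ℝ} (h : g s < g v) :
    g (dir g v s) = -1 := by
  have : g v - g s ≠ 0 := by linarith
  simp only [dir, map_smul, map_sub, smul_eq_mul]
  field_simp
  ring

theorem map_eq_dir {g : (Fin d → ℝ) →ₗ[ℝ] ℝ} {v s : Fin d → ℝ} (h : g s < g v)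
    (f : (Fin d → ℝ) →ₗ[ℝ] ℝ) : f s - f v = (g v - g s) * f (dir g v s) := by
  rw [← map_sub, sub_eq_dir h, map_smul, smul_eq_mul]

theorem edge_of_fig {T : Finset (Fin d → ℝ)} {g : (Fin d → ℝ) →ₗ[ℝ] ℝ} {v q : Fin d → ℝ}
    (hv : v ∈ T) (hg : ∀ s ∈ T, s ≠ v → g s < g v) (hq : CV (fig T g v) q) :
    ∃ w, CE T v w ∧ dir g v w = q := by
  classical
  obtain ⟨hq, f, hf⟩ := hq
  obtain ⟨w0, hw0, hw0q⟩ := mem_fig.1 hq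
  obtain ⟨w, hw, hwmin⟩ := ((T.erase v).filter fun s => dir g v s = q).exists_min_image g
    ⟨w0, by simp [hw0, hw0q]⟩
  simp only [Finset.mem_filter, Finset.mem_erase] at hw hwmin
  have hgw := hg w hw.1.2 hw.1.1
  refine ⟨w, ⟨hw.1.1.symm, hv, hw.1.2, f + (f q) • g, ?_, fun s hs => ?_⟩, hw.2⟩
  · have h1 := map_eq_dir hgw (f + (f q) • g)
    have h2 := g_dir hgw
    rw [hw.2] at h1 h2
    rw [LinearMap.add_apply _ _ q, LinearMap.smul_apply, h2] at h1
    simp only [smul_eq_mul] at h1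
    linarith
  · rcases eq_or_ne s v with rfl | hsv
    · exact ⟨le_rfl, fun _ => left_mem_segment ℝ _ _⟩
    have hgs := hg s hs hsv
    have h1 := map_eq_dir hgs (f + (f q) • g)
    have h2 := g_dir hgs
    rw [LinearMap.add_apply _ _ (dir g v s), LinearMap.smul_apply, h2, smul_eq_mul] at h1
    by_cases hsq : dir g v s = q
    · rw [hsq] at h1
      refine ⟨by linarith, fun _ => ?_⟩
      have h3 := hwmin s ⟨⟨hsv, hs⟩, hsq⟩
      rw [segment_eq_image']
      refine ⟨(g v - g s) / (g v - g w), ⟨?_, ?_⟩, ?_⟩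
      · apply div_nonneg <;> linarith
      · rw [div_le_one] <;> linarith
      · simp only
        rw [sub_eq_dir hgw, hw.2, smul_smul, div_mul_cancel₀ _ (by linarith), ← hsq,
          ← sub_eq_dir hgs]
        abel
    · have h3 := hf _ (mem_fig.2 ⟨s, ⟨hsv, hs⟩, rfl⟩) hsq
      have h4 : (g v - g s) * (f (dir g v s) + f q * -1) < 0 :=
        mul_neg_of_pos_of_neg (by linarith) (by linarith)
      exact ⟨by linarith, fun h => by linarith⟩

theorem dir_eq_of_segment {g : (Fin d → ℝ) →ₗ[ℝ] ℝ} {v w s : Fin d → ℝ}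
    (hsv : s ≠ v) (h : s ∈ segment ℝ v w) : dir g v s = dir g v w := by
  rw [segment_eq_image'] at h
  obtain ⟨θ, _, rfl⟩ := h
  have hθ : θ ≠ 0 := fun h => hsv (by simp [h])
  simp only [dir, map_add, map_smul, map_sub, smul_eq_mul, add_sub_cancel_left, smul_smul]
  congr 1
  have : g v - (g v + θ * (g w - g v)) = θ * (g v - g w) := by ring
  rw [this, mul_inv]
  field_simp

theorem fig_of_edge {T : Finset (Fin d → ℝ)} {g : (Fin d → ℝ) →ₗ[ℝ] ℝ} {v w : Fin d → ℝ}
    (hg : ∀ s ∈ T, s ≠ v → g s < g v) (h : CE T v w) : CV (fig T g v) (dir g v w) := by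
  obtain ⟨hne, hv, hw, f, hf, hfs⟩ := h
  refine ⟨mem_fig.2 ⟨w, ⟨hne.symm, hw⟩, rfl⟩, f, fun p hp hpw => ?_⟩
  obtain ⟨s, ⟨hsv, hs⟩, rfl⟩ := mem_fig.1 hp
  have h1 := map_eq_dir (hg w hw hne.symm) f
  have h2 := map_eq_dir (hg s hs hsv) f
  have h3 := hg w hw hne.symm
  have h4 := hg s hs hsv
  have h5 : f (dir g v w) = 0 := by
    rw [← hf, sub_self] at h1
    rcases mul_eq_zero.1 h1.symm with h | h
    · linarith
    · exact h
  rw [h5]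
  have h6 : f s ≠ f v := fun h => hpw (dir_eq_of_segment hsv ((hfs s hs).2 h))
  have h7 := lt_of_le_of_ne (hfs s hs).1 h6
  by_contra hcon
  have := mul_nonneg (sub_nonneg.2 h4.le) (not_lt.1 hcon)
  linarith

theorem edge_unique {T : Finset (Fin d → ℝ)} {g : (Fin d → ℝ) →ₗ[ℝ] ℝ} {v w w' : Fin d → ℝ}
    (hg : ∀ s ∈ T, s ≠ v → g s < g v) (h : CE T v w) (h' : CE T v w')
    (hd : dir g v w = dir g v w') : w = w' := by
  have key : ∀ w w', CE T v w → CE T v w' → dir g v w = dir g v w' → g w ≤ g w' := by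
    intro w w' h h' hd
    obtain ⟨hne, hv, hw, f, hf, hfs⟩ := h
    obtain ⟨hne', _, hw', -⟩ := h'
    have h1 := map_eq_dir (hg w hw hne.symm) f
    have h2 := map_eq_dir (hg w' hw' hne'.symm) f
    have h3 := hg w hw hne.symm
    have h5 : f (dir g v w) = 0 := by
      rw [← hf, sub_self] at h1
      rcases mul_eq_zero.1 h1.symm with h | h
      · linarith
      · exact h
    rw [← hd, h5, mul_zero] at h2
    have h6 := (hfs w' hw').2 (by linarith)
    rw [segment_eq_image'] at h6
    obtain ⟨θ, hθ, rfl⟩ := h6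
    simp only [map_add, map_smul, map_sub, smul_eq_mul]
    nlinarith [hθ.1, hθ.2]
  have h1 := le_antisymm (key _ _ h h' hd) (key _ _ h' h hd.symm)
  have h2 := sub_eq_dir (hg w h.2.2.1 h.1.symm)
  have h3 := sub_eq_dir (hg w' h'.2.2.1 h'.1.symm)
  rw [← hd, ← h1, ← h2] at h3
  exact (sub_left_inj.1 h3).symm

/-- One step of the simplex method. -/
theorem simplex_step {T : Finset (Fin d → ℝ)} {v s : Fin d → ℝ} (f : (Fin d → ℝ) →ₗ[ℝ] ℝ)
    (hv : CV T v) (hs : s ∈ T) (hfs : f v < f s) : ∃ w, CE T v w ∧ f v < f w := by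
  obtain ⟨hv, g, hg⟩ := hv
  have hsv : s ≠ v := by rintro rfl; exact lt_irrefl _ hfs
  have hsm : dir g v s ∈ fig T g v := mem_fig.2 ⟨s, ⟨hsv, hs⟩, rfl⟩
  obtain ⟨q, hq⟩ := exists_CV (face_nonempty ⟨_, hsm⟩ f)
  have h1 := (mem_face.1 hq.1).2 _ hsm
  obtain ⟨w, hw, rfl⟩ := edge_of_fig hv hg hq.of_face
  refine ⟨w, hw, ?_⟩
  have hgs := hg s hs hsv
  have hgw := hg w hw.2.2.1 hw.1.symm
  have h2 := map_eq_dir hgs f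
  have h3 := map_eq_dir hgw f
  have h4 : 0 < f (dir g v s) := by
    by_contra hcon
    have := mul_nonneg (sub_nonneg.2 hgs.le) (neg_nonneg.2 (not_lt.1 hcon))
    linarith
  have := mul_pos (sub_pos.2 hgw) (h4.trans_le h1)
  linarith

/-- The simplex method. -/
theorem simplex_path {T : Finset (Fin d → ℝ)} (f : (Fin d → ℝ) →ₗ[ℝ] ℝ) :
    ∀ (n : ℕ) (v : Fin d → ℝ), (T.filter fun s => f v < f s).card = n → CV T v →
    ∃ t, CV T t ∧ t ∈ face T f ∧ Relation.ReflTransGen (fun x y => CE T x y ∧ f x < f y) v t := by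
  intro n
  induction n using Nat.strong_induction_on with
  | _ n ih =>
  intro v hn hv
  by_cases h : ∃ s ∈ T, f v < f s
  · obtain ⟨s, hs, hfs⟩ := h
    obtain ⟨w, hw, hfw⟩ := simplex_step f hv hs hfs
    have : (T.filter fun s => f w < f s).card < n := by
      rw [← hn]
      apply Finset.card_lt_card
      refine Finset.ssubset_iff_of_subset ?_ |>.2 ⟨w, ?_, ?_⟩
      · intro s hs
        simp only [Finset.mem_filter] at hs ⊢
        exact ⟨hs.1, hfw.trans hs.2⟩
      · simp [hw.2.2.1, hfw]
      · simp
    obtain ⟨t, h1, h2, h3⟩ := ih _ this w rfl hw.right_CV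
    exact ⟨t, h1, h2, Relation.ReflTransGen.head ⟨hw, hfw⟩ h3⟩
  · push Not at h
    exact ⟨v, hv, mem_face.2 ⟨hv.1, h⟩, .refl⟩

/-- The part of the graph with `L > 0` is connected. -/
theorem pos_connected {T : Finset (Fin d → ℝ)} (L : (Fin d → ℝ) →ₗ[ℝ] ℝ) {p q : Fin d → ℝ}
    (hp : CV T p) (hq : CV T q) (hLp : 0 < L p) (hLq : 0 < L q) :
    Relation.ReflTransGen (fun x y => CE T x y ∧ 0 < L x ∧ 0 < L y) p q := by
  have hsymm : Std.Symm (fun x y => CE T x y ∧ 0 < L x ∧ 0 < L y) :=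
    ⟨fun x y h => ⟨h.1.symm, h.2.2, h.2.1⟩⟩
  obtain ⟨z, hz⟩ := exists_CV (face_nonempty ⟨p, hp.1⟩ L)
  obtain ⟨hzm, h, hh⟩ := hz
  have key : ∀ p, CV T p → 0 < L p →
      Relation.ReflTransGen (fun x y => CE T x y ∧ 0 < L x ∧ 0 < L y) p z := by
    intro p hp hLp
    obtain ⟨t, h1, h2, h3⟩ := simplex_path L _ p rfl hp
    have hLt : 0 < L t := hLp.trans_le ((mem_face.1 h2).2 _ hp.1)
    have h4 : Relation.ReflTransGen (fun x y => CE T x y ∧ 0 < L x ∧ 0 < L y) p t := by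
      have : Relation.ReflTransGen (fun x y => CE T x y ∧ 0 < L x ∧ 0 < L y) p t ∧ 0 < L t := by
        clear h2 hLt h1
        induction h3 with
        | refl => exact ⟨.refl, hLp⟩
        | tail _ h ih =>
          have := ih.2.trans h.2
          exact ⟨ih.1.tail ⟨h.1, ih.2, this⟩, this⟩
      exact this.1
    refine h4.trans ?_
    obtain ⟨t', h5, h6, h7⟩ := simplex_path h _ t rfl (h1.to_face h2)
    have : t' = z := by
      by_contra hne
      have := hh t' h5.1 hne
      have := (mem_face.1 h6).2 z hzm
      linarith
    subst this
    refine Relation.ReflTransGen.mono (fun x y hxy => ?_) _ _ h7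
    refine ⟨hxy.1.of_face, ?_, ?_⟩
    · rw [face_eq hxy.1.2.1 h2]; exact hLt
    · rw [face_eq hxy.1.2.2.1 h2]; exact hLt
  exact (key p hp hLp).trans (symm (key q hq hLq))

theorem isExposed_face (T : Finset (Fin d → ℝ)) (f : (Fin d → ℝ) →ₗ[ℝ] ℝ) :
    IsExposed ℝ (convexHull ℝ (T : Set (Fin d → ℝ)))
      (convexHull ℝ (face T f : Set (Fin d → ℝ))) := by
  classical
  intro hne
  obtain ⟨t, ht⟩ := convexHull_nonempty_iff.1 hne
  have ht' := mem_face.1 (Finset.mem_coe.1 ht)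
  have hle : ∀ y ∈ convexHull ℝ (T : Set (Fin d → ℝ)), f y ≤ f t := by
    intro y hy
    exact convexHull_min (t := {y | f y ≤ f t}) (fun s hs => ht'.2 s hs)
      (convex_halfSpace_le f.isLinear _) hy
  refine ⟨LinearMap.toContinuousLinearMap f, Set.ext fun x => ⟨fun hx => ⟨?_, fun y hy => ?_⟩,
    fun hx => ?_⟩⟩
  · exact convexHull_mono (fun s hs => (mem_face.1 (Finset.mem_coe.1 hs)).1) hx
  · have : f t ≤ f x := convexHull_min (t := {y | f t ≤ f y})
      (fun s hs => (face_eq (Finset.mem_coe.1 ht) (Finset.mem_coe.1 hs)).le)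
      (convex_halfSpace_ge f.isLinear _) hx
    exact (hle y hy).trans this
  · obtain ⟨hxT, hx⟩ := hx
    have hxt : f x = f t :=
      le_antisymm (hle x hxT) (hx t (subset_convexHull ℝ _ ht'.1))
    obtain ⟨w, hw0, hw1, hwx⟩ := Finset.mem_convexHull'.1 hxT
    have hz : ∀ s ∈ T, w s * (f t - f s) = 0 := by
      have hsum : ∑ s ∈ T, w s * (f t - f s) = 0 := by
        have : f x = ∑ s ∈ T, w s * f s := by simp [← hwx]
        simp only [mul_sub, Finset.sum_sub_distrib, ← Finset.sum_mul, hw1, ← this]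
        linarith
      exact (Finset.sum_eq_zero_iff_of_nonneg fun s hs =>
        mul_nonneg (hw0 s hs) (sub_nonneg.2 (ht'.2 s hs))).1 hsum
    have hz' : ∀ s ∈ T, s ∉ face T f → w s = 0 := by
      intro s hs hsf
      rcases mul_eq_zero.1 (hz s hs) with h | h
      · exact h
      · have := face_lt (Finset.mem_coe.1 ht) hs hsf
        linarith
    have hsub : face T f ⊆ T := fun s hs => (mem_face.1 hs).1
    refine Finset.mem_convexHull'.2 ⟨w, fun y hy => hw0 y (hsub hy), ?_, ?_⟩
    · rw [Finset.sum_subset hsub hz', hw1]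
    · rw [Finset.sum_subset hsub fun s hs hsf => by rw [hz' s hs hsf, zero_smul], hwx]

theorem CV.extreme {T : Finset (Fin d → ℝ)} {x : Fin d → ℝ} (h : CV T x) :
    x ∈ (convexHull ℝ (T : Set (Fin d → ℝ))).extremePoints ℝ := by
  obtain ⟨hx, f, hf⟩ := h
  have hxf : x ∈ face T f := by
    refine mem_face.2 ⟨hx, fun s hs => ?_⟩
    rcases eq_or_ne s x with rfl | hsx
    · exact le_rfl
    · exact (hf s hs hsx).le
  have h1 : face T f = {x} := by
    ext s
    rw [Finset.mem_singleton]
    refine ⟨fun hs => ?_, fun hs => hs ▸ hxf⟩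
    by_contra hsx
    exact (hf s (mem_face.1 hs).1 hsx).ne (face_eq hs hxf)
  have h2 := (isExposed_face T f).isExtreme
  rw [h1, Finset.coe_singleton, convexHull_singleton] at h2
  exact h2.extremePoints_subset_extremePoints (by simp)

theorem CE.pedge {T : Finset (Fin d → ℝ)} {x y : Fin d → ℝ} (h : CE T x y) :
    PEdge (convexHull ℝ (T : Set (Fin d → ℝ))) x y := by
  obtain ⟨hne, hx, hy, f, hxy, hf⟩ := h
  refine ⟨hne, ?_⟩
  have hxf : x ∈ face T f := mem_face.2 ⟨hx, fun s hs => (hf s hs).1⟩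
  have hyf : y ∈ face T f := mem_face.2 ⟨hy, fun s hs => hxy ▸ (hf s hs).1⟩
  have : segment ℝ x y = convexHull ℝ (face T f : Set (Fin d → ℝ)) := by
    apply Set.Subset.antisymm
    · rw [← convexHull_pair]
      apply convexHull_mono
      rintro z (rfl | rfl)
      · exact hxf
      · exact hyf
    · apply convexHull_min _ (convex_segment x y)
      intro s hs
      exact (hf s (mem_face.1 hs).1).2 (face_eq hs hxf)
  rw [this]
  exact isExposed_face T f

theorem CE.of_pedge {T : Finset (Fin d → ℝ)} {x y : Fin d → ℝ}
    (h : PEdge (convexHull ℝ (T : Set (Fin d → ℝ))) x y) : CE T x y := by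
  obtain ⟨hne, hexp⟩ := h
  have hext := hexp.isExtreme
  classical
  have hce : CE {x, y} x y := by
    refine ⟨hne, by simp, by simp, 0, by simp, fun s hs => ⟨by simp, fun _ => ?_⟩⟩
    rcases Finset.mem_insert.1 hs with rfl | hs
    · exact left_mem_segment ℝ _ _
    · rw [Finset.mem_singleton.1 hs]
      exact right_mem_segment ℝ _ _
  have hsx := hce.symm.right_CV.extreme
  have hsy := hce.right_CV.extreme
  rw [Finset.coe_pair, convexHull_pair] at hsx hsy
  have hx : x ∈ T := extremePoints_convexHull_subset (hext.extremePoints_subset_extremePoints hsx)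
  have hy : y ∈ T := extremePoints_convexHull_subset (hext.extremePoints_subset_extremePoints hsy)
  obtain ⟨f, hf⟩ := hexp ⟨x, left_mem_segment ℝ x y⟩
  have hxm : x ∈ segment ℝ x y := left_mem_segment ℝ x y
  have hym : y ∈ segment ℝ x y := right_mem_segment ℝ x y
  rw [hf] at hxm hym
  have hT : ∀ s ∈ T, s ∈ convexHull ℝ (T : Set (Fin d → ℝ)) := fun s hs => subset_convexHull ℝ _ hs
  refine ⟨hne, hx, hy, f.toLinearMap, le_antisymm (hym.2 x hxm.1) (hxm.2 y hym.1),
    fun s hs => ⟨hxm.2 s (hT s hs), fun h => ?_⟩⟩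
  rw [hf]
  refine ⟨hT s hs, fun z hz => ?_⟩
  have h' : f s = f x := h
  rw [h']
  exact hxm.2 z hz

theorem CV.of_pvertex {T : Finset (Fin d → ℝ)} {x : Fin d → ℝ}
    (h : PVertex (convexHull ℝ (T : Set (Fin d → ℝ))) x) : CV T x := by
  have hx : x ∈ T := extremePoints_convexHull_subset
    (IsExtreme.extremePoints_subset_extremePoints (IsExposed.isExtreme h) (by simp))
  obtain ⟨f, hf⟩ := h ⟨x, rfl⟩
  have hxm : x ∈ ({x} : Set (Fin d → ℝ)) := rfl
  rw [hf] at hxm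
  have hT : ∀ s ∈ T, s ∈ convexHull ℝ (T : Set (Fin d → ℝ)) := fun s hs => subset_convexHull ℝ _ hs
  refine ⟨hx, f.toLinearMap, fun s hs hsx => lt_of_le_of_ne (hxm.2 s (hT s hs)) fun h => hsx ?_⟩
  have h' : f s = f x := h
  have : s ∈ ({x} : Set (Fin d → ℝ)) := by
    rw [hf]
    refine ⟨hT s hs, fun z hz => ?_⟩
    rw [h']
    exact hxm.2 z hz
  exact this

/-- An edge of the vertex figure gives a 2-face. -/
theorem face_of_fig_edge {T : Finset (Fin d → ℝ)} {g : (Fin d → ℝ) →ₗ[ℝ] ℝ}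
    {v p q : Fin d → ℝ} (hv : v ∈ T) (hg : ∀ s ∈ T, s ≠ v → g s < g v)
    (h : CE (fig T g v) p q) :
    ∃ f, P2Face (convexHull ℝ (T : Set (Fin d → ℝ)))
        (convexHull ℝ (face T f : Set (Fin d → ℝ))) ∧
      v ∈ face T f ∧
      ∀ s ∈ T, s ≠ v → (dir g v s = p ∨ dir g v s = q) → s ∈ face T f := by
  obtain ⟨hne, hp, hq, f, hpq, hf⟩ := h
  have key : ∀ s ∈ T, s ≠ v → (f + f p • g) s - (f + f p • g) v
      = (g v - g s) * (f (dir g v s) - f p) := by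
    intro s hs hsv
    have hgs := hg s hs hsv
    rw [map_eq_dir hgs, LinearMap.add_apply, LinearMap.smul_apply, g_dir hgs, smul_eq_mul]
    ring
  have hvf : v ∈ face T (f + f p • g) := by
    refine mem_face.2 ⟨hv, fun s hs => ?_⟩
    rcases eq_or_ne s v with rfl | hsv
    · exact le_rfl
    have h1 := key s hs hsv
    have h2 := (hf _ (mem_fig.2 ⟨s, ⟨hsv, hs⟩, rfl⟩)).1
    have h3 := hg s hs hsv
    have := mul_nonneg (sub_nonneg.2 h3.le) (sub_nonneg.2 h2)
    linarith
  have hmem : ∀ s ∈ T, s ≠ v → (dir g v s = p ∨ dir g v s = q) → s ∈ face T (f + f p • g) := by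
    intro s hs hsv hspq
    have h1 := key s hs hsv
    have h2 : f (dir g v s) = f p := by
      rcases hspq with h | h
      · rw [h]
      · rw [h, hpq]
    rw [h2, sub_self, mul_zero] at h1
    refine mem_face.2 ⟨hs, fun t ht => ?_⟩
    have := (mem_face.1 hvf).2 t ht
    linarith
  refine ⟨f + f p • g, ⟨isExposed_face _ _, ?_⟩, hvf, hmem⟩
  have hgp : ∀ p ∈ fig T g v, g p = -1 := by
    intro p hp
    obtain ⟨s, ⟨hsv, hs⟩, rfl⟩ := mem_fig.1 hp
    exact g_dir (hg s hs hsv)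
  have hli : LinearIndependent ℝ ![p, q] := by
    rw [LinearIndependent.pair_iff]
    intro a b hab
    have h1 := congrArg g hab
    simp only [map_add, map_smul, hgp p hp, hgp q hq, smul_eq_mul, map_zero] at h1
    have hb : b = -a := by linarith
    subst hb
    have h2 : a • (p - q) = 0 := by
      rw [smul_sub, ← hab, neg_smul, sub_eq_add_neg]
    rcases smul_eq_zero.1 h2 with h | h
    · simp [h]
    · exact absurd (sub_eq_zero.1 h) hne
  have hspan : vectorSpan ℝ (convexHull ℝ (face T (f + f p • g) : Set (Fin d → ℝ)))
      = Submodule.span ℝ (Set.range ![p, q]) := by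
    rw [← direction_affineSpan, affineSpan_convexHull, direction_affineSpan,
      vectorSpan_eq_span_vsub_set_right ℝ (Finset.mem_coe.2 hvf)]
    apply le_antisymm
    · rw [Submodule.span_le]
      rintro _ ⟨s, hs, rfl⟩
      have hs' := mem_face.1 (Finset.mem_coe.1 hs)
      simp only [vsub_eq_sub]
      rcases eq_or_ne s v with rfl | hsv
      · simp
      have hgs := hg s hs'.1 hsv
      rw [sub_eq_dir hgs]
      apply Submodule.smul_mem
      have h1 := key s hs'.1 hsv
      rw [face_eq hs hvf, sub_self] at h1
      have h2 : f (dir g v s) = f p := by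
        rcases mul_eq_zero.1 h1.symm with h | h <;> linarith
      have h3 := (hf _ (mem_fig.2 ⟨s, ⟨hsv, hs'.1⟩, rfl⟩)).2 h2
      obtain ⟨a, b, _, _, _, hab⟩ := h3
      rw [← hab]
      exact Submodule.add_mem _
        (Submodule.smul_mem _ _ (Submodule.subset_span ⟨0, rfl⟩))
        (Submodule.smul_mem _ _ (Submodule.subset_span ⟨1, rfl⟩))
    · rw [Submodule.span_le]
      have aux : ∀ r ∈ fig T g v, (r = p ∨ r = q) → r ∈ Submodule.span ℝ
          ((fun x => x -ᵥ v) '' (face T (f + f p • g) : Set (Fin d → ℝ))) := by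
        intro r hr hrpq
        obtain ⟨s, ⟨hsv, hs⟩, rfl⟩ := mem_fig.1 hr
        exact Submodule.smul_mem _ _ (Submodule.subset_span ⟨s, hmem s hs hsv hrpq, rfl⟩)
      rintro _ ⟨i, rfl⟩
      fin_cases i
      · exact aux p hp (Or.inl rfl)
      · exact aux q hq (Or.inr rfl)
  rw [hspan, finrank_span_eq_card hli]
  simp

theorem PIncrPath.cons' {P : Set (Fin d → ℝ)} {L : (Fin d → ℝ) →ₗ[ℝ] ℝ}
    {u v ω : Fin d → ℝ} {m : List (Fin d → ℝ)} (hm : PIncrPath P L v ω m)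
    (h : PEdge P u v ∧ L u < L v) : PIncrPath P L u ω (u :: m) := by
  obtain ⟨h1, h2, h3⟩ := hm
  cases m with
  | nil => simp at h1
  | cons a m =>
    simp only [List.head?_cons, Option.some.injEq] at h1
    subst h1
    refine ⟨rfl, ?_, List.isChain_cons_cons.2 ⟨h, h3⟩⟩
    rw [List.getLast?_cons_cons]
    exact h2

theorem PIncrPath.append' {P : Set (Fin d → ℝ)} {L : (Fin d → ℝ) →ₗ[ℝ] ℝ}
    {t ω : Fin d → ℝ} {r : List (Fin d → ℝ)} (hr : PIncrPath P L t ω (t :: r)) :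
    ∀ (a : List (Fin d → ℝ)) (v : Fin d → ℝ), PIncrPath P L v t (v :: a) →
      PIncrPath P L v ω (v :: a ++ r) := by
  intro a
  induction a with
  | nil =>
    intro v hv
    have : v = t := by simpa using hv.2.1
    subst this
    exact hr
  | cons b a ih =>
    intro v hv
    obtain ⟨_, h2, h3⟩ := hv
    have h4 := List.isChain_cons_cons.1 h3
    rw [List.getLast?_cons_cons] at h2
    exact PIncrPath.cons' (ih b ⟨rfl, h2, h4.2⟩) h4.1

theorem path_of_rtg {P : Set (Fin d → ℝ)} {L : (Fin d → ℝ) →ₗ[ℝ] ℝ}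
    {R : (Fin d → ℝ) → (Fin d → ℝ) → Prop} {Q : (Fin d → ℝ) → Prop}
    (hR : ∀ x y, R x y → (PEdge P x y ∧ L x < L y) ∧ Q x) {v t : Fin d → ℝ}
    (ht : Q t) (h : Relation.ReflTransGen R v t) :
    ∃ l, PIncrPath P L v t (v :: l) ∧ ∀ x ∈ v :: l, Q x := by
  induction h using Relation.ReflTransGen.head_induction_on with
  | refl => exact ⟨[], ⟨rfl, rfl, List.isChain_singleton _⟩, by simpa using ht⟩
  | head h _ ih =>
    obtain ⟨l, h1, h2⟩ := ih
    refine ⟨_ :: l, PIncrPath.cons' h1 (hR _ _ h).1, ?_⟩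
    rw [List.forall_mem_cons]
    exact ⟨(hR _ _ h).2, h2⟩

theorem FaceStep.cons' {P : Set (Fin d → ℝ)} {L : (Fin d → ℝ) →ₗ[ℝ] ℝ}
    {u v ω : Fin d → ℝ} {m m' : List (Fin d → ℝ)}
    (h : PEdge P u v ∧ L u < L v) (hm : FaceStep P L v ω m m') :
    FaceStep P L u ω (u :: m) (u :: m') := by
  obtain ⟨h1, h2, pre, mid, mid', suf, Fc, h3, h4, h5, h6, h7⟩ := hm
  refine ⟨PIncrPath.cons' h1 h, PIncrPath.cons' h2 h, u :: pre, mid, mid', suf, Fc, h3, ?_, ?_,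
    h6, h7⟩
  · simp [h4]
  · simp [h5]

theorem rtg_cons {P : Set (Fin d → ℝ)} {L : (Fin d → ℝ) →ₗ[ℝ] ℝ}
    {u v ω : Fin d → ℝ} {m m' : List (Fin d → ℝ)}
    (h : PEdge P u v ∧ L u < L v) (hm : Relation.ReflTransGen (FaceStep P L v ω) m m') :
    Relation.ReflTransGen (FaceStep P L u ω) (u :: m) (u :: m') :=
  Relation.ReflTransGen.lift (fun m => u :: m) (fun _ _ h' => FaceStep.cons' h h') _ _ hm

/-- The vertex of a face maximizing `L` is unique. -/
theorem top_unique {T : Finset (Fin d → ℝ)} {L : (Fin d → ℝ) →ₗ[ℝ] ℝ}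
    (hL : ∀ x y, CE T x y → L x ≠ L y) {t t' : Fin d → ℝ}
    (ht : CV T t) (ht' : CV T t') (h : t ∈ face T L) (h' : t' ∈ face T L) : t = t' := by
  by_contra hne
  obtain ⟨_, k, hk⟩ := ht'.to_face h'
  obtain ⟨w, hw, _⟩ := simplex_step k (ht.to_face h) h' (hk t h hne)
  exact hL _ _ hw.of_face (face_eq hw.2.1 hw.2.2.1)

theorem main {S : Finset (Fin d → ℝ)} (L : (Fin d → ℝ) →ₗ[ℝ] ℝ)
    (hL : ∀ x y : Fin d → ℝ, PEdge (convexHull ℝ (S : Set (Fin d → ℝ))) x y → L x ≠ L y)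
    {ω : Fin d → ℝ} (hω : CV S ω)
    (hmax : ∀ x ∈ convexHull ℝ (S : Set (Fin d → ℝ)), L x ≤ L ω) :
    ∀ (n : ℕ) (v : Fin d → ℝ), (S.filter fun s => L v < L s).card = n → CV S v →
    ∀ l₁ l₂, PIncrPath (convexHull ℝ (S : Set (Fin d → ℝ))) L v ω l₁ →
      PIncrPath (convexHull ℝ (S : Set (Fin d → ℝ))) L v ω l₂ →
      Relation.ReflTransGen (FaceStep (convexHull ℝ (S : Set (Fin d → ℝ))) L v ω) l₁ l₂ := by
  intro n
  induction n using Nat.strong_induction_on with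
  | _ n ih =>
  intro v hn hv l₁ l₂ h₁ h₂
  have hT : ∀ s ∈ S, s ∈ convexHull ℝ (S : Set (Fin d → ℝ)) := fun s hs => subset_convexHull ℝ _ hs
  have hLC : ∀ x y, CE S x y → L x ≠ L y := fun x y h => hL x y h.pedge
  have ih' : ∀ w, CE S v w → L v < L w → ∀ m m',
      PIncrPath (convexHull ℝ (S : Set (Fin d → ℝ))) L w ω m →
      PIncrPath (convexHull ℝ (S : Set (Fin d → ℝ))) L w ω m' →
      Relation.ReflTransGen (FaceStep (convexHull ℝ (S : Set (Fin d → ℝ))) L v ω)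
        (v :: m) (v :: m') := by
    intro w hw hfw m m' hm hm'
    have : (S.filter fun s => L w < L s).card < n := by
      rw [← hn]
      apply Finset.card_lt_card
      refine Finset.ssubset_iff_of_subset ?_ |>.2 ⟨w, ?_, ?_⟩
      · intro s hs
        simp only [Finset.mem_filter] at hs ⊢
        exact ⟨hs.1, hfw.trans hs.2⟩
      · simp [hw.2.2.1, hfw]
      · simp
    exact rtg_cons ⟨hw.pedge, hfw⟩ (ih _ this w rfl hw.right_CV m m' hm hm')
  have decomp : ∀ l, PIncrPath (convexHull ℝ (S : Set (Fin d → ℝ))) L v ω l →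
      (v = ω ∧ l = [v]) ∨ ∃ w m, l = v :: m ∧ CE S v w ∧ L v < L w ∧
        PIncrPath (convexHull ℝ (S : Set (Fin d → ℝ))) L w ω m := by
    intro l hl
    obtain ⟨h1, h2, h3⟩ := hl
    match l, h1, h2, h3 with
    | [], h1, _, _ => simp at h1
    | [a], h1, h2, _ =>
      simp only [List.head?_cons, Option.some.injEq] at h1
      simp only [List.getLast?_singleton, Option.some.injEq] at h2
      subst h1
      exact Or.inl ⟨h2, rfl⟩
    | a :: b :: l, h1, h2, h3 =>
      simp only [List.head?_cons, Option.some.injEq] at h1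
      subst h1
      rw [List.getLast?_cons_cons] at h2
      have h4 := List.isChain_cons_cons.1 h3
      exact Or.inr ⟨b, b :: l, rfl, CE.of_pedge h4.1.1, h4.1.2, rfl, h2, h4.2⟩
  rcases decomp l₁ h₁ with ⟨hvω, rfl⟩ | ⟨w₁, m₁, rfl, hw₁, hLw₁, hm₁⟩
  · rcases decomp l₂ h₂ with ⟨_, rfl⟩ | ⟨w₂, m₂, rfl, hw₂, hLw₂, hm₂⟩
    · exact .refl
    · have := hmax w₂ (hT _ hw₂.2.2.1)
      rw [← hvω] at this
      linarith
  rcases decomp l₂ h₂ with ⟨hvω, rfl⟩ | ⟨w₂, m₂, rfl, hw₂, hLw₂, hm₂⟩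
  · have := hmax w₁ (hT _ hw₁.2.2.1)
    rw [← hvω] at this
    linarith
  obtain ⟨hvS, g, hg⟩ := id hv
  have hpos : ∀ w, CE S v w → (0 < L (dir g v w) ↔ L v < L w) := by
    intro w hw
    have hgw := hg w hw.2.2.1 hw.1.symm
    have h1 := map_eq_dir hgw L
    rw [← sub_pos (a := L w), h1]
    exact (mul_pos_iff_of_pos_left (sub_pos.2 hgw)).symm
  have hωtop : ∀ t, CV S t → ∃ r,
      PIncrPath (convexHull ℝ (S : Set (Fin d → ℝ))) L t ω (t :: r) := by
    intro t ht
    obtain ⟨z, hz, hzF, htz⟩ := simplex_path L _ t rfl ht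
    have hzω : z = ω := top_unique hLC hz hω hzF
      (mem_face.2 ⟨hω.1, fun s hs => hmax s (hT s hs)⟩)
    subst hzω
    obtain ⟨r, hr, _⟩ := path_of_rtg (Q := fun _ => True)
      (fun x y (h : CE S x y ∧ L x < L y) => ⟨⟨h.1.pedge, h.2⟩, trivial⟩) trivial htz
    exact ⟨r, hr⟩
  have hconn := pos_connected L (fig_of_edge hg hw₁) (fig_of_edge hg hw₂)
    ((hpos _ hw₁).2 hLw₁) ((hpos _ hw₂).2 hLw₂)
  suffices H : ∀ q, Relation.ReflTransGen
      (fun x y => CE (fig S g v) x y ∧ 0 < L x ∧ 0 < L y) (dir g v w₁) q →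
      ∀ w m, CE S v w → L v < L w → dir g v w = q →
        PIncrPath (convexHull ℝ (S : Set (Fin d → ℝ))) L w ω m →
        Relation.ReflTransGen (FaceStep (convexHull ℝ (S : Set (Fin d → ℝ))) L v ω)
          (v :: m₁) (v :: m) from H _ hconn w₂ m₂ hw₂ hLw₂ rfl hm₂
  intro q hq
  induction hq with
  | refl =>
    intro w m hw hLw hd hm
    have := edge_unique hg hw hw₁ hd
    subst this
    exact ih' _ hw hLw _ _ hm₁ hm
  | @tail p q _ hpq ihp =>
    intro w m hw hLw hd hm
    obtain ⟨u, hu, hup⟩ := edge_of_fig hvS hg hpq.1.symm.right_CV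
    have hLu : L v < L u := (hpos _ hu).1 (hup ▸ hpq.2.1)
    obtain ⟨f, hF, hvF, hmem⟩ := face_of_fig_edge hvS hg hpq.1
    have huF := hmem u hu.2.2.1 hu.1.symm (Or.inl hup)
    have hwF := hmem w hw.2.2.1 hw.1.symm (Or.inr hd)
    obtain ⟨t, ht, htF, hut⟩ := simplex_path L _ u rfl (hu.right_CV.to_face huF)
    obtain ⟨t', ht', htF', hwt⟩ := simplex_path L _ w rfl (hw.right_CV.to_face hwF)
    have htt : t = t' := top_unique (fun x y h => hLC x y h.of_face) ht ht' htF htF'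
    subst htt
    have hR : ∀ x y, (CE (face S f) x y ∧ L x < L y) →
        (PEdge (convexHull ℝ (S : Set (Fin d → ℝ))) x y ∧ L x < L y) ∧
          x ∈ convexHull ℝ (face S f : Set (Fin d → ℝ)) := fun x y h =>
      ⟨⟨h.1.of_face.pedge, h.2⟩, subset_convexHull ℝ _ h.1.2.1⟩
    have htc : t ∈ convexHull ℝ (face S f : Set (Fin d → ℝ)) := subset_convexHull ℝ _ ht.1
    obtain ⟨a, ha, haF⟩ := path_of_rtg hR htc hut
    obtain ⟨b, hb, hbF⟩ := path_of_rtg hR htc hwt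
    obtain ⟨r, hr⟩ := hωtop t ht.of_face
    have hpa := PIncrPath.append' hr _ _ ha
    have hpb := PIncrPath.append' hr _ _ hb
    refine ((ihp u _ hu hLu hup hpa).tail ?_).trans (ih' w hw hLw _ _ hpb hm)
    have hvc : v ∈ convexHull ℝ (face S f : Set (Fin d → ℝ)) := subset_convexHull ℝ _ hvF
    refine ⟨PIncrPath.cons' hpa ⟨hu.pedge, hLu⟩, PIncrPath.cons' hpb ⟨hw.pedge, hLw⟩,
      [], v :: u :: a, v :: w :: b, r, _, hF, rfl, rfl, ?_, ?_⟩
    · exact List.forall_mem_cons.2 ⟨hvc, haF⟩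
    · exact List.forall_mem_cons.2 ⟨hvc, hbF⟩

end MonoPath

/-- Let `P` be a convex polytope, `L` a linear functional not constant
on any edge, `α` a vertex and `ω` the vertex where `L` attains its maximum over `P`.
Then any two strictly `L`-increasing paths from `α` to `ω` can be transformed into each
other by finitely many steps, each a transformation within a single 2-dimensional face
of `P`. -/
theorem increasing_paths_connected_by_facewise_moves {d : ℕ} (S : Finset (Fin d → ℝ))
    (P : Set (Fin d → ℝ)) (hP : P = convexHull ℝ (S : Set (Fin d → ℝ)))
    (L : (Fin d → ℝ) →ₗ[ℝ] ℝ)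
    (hL : ∀ x y : Fin d → ℝ, PEdge P x y → L x ≠ L y)
    (α ω : Fin d → ℝ) (hα : PVertex P α) (hω : PVertex P ω)
    (hmax : ∀ x ∈ P, L x ≤ L ω)
    (l₁ l₂ : List (Fin d → ℝ))
    (h₁ : PIncrPath P L α ω l₁) (h₂ : PIncrPath P L α ω l₂) :
    Relation.ReflTransGen (FaceStep P L α ω) l₁ l₂ := by
  subst hP
  exact MonoPath.main L hL (MonoPath.CV.of_pvertex hω) hmax _ α rfl (MonoPath.CV.of_pvertex hα) _ _ h₁ h₂
end
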